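/- arXiv:1810.03881 — 5 statements merged into one kernel-verified Lean document; each statement's English description precedes it below -/
import Mathlib

section
/- Let p be an odd prime, k ≥ 1 and n ≥ 1, and let B be an n×n symmetric matrix over ℤ/p^kℤ whose determinant is a unit. Then there exists an invertible n×n matrix U over ℤ/p^kℤ such that Uᵀ B U is the diagonal matrix diag(c, 1, …, 1) for some unit c ∈ ℤ/p^kℤ, where c = 1 if det B is a square in ℤ/p^kℤ, and c is a non-square unit of ℤ/p^kℤ if det B is not a square in ℤ/p^kℤ. -/
open Matrix

namespace Stmt4Aux

/-- congruence of matrices -/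
def Cong {R ι : Type*} [CommRing R] [Fintype ι] [DecidableEq ι] (B B' : Matrix ι ι R) : Prop :=
  ∃ U : Matrix ι ι R, IsUnit U.det ∧ Uᵀ * B * U = B'

section
variable {R ι κ : Type*} [CommRing R] [Fintype ι] [DecidableEq ι] [Fintype κ] [DecidableEq κ]

theorem Cong.trans {A B C : Matrix ι ι R} (h : Cong A B) (h' : Cong B C) : Cong A C := by
  obtain ⟨U, hU, rfl⟩ := h
  obtain ⟨V, hV, rfl⟩ := h'
  refine ⟨U * V, by rw [det_mul]; exact hU.mul hV, ?_⟩
  simp only [transpose_mul, Matrix.mul_assoc]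

theorem Cong.symm {A B : Matrix ι ι R} (h : Cong A B) : Cong B A := by
  obtain ⟨U, hU, rfl⟩ := h
  refine ⟨U⁻¹, ?_, ?_⟩
  · exact isUnit_nonsing_inv_det U hU
  · have h1 : U * U⁻¹ = 1 := mul_nonsing_inv U hU
    have h2 : (U⁻¹)ᵀ * Uᵀ = 1 := by rw [← transpose_mul, h1, transpose_one]
    calc (U⁻¹)ᵀ * (Uᵀ * A * U) * U⁻¹ = ((U⁻¹)ᵀ * Uᵀ) * A * (U * U⁻¹) := by
          simp only [Matrix.mul_assoc]
      _ = A := by rw [h1, h2]; simp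

theorem Cong.reindex {A B : Matrix ι ι R} (h : Cong A B) (e : κ ≃ ι) :
    Cong (A.submatrix e e) (B.submatrix e e) := by
  obtain ⟨U, hU, rfl⟩ := h
  refine ⟨U.submatrix e e, by rwa [det_submatrix_equiv_self], ?_⟩
  rw [transpose_submatrix, submatrix_mul_equiv, submatrix_mul_equiv]

theorem Cong.perm (A : Matrix ι ι R) (e : ι ≃ ι) : Cong A (A.submatrix e e) := by
  refine ⟨(1 : Matrix ι ι R).submatrix id e, ?_, ?_⟩
  · rw [det_permute']
    simp only [det_one, mul_one]
    exact (Units.isUnit (Equiv.Perm.sign e)).map (Int.castRingHom R)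
  · ext i j
    simp [Matrix.mul_apply, Matrix.one_apply]

theorem Cong.det {A B : Matrix ι ι R} (h : Cong A B) :
    ∃ u : R, IsUnit u ∧ B.det = A.det * (u * u) := by
  obtain ⟨U, hU, rfl⟩ := h
  exact ⟨U.det, hU, by simp; ring⟩

theorem Cong.isSymm {A B : Matrix ι ι R} (h : Cong A B) (hA : A.IsSymm) : B.IsSymm := by
  obtain ⟨U, hU, rfl⟩ := h
  unfold IsSymm at *
  simp [hA, Matrix.mul_assoc]

theorem Cong.blocks {A B : Matrix ι ι R} {C D : Matrix κ κ R} (h : Cong A B) (h' : Cong C D) :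
    Cong (fromBlocks A 0 0 C) (fromBlocks B 0 0 D) := by
  obtain ⟨U, hU, rfl⟩ := h
  obtain ⟨V, hV, rfl⟩ := h'
  refine ⟨fromBlocks U 0 0 V, by simpa using hU.mul hV, ?_⟩
  simp [fromBlocks_transpose, fromBlocks_multiply]

theorem Cong.refl (A : Matrix ι ι R) : Cong A A := ⟨1, by simp, by simp⟩

theorem Cong.schur (A : Matrix ι ι R) (b : Matrix ι κ R) (D : Matrix κ κ R) (hD : IsUnit D.det)
    (hS : D.IsSymm) :
    ∃ A' : Matrix ι ι R, Cong (fromBlocks A b bᵀ D) (fromBlocks A' 0 0 D) := by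
  let : Invertible D := invertibleOfIsUnitDet D hD
  refine ⟨A - b * ⅟D * bᵀ, Cong.symm ⟨fromBlocks 1 0 (⅟D * bᵀ) 1, by rw [det_fromBlocks_zero₁₂]; simp, ?_⟩⟩
  rw [fromBlocks_eq_of_invertible₂₂ A b bᵀ D]
  have : (⅟D)ᵀ = ⅟D := by rw [invOf_eq_nonsing_inv, transpose_nonsing_inv, hS]
  congr 2
  rw [fromBlocks_transpose, transpose_mul, this]
  simp

theorem exists_unit_entry [IsLocalRing R] [Nonempty ι] (B : Matrix ι ι R) (h : IsUnit B.det) :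
    ∃ i j, IsUnit (B i j) := by
  by_contra! hc
  have : (B.map (IsLocalRing.residue R)) = 0 := by
    ext i j
    simpa [IsLocalRing.residue_eq_zero_iff] using hc i j
  have h2 := h.map (IsLocalRing.residue R)
  rw [RingHom.map_det, RingHom.mapMatrix_apply, this, det_zero] at h2
  exact not_isUnit_zero h2

theorem exists_unit_diag [IsLocalRing R] (h2 : IsUnit (2 : R)) (B : Matrix ι ι R)
    (hs : B.IsSymm) (h : IsUnit B.det) (i₀ : ι) :
    ∃ B', Cong B B' ∧ IsUnit (B' i₀ i₀) := by
  have key : ∃ B' j, Cong B B' ∧ IsUnit (B' j j) := by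
    by_cases hd : ∃ j, IsUnit (B j j)
    · obtain ⟨j, hj⟩ := hd
      exact ⟨B, j, Cong.refl B, hj⟩
    push Not at hd
    have : Nonempty ι := ⟨i₀⟩
    obtain ⟨i, j, hij⟩ := exists_unit_entry B h
    have hne : i ≠ j := by
      rintro rfl
      exact hd _ hij
    refine ⟨_, j, ⟨transvection i j 1, by rw [det_transvection_of_ne _ _ hne]; exact isUnit_one, rfl⟩, ?_⟩
    have hji : B j i = B i j := hs.apply i j
    have : ((transvection i j (1:R))ᵀ * B * transvection i j (1:R) : Matrix ι ι R) j j
        = 2 * B i j + (B j j + B i i) := by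
      simp [transvection, Matrix.add_mul, Matrix.mul_add, Matrix.transpose_add, hji]
      ring
    rw [this]
    by_contra hn
    have h3 : B j j + B i i ∈ nonunits R := IsLocalRing.nonunits_add (hd j) (hd i)
    have h4 : -(B j j + B i i) ∈ nonunits R := by
      rw [mem_nonunits_iff, IsUnit.neg_iff]; exact h3
    have := IsLocalRing.nonunits_add (show _ ∈ nonunits R from hn) h4
    apply this
    rw [add_neg_cancel_right]
    exact h2.mul hij
  obtain ⟨B', j, hB', hj⟩ := key
  exact ⟨_, hB'.trans (Cong.perm B' (Equiv.swap i₀ j)), by simpa using hj⟩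

theorem two_step (a c x y : R) (h : a * x ^ 2 + c * y ^ 2 = 1) :
    Cong (diagonal ![a, c]) (diagonal ![a * c, 1]) := by
  refine ⟨!![-c * y, x; a * x, y], ?_, ?_⟩
  · have : (!![-c * y, x; a * x, y]).det = -1 := by
      rw [det_fin_two_of]; linear_combination -h
    rw [this]; exact isUnit_one.neg
  · ext i j
    fin_cases i <;> fin_cases j <;> simp [Matrix.mul_apply, Fin.sum_univ_two, diagonal_apply]
    · linear_combination a * c * h
    · ring
    · ring
    · linear_combination h

theorem main [IsLocalRing R] (h2 : IsUnit (2 : R))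
    (hrep : ∀ a c : R, IsUnit a → IsUnit c → ∃ x y : R, a * x ^ 2 + c * y ^ 2 = 1) (n : ℕ) :
    ∀ B : Matrix (Fin (n+1)) (Fin (n+1)) R, B.IsSymm → IsUnit B.det →
      ∃ c, IsUnit c ∧ Cong B (diagonal (fun i => if i.1 = 0 then c else 1)) := by
  induction n with
  | zero =>
    intro B hs hd
    refine ⟨B 0 0, by simpa using hd, ?_⟩
    convert Cong.refl B
    ext i j
    fin_cases i; fin_cases j; simp
  | succ n ih =>
    intro B hs hd
    obtain ⟨B₁, hB₁, hu⟩ := exists_unit_diag h2 B hs hd 0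
    have hs₁ := hB₁.isSymm hs
    have hd₁ : IsUnit B₁.det := by
      obtain ⟨u, hu, e⟩ := hB₁.det
      rw [e]; exact hd.mul (hu.mul hu)
    let e : Fin (n+1) ⊕ Unit ≃ Fin (n+2) :=
      ((finSuccEquiv (n+1)).trans (Equiv.optionEquivSumPUnit _)).symm
    have e1 : ∀ i, e (Sum.inl i) = i.succ := fun i => by simp [e]
    have e2 : ∀ i, e (Sum.inr i) = 0 := fun i => by simp [e]
    let M := B₁.submatrix e e
    have hM : M = fromBlocks M.toBlocks₁₁ M.toBlocks₁₂ M.toBlocks₁₂ᵀ M.toBlocks₂₂ := by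
      have : M.toBlocks₁₂ᵀ = M.toBlocks₂₁ := by
        ext i j
        exact hs₁.apply _ _
      rw [this, fromBlocks_toBlocks]
    have h22 : M.toBlocks₂₂ = diagonal (fun _ => B₁ 0 0) := by
      ext i j
      simp [toBlocks₂₂, M, e2]
    obtain ⟨A', hA'⟩ := Cong.schur M.toBlocks₁₁ M.toBlocks₁₂ M.toBlocks₂₂
      (by rw [h22]; simpa using hu) (by rw [h22]; exact isSymm_diagonal _)
    rw [← hM] at hA'
    have hAs := hA'.isSymm (hs₁.submatrix e)
    have hAd : IsUnit A'.det := by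
      obtain ⟨u, hu, e'⟩ := hA'.det
      rw [det_fromBlocks_zero₁₂] at e'
      have : IsUnit (A'.det * M.toBlocks₂₂.det) := by
        rw [e', det_submatrix_equiv_self]
        exact hd₁.mul (hu.mul hu)
      exact isUnit_of_mul_isUnit_left this
    obtain ⟨c, hc, hAc⟩ := ih A' (isSymm_fromBlocks_iff.1 hAs).1 hAd
    have h3 := (hA'.trans (hAc.blocks (Cong.refl M.toBlocks₂₂))).reindex e.symm
    have hMB : M.submatrix e.symm e.symm = B₁ := by simp [M]
    rw [hMB, h22, fromBlocks_diagonal, submatrix_diagonal_equiv] at h3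
    obtain ⟨x, y, hxy⟩ := hrep (B₁ 0 0) c hu hc
    let f : Fin 2 ⊕ Fin n ≃ Fin (n+2) := finSumFinEquiv.trans (finCongr (by omega))
    have h4 := ((two_step _ _ x y hxy).blocks (Cong.refl (1 : Matrix (Fin n) (Fin n) R))).reindex f.symm
    rw [← diagonal_one, fromBlocks_diagonal, fromBlocks_diagonal, submatrix_diagonal_equiv,
      submatrix_diagonal_equiv] at h4
    refine ⟨B₁ 0 0 * c, hu.mul hc, hB₁.trans (h3.trans ?_)⟩
    have f0 : f (Sum.inl 0) = 0 := by ext; simp [f]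
    have f1 : f (Sum.inl 1) = 1 := by ext; simp [f]
    have f2 : ∀ i, (f (Sum.inr i)).1 = i.1 + 2 := fun i => by simp [f]
    convert h4 using 2
    · funext i
      obtain ⟨i, rfl⟩ := f.surjective i
      simp only [Function.comp, Equiv.symm_apply_apply]
      rcases i with i | i
      · fin_cases i
        · have : e.symm (f (Sum.inl 0)) = Sum.inr () := by rw [Equiv.symm_apply_eq, e2, f0]
          simp [this]
        · have : e.symm (f (Sum.inl 1)) = Sum.inl 0 := by rw [Equiv.symm_apply_eq, e1, f1]; rfl
          simp [this]
      · have : e.symm (f (Sum.inr i)) = Sum.inl i.succ := by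
          rw [Equiv.symm_apply_eq, e1]; ext; rw [f2]; simp
        simp [this]
    · funext i
      obtain ⟨i, rfl⟩ := f.surjective i
      simp only [Function.comp, Equiv.symm_apply_apply]
      rcases i with i | i
      · fin_cases i
        · simp [f0]
        · simp [f1]
      · simp [f2]

theorem main' [IsLocalRing R] (h2 : IsUnit (2 : R))
    (hrep : ∀ a c : R, IsUnit a → IsUnit c → ∃ x y : R, a * x ^ 2 + c * y ^ 2 = 1) (n : ℕ)
    (B : Matrix (Fin (n+1)) (Fin (n+1)) R) (hs : B.IsSymm) (hd : IsUnit B.det) :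
      ∃ U c, IsUnit U.det ∧ IsUnit c ∧
        Uᵀ * B * U = (diagonal (fun i : Fin (n+1) => if i.1 = 0 then c else 1)) ∧
      (IsSquare B.det → c = 1) ∧
      (¬ IsSquare B.det → ¬ IsSquare c) := by
  obtain ⟨c, hc, hB⟩ := main h2 hrep n B hs hd
  obtain ⟨u, hu, e⟩ := hB.det
  have hdc : (diagonal (fun i : Fin (n+1) => if i.1 = 0 then c else 1)).det = c := by
    simp [Fin.prod_univ_succ]
  rw [hdc] at e
  by_cases hsq : IsSquare B.det
  · obtain ⟨d, hd'⟩ := hsq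
    have hdu : IsUnit (d * u) := (isUnit_of_mul_isUnit_left (hd' ▸ hd)).mul hu
    obtain ⟨w, hw⟩ := hdu.exists_left_inv
    have hwu : IsUnit w := IsUnit.of_mul_eq_one _ hw
    have : Cong (diagonal (fun i : Fin (n+1) => if i.1 = 0 then c else 1))
        (diagonal (fun i : Fin (n+1) => if i.1 = 0 then (1 : R) else 1)) := by
      refine ⟨diagonal (fun i : Fin (n+1) => if i.1 = 0 then w else 1), ?_, ?_⟩
      · simpa [Fin.prod_univ_succ] using hwu
      · rw [diagonal_transpose, diagonal_mul_diagonal, diagonal_mul_diagonal]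
        congr 1
        funext i
        split_ifs
        · rw [e, hd']; linear_combination (w * (d * u) + 1) * hw
        · simp
    obtain ⟨U, hU, hE⟩ := hB.trans this
    exact ⟨U, 1, hU, isUnit_one, hE, fun _ => rfl, fun h => absurd ⟨d, hd'⟩ h⟩
  · obtain ⟨U, hU, hE⟩ := hB
    refine ⟨U, c, hU, hc, hE, fun h => absurd h hsq, fun _ => ?_⟩
    rintro ⟨d, rfl⟩
    obtain ⟨w, hw⟩ := hu.exists_left_inv
    exact hsq ⟨d * w, by linear_combination (-B.det * (w * u + 1)) * hw - w ^ 2 * e⟩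

end

section zmod
variable {p k : ℕ}

theorem nilp_of_cast (hp : p.Prime) (hk : 1 ≤ k) (x : ZMod (p ^ k))
    (hx : ZMod.castHom (dvd_pow_self p (by omega : k ≠ 0)) (ZMod p) x = 0) : IsNilpotent x := by
  have : NeZero (p ^ k) := ⟨pow_ne_zero _ hp.ne_zero⟩
  rw [← ZMod.natCast_zmod_val x, map_natCast, ZMod.natCast_eq_zero_iff] at hx
  refine ⟨k, ?_⟩
  rw [← ZMod.natCast_zmod_val x, ← Nat.cast_pow, ZMod.natCast_eq_zero_iff]
  exact pow_dvd_pow_of_dvd hx k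

theorem unit_of_cast (hp : p.Prime) (hk : 1 ≤ k) (x : ZMod (p ^ k))
    (hx : ZMod.castHom (dvd_pow_self p (by omega : k ≠ 0)) (ZMod p) x ≠ 0) : IsUnit x := by
  have : NeZero (p ^ k) := ⟨pow_ne_zero _ hp.ne_zero⟩
  rw [← ZMod.natCast_zmod_val x, map_natCast, Ne, ZMod.natCast_eq_zero_iff] at hx
  rw [← ZMod.natCast_zmod_val x, ZMod.isUnit_iff_coprime]
  exact (((Nat.Prime.coprime_iff_not_dvd hp).2 hx).pow_left k).symm

theorem local_zmod (hp : p.Prime) (hk : 1 ≤ k) : IsLocalRing (ZMod (p ^ k)) := by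
  have : Fact p.Prime := ⟨hp⟩
  have : Fact (1 < p ^ k) := ⟨Nat.one_lt_pow (by omega) hp.one_lt⟩
  refine IsLocalRing.of_isUnit_or_isUnit_one_sub_self fun a => ?_
  by_contra! h
  have h1 := mt (unit_of_cast hp hk a) h.1
  have h2 := mt (unit_of_cast hp hk (1 - a)) h.2
  rw [not_not] at h1 h2
  rw [map_sub, h1, map_one, sub_zero] at h2
  exact one_ne_zero h2

open Polynomial in
theorem lift_root {R : Type*} [CommRing R] (h2 : IsUnit (2 : R)) (a b x : R) (ha : IsUnit a)
    (hx : IsUnit x) (h : IsNilpotent (a * x ^ 2 + b)) : ∃ r, a * r ^ 2 + b = 0 := by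
  obtain ⟨r, ⟨-, hr⟩, -⟩ := Polynomial.existsUnique_nilpotent_sub_and_aeval_eq_zero
    (P := (C a * X ^ 2 + C b : R[X])) (x := x) (by simpa using h)
    (by
      simp
      exact ⟨ha, by rw [one_add_one_eq_two]; exact h2, hx⟩)
  exact ⟨r, by simpa using hr⟩

theorem rep_zmod (hp : p.Prime) (hp2 : p ≠ 2) (hk : 1 ≤ k) (h2 : IsUnit (2 : ZMod (p ^ k)))
    (a c : ZMod (p ^ k)) (ha : IsUnit a) (hc : IsUnit c) :
    ∃ x y, a * x ^ 2 + c * y ^ 2 = 1 := by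
  have : Fact p.Prime := ⟨hp⟩
  let φ := ZMod.castHom (dvd_pow_self p (by omega : k ≠ 0)) (ZMod p)
  have hφ : Function.Surjective φ := ZMod.castHom_surjective _
  have ha' : φ a ≠ 0 := (ha.map φ).ne_zero
  have hc' : φ c ≠ 0 := (hc.map φ).ne_zero
  obtain ⟨s, t, hst⟩ : ∃ s t : ZMod p, φ a * s ^ 2 + φ c * t ^ 2 = 1 := by
    obtain ⟨s, t, h⟩ := FiniteField.exists_root_sum_quadratic
      (f := (Polynomial.C (φ a) * Polynomial.X ^ 2 + Polynomial.C 0 * Polynomial.X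
        + Polynomial.C 0 : Polynomial (ZMod p)))
      (g := (Polynomial.C (φ c) * Polynomial.X ^ 2 + Polynomial.C 0 * Polynomial.X
        + Polynomial.C (-1) : Polynomial (ZMod p)))
      (Polynomial.degree_quadratic ha') (Polynomial.degree_quadratic hc')
      (by rw [ZMod.card]; exact hp.mod_two_eq_one_iff_ne_two.2 hp2)
    refine ⟨s, t, ?_⟩
    simp at h
    linear_combination h
  obtain ⟨x, rfl⟩ := hφ s
  obtain ⟨y, rfl⟩ := hφ t
  by_cases hx : φ x = 0
  · have hy : φ y ≠ 0 := by
      intro hy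
      simp [hx, hy] at hst
    obtain ⟨r, hr⟩ := lift_root h2 c (a * x ^ 2 - 1) y hc (unit_of_cast hp hk y hy)
      (nilp_of_cast hp hk _ (by
        change φ _ = 0
        simp only [map_add, map_sub, map_mul, map_pow, map_one]
        linear_combination hst))
    exact ⟨x, r, by linear_combination hr⟩
  · obtain ⟨r, hr⟩ := lift_root h2 a (c * y ^ 2 - 1) x ha (unit_of_cast hp hk x hx)
      (nilp_of_cast hp hk _ (by
        change φ _ = 0
        simp only [map_add, map_sub, map_mul, map_pow, map_one]
        linear_combination hst))
    exact ⟨r, y, by linear_combination hr⟩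

end zmod

end Stmt4Aux

theorem stmt4 (p : ℕ) (hp : p.Prime) (hp2 : p ≠ 2) (k : ℕ) (hk : 1 ≤ k)
    (n : ℕ) (hn : 1 ≤ n)
    (B : Matrix (Fin n) (Fin n) (ZMod (p ^ k))) (hsymm : B.IsSymm) (hdet : IsUnit B.det) :
    ∃ (U : Matrix (Fin n) (Fin n) (ZMod (p ^ k))) (c : ZMod (p ^ k)),
      IsUnit U.det ∧ IsUnit c ∧
      Uᵀ * B * U = Matrix.diagonal (fun i : Fin n => if i.1 = 0 then c else 1) ∧
      (IsSquare B.det → c = 1) ∧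
      (¬ IsSquare B.det → ¬ IsSquare c) := by
  obtain ⟨m, rfl⟩ : ∃ m, n = m + 1 := ⟨n - 1, by omega⟩
  have := Stmt4Aux.local_zmod hp hk
  have h2 : IsUnit (2 : ZMod (p ^ k)) := by
    have : IsUnit ((2 : ℕ) : ZMod (p ^ k)) := by
      rw [ZMod.isUnit_iff_coprime]
      exact (((Nat.coprime_primes hp Nat.prime_two).2 hp2).pow_left k).symm
    simpa using this
  exact Stmt4Aux.main' h2 (Stmt4Aux.rep_zmod hp hp2 hk h2) m B hsymm hdet
end

section
/- Let p be an odd prime and let B be a p-form (i.e. k = 1) of rank n with index ε(B) = ε ∈ {1, −1}. If n = 2m + 1 is odd, then the cardinality of O(B) equals 2·p^{m²}·∏_{i=1}^{m} (p^{2i} − 1). If n = 2m is even with m ≥ 1, then the cardinality of O(B) equals 2·p^{m(m−1)}·(p^m − ε)·∏_{i=1}^{m−1} (p^{2i} − 1). -/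
open Matrix

/-- `minExp p q` is the least positive integer `a` such that `q ∣ p^a - 1` or `q ∣ p^a + 1`.
(This is denoted `[q|p]` in the paper.) -/
noncomputable def minExp (p q : ℕ) : ℕ :=
  sInf {a : ℕ | 0 < a ∧ (q ∣ p ^ a - 1 ∨ q ∣ p ^ a + 1)}

/-- `eta p q` is `1` if `q ∣ p^[q|p] - 1` and `-1` otherwise. -/
noncomputable def eta (p q : ℕ) : ℤ :=
  if q ∣ p ^ minExp p q - 1 then 1 else -1

open Classical in
/-- The index `ε(B)` of a symmetric bilinear form `B` over `ℤ/p^kℤ`: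
`ε₁ · ε₂`, where `ε₁ = 1` iff `det B` is a square, and
`ε₂ = -1` iff `p ≡ 3 (mod 4)` and the rank is `≡ 2 (mod 4)`. -/
noncomputable def epsilon (p : ℕ) {ι : Type*} [Fintype ι] [DecidableEq ι] {R : Type*}
    [CommRing R] (B : Matrix ι ι R) : ℤ :=
  (if IsSquare B.det then 1 else -1) *
    (if p % 4 = 3 ∧ Fintype.card ι % 4 = 2 then -1 else 1)


section
variable {F : Type*} [Field F] [Fintype F] [DecidableEq F]

lemma sum_aux1 (hF : ringChar F ≠ 2) (c : F) :
    ∑ t : F, quadraticChar F t * quadraticChar F (c - t)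
      = quadraticChar F (-1) * (Fintype.card F * (if c = 0 then 1 else 0) - 1) := by
  have hq : ∀ t : F, t ≠ 0 → quadraticChar F t * quadraticChar F t = 1 := by
    intro t ht; rw [← sq]; exact quadraticChar_sq_one ht
  by_cases hc : c = 0
  · subst hc
    have : ∀ t : F, quadraticChar F t * quadraticChar F (0 - t)
        = quadraticChar F (-1) * (1 - if t = 0 then 1 else 0) := by
      intro t
      have : (0 - t) = -1 * t := by ring
      rw [this, map_mul]
      by_cases ht : t = 0
      · simp [ht]
      · rw [if_neg ht]; linear_combination quadraticChar F (-1) * hq t ht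
    rw [Finset.sum_congr rfl (fun t _ => this t), ← Finset.mul_sum]
    simp
  · have h1 := jacobiSum_nontrivial_inv (quadraticChar_ne_one hF)
    rw [(quadraticChar_isQuadratic F).inv, jacobiSum] at h1
    rw [if_neg hc, ← Equiv.sum_comp (Equiv.mulLeft₀ c hc)]
    simp only [Equiv.mulLeft₀_apply]
    have : ∀ t : F, quadraticChar F (c * t) * quadraticChar F (c - c * t)
        = quadraticChar F t * quadraticChar F (1 - t) := by
      intro t
      have : c - c * t = c * (1 - t) := by ring
      rw [this, map_mul, map_mul]
      linear_combination (quadraticChar F t * quadraticChar F (1 - t)) * hq c hc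
    rw [Finset.sum_congr rfl (fun t _ => this t), h1]
    ring

lemma card_sq (hF : ringChar F ≠ 2) (a c : F) (ha : a ≠ 0) :
    ((Finset.univ.filter (fun x : F => a * x ^ 2 = c)).card : ℤ) = 1 + quadraticChar F (a * c) := by
  have h := quadraticChar_card_sqrts hF (c / a)
  have e : quadraticChar F (a * c) = quadraticChar F (c / a) := by
    have : a * c = a ^ 2 * (c / a) := by field_simp
    rw [this, map_mul, map_pow, quadraticChar_sq_one ha, one_mul]
  rw [e, add_comm, ← h]
  congr 2
  ext x
  simp [eq_div_iff ha, mul_comm]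

lemma sum_aux2 (hF : ringChar F ≠ 2) (a c : F) (ha : a ≠ 0) :
    ∑ x : F, quadraticChar F (c - a * x ^ 2)
      = quadraticChar F (-a) * (Fintype.card F * (if c = 0 then 1 else 0) - 1) := by
  have h1 : ∑ x : F, quadraticChar F (c - a * x ^ 2)
      = ∑ t : F, (1 + quadraticChar F (a * t)) * quadraticChar F (c - t) := by
    rw [← Finset.sum_fiberwise (s := Finset.univ) (g := fun x : F => a * x ^ 2)]
    refine Finset.sum_congr rfl fun t _ => ?_
    rw [← card_sq hF a t ha, ← nsmul_eq_mul, ← Finset.sum_const]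
    refine Finset.sum_congr rfl fun x hx => ?_
    rw [(Finset.mem_filter.1 hx).2]
  have h0 : ∑ t : F, quadraticChar F (c - t) = 0 := by
    have := (Equiv.subLeft c).sum_comp (fun t => quadraticChar F t)
    simp only [Equiv.subLeft_apply] at this
    rw [this]; exact quadraticChar_sum_zero hF
  have h2 : quadraticChar F (-a) = quadraticChar F a * quadraticChar F (-1) := by
    rw [← map_mul]; congr 1; ring
  rw [h1]
  simp only [add_mul, one_mul, Finset.sum_add_distrib, h0, map_mul, mul_assoc, ← Finset.mul_sum,
    sum_aux1 hF c, h2]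
  ring

/-- number of representations of c by the diagonal form d -/
noncomputable def NN {n : ℕ} (d : Fin n → F) (c : F) : ℤ :=
  ((Finset.univ.filter (fun v : Fin n → F => ∑ i, d i * v i ^ 2 = c)).card : ℤ)

lemma NN_succ {n : ℕ} (d : Fin (n+1) → F) (c : F) :
    NN d c = ∑ x : F, NN (Fin.tail d) (c - d 0 * x ^ 2) := by
  unfold NN
  simp only [Finset.card_filter]
  push_cast
  rw [← (Fin.consEquiv (fun _ => F)).sum_comp, Fintype.sum_prod_type]
  refine Finset.sum_congr rfl fun x _ => Finset.sum_congr rfl fun v _ => ?_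
  congr 1
  simp [Fin.sum_univ_succ, Fin.consEquiv, Fin.tail, eq_sub_iff_add_eq']

lemma NN_formula (hF : ringChar F ≠ 2) (m : ℕ) :
    (∀ d : Fin (2*m) → F, (∀ i, d i ≠ 0) → ∀ c, (Fintype.card F : ℤ) * NN d c =
      (Fintype.card F)^(2*m) + (Fintype.card F)^m * quadraticChar F ((-1)^m * ∏ i, d i) *
        (Fintype.card F * (if c = 0 then 1 else 0) - 1)) ∧
    (∀ d : Fin (2*m+1) → F, (∀ i, d i ≠ 0) → ∀ c, NN d c =
      (Fintype.card F : ℤ)^(2*m) + (Fintype.card F)^m * quadraticChar F ((-1)^m * c * ∏ i, d i)) := by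
  have hq : (Fintype.card F : ℤ) ≠ 0 := by simp
  have step : ∀ m, (∀ d : Fin (2*m) → F, (∀ i, d i ≠ 0) → ∀ c, (Fintype.card F : ℤ) * NN d c =
      (Fintype.card F)^(2*m) + (Fintype.card F)^m * quadraticChar F ((-1)^m * ∏ i, d i) *
        (Fintype.card F * (if c = 0 then 1 else 0) - 1)) → 
    (∀ d : Fin (2*m+1) → F, (∀ i, d i ≠ 0) → ∀ c, NN d c =
      (Fintype.card F : ℤ)^(2*m) + (Fintype.card F)^m * quadraticChar F ((-1)^m * c * ∏ i, d i)) := by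
    intro m ih d hd c
    apply mul_left_cancel₀ hq
    rw [NN_succ, Finset.mul_sum, Finset.sum_congr rfl (fun x _ => ih (Fin.tail d) (fun i => hd i.succ) _)]
    have h := card_sq hF (d 0) c (hd 0)
    rw [Finset.card_filter] at h
    push_cast at h
    simp only [sub_eq_zero, Finset.sum_add_distrib, ← Finset.mul_sum, Finset.sum_sub_distrib,
      eq_comm (a := c), h]
    have e : quadraticChar F ((-1)^m * c * ∏ i, d i) =
      quadraticChar F ((-1)^m * ∏ i, Fin.tail d i) * quadraticChar F (d 0 * c) := by
      rw [← map_mul, Fin.prod_univ_succ]; congr 1; simp only [Fin.tail]; ring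
    rw [e]
    simp
    ring
  induction m with
  | zero =>
    have h0 : (∀ d : Fin (2*0) → F, (∀ i, d i ≠ 0) → ∀ c, (Fintype.card F : ℤ) * NN d c =
      (Fintype.card F)^(2*0) + (Fintype.card F)^0 * quadraticChar F ((-1)^0 * ∏ i, d i) *
        (Fintype.card F * (if c = 0 then 1 else 0) - 1)) := by
      intro d _ c
      have : NN d c = if c = 0 then 1 else 0 := by
        unfold NN
        rw [Finset.card_filter]
        simp [eq_comm (a := c)]
      rw [this]
      simp
    exact ⟨h0, step 0 h0⟩
  | succ m ih =>
    have h0 : (∀ d : Fin (2*(m+1)) → F, (∀ i, d i ≠ 0) → ∀ c, (Fintype.card F : ℤ) * NN d c =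
      (Fintype.card F)^(2*(m+1)) + (Fintype.card F)^(m+1) *
        quadraticChar F ((-1)^(m+1) * ∏ i, d i) *
        (Fintype.card F * (if c = 0 then 1 else 0) - 1)) := by
      intro d hd c
      change Fin (2*m+1+1) → F at d
      rw [NN_succ, Finset.sum_congr rfl (fun x _ => ih.2 (Fin.tail d) (fun i => hd i.succ) _)]
      have e : ∀ x, quadraticChar F ((-1)^m * (c - d 0 * x^2) * ∏ i, Fin.tail d i) =
        quadraticChar F ((-1)^m * ∏ i, Fin.tail d i) * quadraticChar F (c - d 0 * x^2) := by
        intro x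
        rw [← map_mul]; congr 1; ring
      have e2 : quadraticChar F ((-1)^(m+1) * ∏ i, d i) =
        quadraticChar F ((-1)^m * ∏ i, Fin.tail d i) * quadraticChar F (-d 0) := by
        rw [← map_mul, Fin.prod_univ_succ]; congr 1; simp only [Fin.tail]; ring
      simp only [e, Finset.sum_add_distrib, ← Finset.mul_sum, sum_aux2 hF (d 0) c (hd 0)]
      rw [show (∏ i : Fin (2*(m+1)), d i) = ∏ i : Fin (2*m+1+1), d i from rfl, e2]
      simp
      ring
    exact ⟨h0, step _ h0⟩

/-- order of the isometry group -/
noncomputable def GG {n : ℕ} (B : Matrix (Fin n) (Fin n) F) : ℕ :=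
  Nat.card {A : Matrix (Fin n) (Fin n) F // Aᵀ * B * A = B}

lemma refl_exists {n : ℕ} (d w : Fin n → F) (hw : w ⬝ᵥ (diagonal d *ᵥ w) ≠ 0) :
    ∃ g : Matrix (Fin n) (Fin n) F, g * g = 1 ∧ gᵀ * diagonal d * g = diagonal d ∧
      ∀ x, g *ᵥ x = x - (2 * (w ⬝ᵥ (diagonal d *ᵥ w))⁻¹ * (w ⬝ᵥ (diagonal d *ᵥ x))) • w := by
  set D := diagonal d with hD
  have hDT : Dᵀ = D := by simp [hD]
  set q := w ⬝ᵥ (D *ᵥ w) with hq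
  set u := D *ᵥ w with hu
  have huw : u ⬝ᵥ w = q := by rw [dotProduct_comm]
  have hvD : w ᵥ* D = u := by rw [← hDT, vecMul_transpose]
  have e1 : vecMulVec w u * vecMulVec w u = q • vecMulVec w u := by
    rw [vecMulVec_mul_vecMulVec, huw, vecMulVec_smul]
  have e2 : D * vecMulVec w u = vecMulVec u u := by rw [mul_vecMulVec]
  have e3 : vecMulVec u w * D = vecMulVec u u := by rw [vecMulVec_mul, hvD]
  have e4 : vecMulVec u u * vecMulVec w u = q • vecMulVec u u := by
    rw [vecMulVec_mul_vecMulVec, huw, vecMulVec_smul]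
  refine ⟨1 - (2 * q⁻¹) • vecMulVec w u, ?_, ?_, ?_⟩
  · simp only [sub_mul, mul_sub, one_mul, mul_one, smul_mul_assoc, mul_smul_comm, e1, smul_sub, smul_smul]
    have : 2 * q⁻¹ * (2 * q⁻¹ * q) = 2 * q⁻¹ + 2 * q⁻¹ := by field_simp; ring
    rw [this, add_smul]; abel
  · simp only [transpose_sub, transpose_smul, transpose_one, transpose_vecMulVec, sub_mul, mul_sub,
      one_mul, mul_one, smul_mul_assoc, mul_smul_comm, e2, e3, e4, smul_sub, smul_smul]
    have : 2 * q⁻¹ * (2 * q⁻¹ * q) = 2 * q⁻¹ + 2 * q⁻¹ := by field_simp; ring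
    simp only [this, add_smul]; abel
  · intro x
    have : u ⬝ᵥ x = w ⬝ᵥ (D *ᵥ x) := by rw [dotProduct_mulVec, hvD]
    rw [sub_mulVec, one_mulVec, smul_mulVec, vecMulVec_mulVec, this]
    ext i; simp; ring

lemma witt {n : ℕ} (h2 : (2 : F) ≠ 0) (d x y : Fin n → F) (a : F) (ha : a ≠ 0)
    (hx : x ⬝ᵥ (diagonal d *ᵥ x) = a) (hy : y ⬝ᵥ (diagonal d *ᵥ y) = a) :
    ∃ g : Matrix (Fin n) (Fin n) F, g * g = 1 ∧ gᵀ * diagonal d * g = diagonal d ∧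
      g *ᵥ x = y := by
  have hc : y ⬝ᵥ (diagonal d *ᵥ x) = x ⬝ᵥ (diagonal d *ᵥ y) := by
    simp only [dotProduct, mulVec_diagonal]
    exact Finset.sum_congr rfl fun i _ => by ring
  by_cases h : x ⬝ᵥ (diagonal d *ᵥ y) = a
  · have hw : (x + y) ⬝ᵥ (diagonal d *ᵥ (x + y)) = 4 * a := by
      simp only [mulVec_add, dotProduct_add, add_dotProduct, hx, hy, hc, h]; ring
    have h4 : (x + y) ⬝ᵥ (diagonal d *ᵥ x) = 2 * a := by
      simp only [add_dotProduct, hx, hc, h]; ring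
    have h40 : (4 : F) ≠ 0 := by
      have : (4 : F) = 2 * 2 := by norm_num
      rw [this]; exact mul_ne_zero h2 h2
    obtain ⟨g, h1, h2', h3⟩ := refl_exists d (x + y) (by rw [hw]; exact mul_ne_zero h40 ha)
    refine ⟨-g, by simpa using h1, by simpa using h2', ?_⟩
    rw [neg_mulVec, h3, hw, h4]
    have : 2 * (4 * a)⁻¹ * (2 * a) = 1 := by
      have : (4 : F) = 2 * 2 := by norm_num
      rw [this]; field_simp
    rw [this]; simp
  · have hw : (x - y) ⬝ᵥ (diagonal d *ᵥ (x - y)) = 2 * (a - x ⬝ᵥ (diagonal d *ᵥ y)) := by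
      simp only [mulVec_sub, dotProduct_sub, sub_dotProduct, hx, hy, hc]; ring
    have h4 : (x - y) ⬝ᵥ (diagonal d *ᵥ x) = a - x ⬝ᵥ (diagonal d *ᵥ y) := by
      simp only [sub_dotProduct, hx, hc]
    have h5 : a - x ⬝ᵥ (diagonal d *ᵥ y) ≠ 0 := sub_ne_zero.2 (Ne.symm h)
    obtain ⟨g, h1, h2', h3⟩ := refl_exists d (x - y) (by rw [hw]; exact mul_ne_zero h2 h5)
    refine ⟨g, h1, h2', ?_⟩
    rw [h3, hw, h4]
    have : 2 * (2 * (a - x ⬝ᵥ (diagonal d *ᵥ y)))⁻¹ * (a - x ⬝ᵥ (diagonal d *ᵥ y)) = 1 := by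
      field_simp
    rw [this]; simp

lemma entry {n : ℕ} (d : Fin n → F) (A : Matrix (Fin n) (Fin n) F) :
    Aᵀ * diagonal d * A = diagonal d ↔
      ∀ i j, ∑ k, d k * A k i * A k j = if i = j then d i else 0 := by
  rw [← Matrix.ext_iff]
  refine forall_congr' fun i => forall_congr' fun j => ?_
  rw [diagonal_apply, Matrix.mul_apply]
  simp only [mul_diagonal, transpose_apply, mul_comm (d _)]

lemma row_zero {n : ℕ} (d : Fin (n+1) → F) (hd : d 0 ≠ 0) (A : Matrix (Fin (n+1)) (Fin (n+1)) F)
    (hA : Aᵀ * diagonal d * A = diagonal d) (h0 : A.col 0 = Pi.single 0 1) (j : Fin (n+1)) :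
    A 0 j = if 0 = j then 1 else 0 := by
  have h := (entry d A).1 hA 0 j
  have h0' : ∀ i, A i 0 = (Pi.single 0 1 : Fin (n+1) → F) i := fun i => congrFun h0 i
  simp only [h0', Fin.sum_univ_succ, Pi.single_apply, Fin.succ_ne_zero] at h
  simp at h
  split_ifs at h ⊢ with hj
  · simpa [hd] using h
  · simpa [hd] using h

/-- fibre over the first basis vector -/
noncomputable def fibEquiv {n : ℕ} (d : Fin (n+1) → F) (hd : d 0 ≠ 0) :
    {A : Matrix (Fin (n+1)) (Fin (n+1)) F // Aᵀ * diagonal d * A = diagonal d ∧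
      A.col 0 = Pi.single 0 1} ≃
    {A : Matrix (Fin n) (Fin n) F // Aᵀ * diagonal (Fin.tail d) * A = diagonal (Fin.tail d)} where
  toFun A := ⟨A.1.submatrix Fin.succ Fin.succ, by
    rw [entry]
    intro i j
    have h := (entry d A.1).1 A.2.1 i.succ j.succ
    rw [Fin.sum_univ_succ, row_zero d hd A.1 A.2.1 A.2.2, if_neg (Fin.succ_ne_zero i).symm] at h
    simpa [Fin.tail] using h⟩
  invFun A := ⟨Matrix.of (Fin.cons (Fin.cons 1 0) (fun i => Fin.cons 0 (A.1 i))), by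
    constructor
    · rw [entry]
      intro i j
      have h := (entry _ A.1).1 A.2
      rw [Fin.sum_univ_succ]
      cases i using Fin.cases with
      | zero =>
        cases j using Fin.cases with
        | zero => simp
        | succ j => simp [(Fin.succ_ne_zero j).symm]
      | succ i =>
        cases j using Fin.cases with
        | zero => simp
        | succ j => simpa [Fin.tail] using h i j
    · ext i
      cases i using Fin.cases with
      | zero => simp
      | succ i => simp⟩
  left_inv A := by
    apply Subtype.ext
    ext i j
    have h0' : ∀ i, A.1 i 0 = (Pi.single 0 1 : Fin (n+1) → F) i := fun i => congrFun A.2.2 i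
    cases i using Fin.cases with
    | zero =>
      rw [row_zero d hd A.1 A.2.1 A.2.2]
      cases j using Fin.cases with
      | zero => simp
      | succ j => simp [(Fin.succ_ne_zero j).symm]
    | succ i =>
      cases j using Fin.cases with
      | zero => simp [h0']
      | succ j => simp
  right_inv A := by
    apply Subtype.ext
    ext i j
    simp

lemma mul_iso {n : ℕ} {B g A : Matrix (Fin n) (Fin n) F} (hg : gᵀ * B * g = B)
    (hA : Aᵀ * B * A = B) : (g * A)ᵀ * B * (g * A) = B := by
  calc (g * A)ᵀ * B * (g * A) = Aᵀ * (gᵀ * B * g) * A := by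
        simp only [transpose_mul, Matrix.mul_assoc]
    _ = B := by rw [hg, hA]

lemma col_eq {n : ℕ} (A : Matrix (Fin n) (Fin n) F) (j : Fin n) :
    A.col j = A *ᵥ Pi.single j 1 := by simp

lemma fib_card {n : ℕ} (h2 : (2 : F) ≠ 0) (d v : Fin (n+1) → F) (hd : d 0 ≠ 0)
    (hv : ∑ i, d i * v i ^ 2 = d 0) :
    Nat.card {A : Matrix (Fin (n+1)) (Fin (n+1)) F // Aᵀ * diagonal d * A = diagonal d ∧
      A.col 0 = v} = GG (diagonal (Fin.tail d)) := by
  rw [GG, ← Nat.card_congr (fibEquiv d hd)]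
  obtain ⟨g, h1, h2, h3⟩ := witt h2 d (Pi.single 0 1) v (d 0) hd (by simp)
    (by rw [← hv]; simp only [dotProduct, mulVec_diagonal]
        exact Finset.sum_congr rfl fun i _ => by ring)
  have h4 : g *ᵥ v = Pi.single 0 1 := by rw [← h3, mulVec_mulVec, h1, one_mulVec]
  refine Nat.card_congr ⟨fun A => ⟨g * A.1, mul_iso h2 A.2.1, ?_⟩,
    fun A => ⟨g * A.1, mul_iso h2 A.2.1, ?_⟩, fun A => ?_, fun A => ?_⟩
  · rw [col_eq, ← mulVec_mulVec, ← col_eq, A.2.2, h4]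
  · rw [col_eq, ← mulVec_mulVec, ← col_eq, A.2.2, h3]
  · apply Subtype.ext; simp [← Matrix.mul_assoc, h1]
  · apply Subtype.ext; simp [← Matrix.mul_assoc, h1]

lemma GG_succ {n : ℕ} (h2 : (2 : F) ≠ 0) (d : Fin (n+1) → F) (hd : d 0 ≠ 0) :
    (GG (diagonal d) : ℤ) = NN d (d 0) * GG (diagonal (Fin.tail d)) := by
  classical
  have key : ∀ A : Matrix (Fin (n+1)) (Fin (n+1)) F, Aᵀ * diagonal d * A = diagonal d →
      ∑ i, d i * (A.col 0) i ^ 2 = d 0 := by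
    intro A hA
    have := (entry d A).1 hA 0 0
    simp only [if_true] at this
    rw [← this]
    exact Finset.sum_congr rfl fun i _ => by simp; ring
  let f : {A : Matrix (Fin (n+1)) (Fin (n+1)) F // Aᵀ * diagonal d * A = diagonal d} →
    {v : Fin (n+1) → F // ∑ i, d i * v i ^ 2 = d 0} := fun A => ⟨A.1.col 0, key A.1 A.2⟩
  have e := Nat.card_congr (Equiv.sigmaFiberEquiv f)
  rw [Nat.card_sigma] at e
  have hf : ∀ v, Nat.card {A // f A = v} = GG (diagonal (Fin.tail d)) := by
    intro v
    rw [← fib_card h2 d v.1 hd v.2]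
    refine Nat.card_congr ((Equiv.subtypeEquivRight fun A => ?_).trans
      (Equiv.subtypeSubtypeEquivSubtypeInter _ (fun A : Matrix (Fin (n+1)) (Fin (n+1)) F => A.col 0 = v.1)))
    simp [f, Subtype.ext_iff]
  simp only [hf, Finset.sum_const, smul_eq_mul, Finset.card_univ] at e
  rw [GG, ← e, NN]
  push_cast
  rw [Fintype.card_subtype]

lemma GG_zero (B : Matrix (Fin 0) (Fin 0) F) : GG B = 1 := by
  rw [GG, Nat.card_eq_one_iff_unique]
  exact ⟨inferInstance, ⟨⟨0, Subsingleton.elim _ _⟩⟩⟩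

lemma GG_diag (hF : ringChar F ≠ 2) (m : ℕ) :
    (∀ d : Fin (2*m+1) → F, (∀ i, d i ≠ 0) → (GG (diagonal d) : ℤ) =
        2 * (Fintype.card F : ℤ) ^ (m ^ 2) *
          ∏ i ∈ Finset.range m, ((Fintype.card F : ℤ) ^ (2 * (i + 1)) - 1)) ∧
    (∀ d : Fin (2*(m+1)) → F, (∀ i, d i ≠ 0) → (GG (diagonal d) : ℤ) =
        2 * (Fintype.card F : ℤ) ^ ((m + 1) * m) *
          ((Fintype.card F : ℤ) ^ (m + 1) - quadraticChar F ((-1)^(m+1) * ∏ i, d i)) *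
          ∏ i ∈ Finset.range m, ((Fintype.card F : ℤ) ^ (2 * (i + 1)) - 1)) := by
  have hq : (Fintype.card F : ℤ) ≠ 0 := by simp
  have h2 : (2 : F) ≠ 0 := Ring.two_ne_zero hF
  have step : ∀ m, (∀ d : Fin (2*m+1) → F, (∀ i, d i ≠ 0) → (GG (diagonal d) : ℤ) =
        2 * (Fintype.card F : ℤ) ^ (m ^ 2) *
          ∏ i ∈ Finset.range m, ((Fintype.card F : ℤ) ^ (2 * (i + 1)) - 1)) →
    (∀ d : Fin (2*(m+1)) → F, (∀ i, d i ≠ 0) → (GG (diagonal d) : ℤ) =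
        2 * (Fintype.card F : ℤ) ^ ((m + 1) * m) *
          ((Fintype.card F : ℤ) ^ (m + 1) - quadraticChar F ((-1)^(m+1) * ∏ i, d i)) *
          ∏ i ∈ Finset.range m, ((Fintype.card F : ℤ) ^ (2 * (i + 1)) - 1)) := by
    intro m ih d hd
    have hN := (NN_formula hF (m+1)).1 d hd (d 0)
    rw [if_neg (hd 0)] at hN
    apply mul_left_cancel₀ hq
    rw [GG_succ (n := 2*m+1) h2 d (hd 0), ih (Fin.tail (n := 2*m+1) d) (fun i => hd i.succ),
      ← mul_assoc]
    refine (congrArg (· * _) hN).trans ?_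
    ring
  have step2 : ∀ m (d : Fin (2*m+1) → F), (∀ i, d i ≠ 0) → NN d (d 0) =
      (Fintype.card F : ℤ) ^ m *
        ((Fintype.card F : ℤ) ^ m + quadraticChar F ((-1)^m * ∏ i, Fin.tail d i)) := by
    intro m d hd
    rw [(NN_formula hF m).2 d hd (d 0)]
    have : (-1)^m * d 0 * ∏ i, d i = (d 0)^2 * ((-1)^m * ∏ i, Fin.tail d i) := by
      rw [Fin.prod_univ_succ]; simp only [Fin.tail]; ring
    rw [this, map_mul, quadraticChar_sq_one' (hd 0)]
    ring
  induction m with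
  | zero =>
    have h0 : (∀ d : Fin (2*0+1) → F, (∀ i, d i ≠ 0) → (GG (diagonal d) : ℤ) =
        2 * (Fintype.card F : ℤ) ^ (0 ^ 2) *
          ∏ i ∈ Finset.range 0, ((Fintype.card F : ℤ) ^ (2 * (i + 1)) - 1)) := by
      intro d hd
      rw [GG_succ h2 d (hd 0), step2 0 d hd, GG_zero]
      simp
    exact ⟨h0, step 0 h0⟩
  | succ m ih =>
    have h0 : (∀ d : Fin (2*(m+1)+1) → F, (∀ i, d i ≠ 0) → (GG (diagonal d) : ℤ) =
        2 * (Fintype.card F : ℤ) ^ ((m+1) ^ 2) *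
          ∏ i ∈ Finset.range (m+1), ((Fintype.card F : ℤ) ^ (2 * (i + 1)) - 1)) := by
      intro d hd
      rw [GG_succ h2 d (hd 0), step2 (m+1) d hd, ih.2 (Fin.tail d) (fun i => hd i.succ),
        Finset.prod_range_succ]
      have hz : (-1)^(m+1) * ∏ i, Fin.tail d i ≠ 0 :=
        mul_ne_zero (by simp) (Finset.prod_ne_zero_iff.2 fun i _ => hd i.succ)
      have hχ := quadraticChar_sq_one hz
      set χ := quadraticChar F ((-1)^(m+1) * ∏ i, Fin.tail d i)
      set P := ∏ i ∈ Finset.range m, ((Fintype.card F : ℤ) ^ (2 * (i + 1)) - 1)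
      linear_combination (-2 * (Fintype.card F : ℤ)^((m+1)^2) * P) * hχ
    exact ⟨h0, step _ h0⟩

lemma GG_congr {n : ℕ} (B P : Matrix (Fin n) (Fin n) F) (hP : IsUnit P.det) :
    GG (Pᵀ * B * P) = GG B := by
  have h1 : P * P⁻¹ = 1 := mul_nonsing_inv P hP
  have h2 : P⁻¹ * P = 1 := nonsing_inv_mul P hP
  have h1' : P⁻¹ᵀ * Pᵀ = 1 := by rw [← transpose_mul, h1, transpose_one]
  refine Nat.card_congr ⟨fun A => ⟨P * A.1 * P⁻¹, ?_⟩, fun A => ⟨P⁻¹ * A.1 * P, ?_⟩, ?_, ?_⟩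
  · calc (P * A.1 * P⁻¹)ᵀ * B * (P * A.1 * P⁻¹)
        = P⁻¹ᵀ * (A.1ᵀ * (Pᵀ * B * P) * A.1) * P⁻¹ := by
          simp only [transpose_mul, Matrix.mul_assoc]
      _ = (P⁻¹ᵀ * Pᵀ) * B * (P * P⁻¹) := by rw [A.2]; simp only [Matrix.mul_assoc]
      _ = B := by rw [h1, h1']; simp
  · calc (P⁻¹ * A.1 * P)ᵀ * (Pᵀ * B * P) * (P⁻¹ * A.1 * P)
        = Pᵀ * A.1ᵀ * (P * P⁻¹)ᵀ * B * (P * P⁻¹) * A.1 * P := by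
          simp only [transpose_mul, Matrix.mul_assoc]
      _ = Pᵀ * (A.1ᵀ * B * A.1) * P := by
          rw [h1]; simp only [transpose_one, mul_one, Matrix.mul_assoc]
      _ = _ := by rw [A.2]
  · intro A
    apply Subtype.ext
    calc P⁻¹ * (P * A.1 * P⁻¹) * P = (P⁻¹ * P) * A.1 * (P⁻¹ * P) := by
          simp only [Matrix.mul_assoc]
      _ = A.1 := by rw [h2]; simp
  · intro A
    apply Subtype.ext
    calc P * (P⁻¹ * A.1 * P) * P⁻¹ = (P * P⁻¹) * A.1 * (P * P⁻¹) := by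
          simp only [Matrix.mul_assoc]
      _ = A.1 := by rw [h1]; simp

lemma diag_exists {n : ℕ} (h2 : (2 : F) ≠ 0) (B : Matrix (Fin n) (Fin n) F) (hB : B.IsSymm) :
    ∃ (P : Matrix (Fin n) (Fin n) F) (d : Fin n → F), IsUnit P.det ∧ Pᵀ * B * P = diagonal d := by
  have : Invertible (2 : F) := invertibleOfNonzero h2
  obtain ⟨v, hv⟩ := LinearMap.BilinForm.exists_orthogonal_basis (B := Matrix.toBilin' B)
    (LinearMap.BilinForm.isSymm_iff.1 (Matrix.isSymm_toBilin'_iff_isSymm.2 hB))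
  let b := v.reindex (finCongr (by simp : Module.finrank F (Fin n → F) = n))
  refine ⟨(Pi.basisFun F (Fin n)).toMatrix b, fun i => Matrix.toBilin' B (b i) (b i), ?_, ?_⟩
  · rw [← Module.Basis.det_apply]; exact Module.Basis.isUnit_det _ _
  · have h := LinearMap.BilinForm.toMatrix_mul_basis_toMatrix (Pi.basisFun F (Fin n)) b
      (Matrix.toBilin' B)
    rw [LinearMap.BilinForm.toMatrix_basisFun, LinearMap.BilinForm.toMatrix'_toBilin'] at h
    rw [h]
    ext i j
    rw [LinearMap.BilinForm.toMatrix_apply, diagonal_apply]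
    split_ifs with hij
    · rw [hij]
    · have := hv (i := finCongr (by simp) i) (j := finCongr (by simp) j) (by simpa using hij)
      simpa [b] using this

end

theorem stmt6 (p : ℕ) (hp : p.Prime) (hp2 : p ≠ 2) (n : ℕ)
    (B : Matrix (Fin n) (Fin n) (ZMod p)) (hsymm : B.IsSymm) (hdet : IsUnit B.det) :
    (∀ m : ℕ, n = 2 * m + 1 →
      (Nat.card {A : Matrix (Fin n) (Fin n) (ZMod p) // Aᵀ * B * A = B} : ℤ) =
        2 * (p : ℤ) ^ (m ^ 2) * ∏ i ∈ Finset.range m, ((p : ℤ) ^ (2 * (i + 1)) - 1)) ∧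
    (∀ m : ℕ, 1 ≤ m → n = 2 * m →
      (Nat.card {A : Matrix (Fin n) (Fin n) (ZMod p) // Aᵀ * B * A = B} : ℤ) =
        2 * (p : ℤ) ^ (m * (m - 1)) * ((p : ℤ) ^ m - epsilon p B) *
          ∏ i ∈ Finset.range (m - 1), ((p : ℤ) ^ (2 * (i + 1)) - 1)) := by
  have : Fact p.Prime := ⟨hp⟩
  have hF : ringChar (ZMod p) ≠ 2 := by rwa [ZMod.ringChar_zmod_n]
  have h2 : (2 : ZMod p) ≠ 0 := Ring.two_ne_zero hF
  obtain ⟨P, d, hP, hd⟩ := diag_exists h2 B hsymm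
  have hG : GG B = GG (diagonal d) := by rw [← hd, GG_congr B P hP]
  have hdd : ∏ i, d i = P.det ^ 2 * B.det := by
    rw [← det_diagonal, ← hd]; simp only [det_mul, det_transpose]; ring
  have hB0 : B.det ≠ 0 := hdet.ne_zero
  have hP0 : P.det ≠ 0 := hP.ne_zero
  have hd0 : ∀ i, d i ≠ 0 := by
    have : ∏ i, d i ≠ 0 := by rw [hdd]; exact mul_ne_zero (pow_ne_zero _ hP0) hB0
    exact fun i => Finset.prod_ne_zero_iff.1 this i (Finset.mem_univ i)
  constructor
  · rintro m rfl
    have := (GG_diag hF m).1 d hd0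
    rw [← hG, ZMod.card] at this
    exact this
  · intro m hm hn
    obtain ⟨m, rfl⟩ : ∃ k, m = k + 1 := ⟨m - 1, by omega⟩
    subst hn
    have := (GG_diag hF m).2 d hd0
    rw [← hG, ZMod.card] at this
    have he : epsilon p B = quadraticChar (ZMod p) ((-1)^(m+1) * ∏ i, d i) := by
      rw [hdd, map_mul, map_mul, quadraticChar_sq_one' hP0, one_mul,
        mul_comm (quadraticChar (ZMod p) _), map_pow, epsilon]
      congr 1
      · split_ifs with h
        · exact ((quadraticChar_one_iff_isSquare hB0).2 h).symm
        · exact (quadraticChar_neg_one_iff_not_isSquare.2 h).symm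
      · have hsq := FiniteField.isSquare_neg_one_iff (F := ZMod p)
        rw [ZMod.card] at hsq
        rw [Fintype.card_fin]
        by_cases h3 : p % 4 = 3
        · have : quadraticChar (ZMod p) (-1) = -1 :=
            quadraticChar_neg_one_iff_not_isSquare.2 (fun h => hsq.1 h h3)
          rw [this]
          rcases Nat.even_or_odd (m+1) with h | h
          · rw [h.neg_one_pow, if_neg]
            obtain ⟨k, hk⟩ := h; omega
          · rw [h.neg_one_pow, if_pos]
            obtain ⟨k, hk⟩ := h; omega
        · have : quadraticChar (ZMod p) (-1) = 1 :=
            (quadraticChar_one_iff_isSquare (by simp)).2 (hsq.2 h3)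
          rw [this, if_neg (by tauto), one_pow]
    rw [he]
    exact this
end

section
/- Let p ≠ q be odd primes, k ≥ 1, and let B be a p^k-form of rank n = 2[q|p]·d + R, where d ≥ 0 and 0 < R < 2[q|p]. Let A be an isometry of B whose order is a power of q. Then there exists an invertible n×n matrix U over ℤ/p^kℤ such that Uᵀ B U is block-diagonal diag(B₁, B₂) with blocks of sizes 2[q|p]·d and R, and U⁻¹ A U is the block-diagonal matrix diag(A₁, I_R) for some matrix A₁ of size 2[q|p]·d; in particular A fixes pointwise a free ℤ/p^kℤ-submodule of rank R. -/
open Matrix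

theorem exists_pivot {S : Type} [CommRing S] [IsLocalRing S] (h2 : IsUnit (2 : S))
    {ι : Type} [Fintype ι] [DecidableEq ι] [Nonempty ι] (B : Matrix ι ι S) (hs : B.IsSymm)
    (hd : IsUnit B.det) :
    ∃ V : Matrix ι ι S, IsUnit V.det ∧ ∃ i, IsUnit ((Vᵀ * B * V) i i) := by
  by_cases h : ∃ i, IsUnit (B i i)
  · exact ⟨1, by simp, by simpa using h⟩
  · push Not at h
    have h' : ∃ i j, IsUnit (B i j) := by
      by_contra hc
      push Not at hc
      have h0 : B.map (IsLocalRing.residue S) = 0 := by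
        ext i j
        simpa [IsLocalRing.residue_eq_zero_iff] using hc i j
      have h1 : IsLocalRing.residue S B.det = 0 := by
        rw [RingHom.map_det, RingHom.mapMatrix_apply, h0, Matrix.det_zero]
      exact (hd.map (IsLocalRing.residue S)).ne_zero h1
    obtain ⟨i, j, hij⟩ := h'
    have hne : i ≠ j := by
      rintro rfl
      exact h i hij
    refine ⟨transvection j i 1, by rw [det_transvection_of_ne _ _ hne.symm]; exact isUnit_one, i, ?_⟩
    have e : ((transvection j i (1 : S))ᵀ * B * transvection j i (1 : S) : Matrix ι ι S) i i
        = 2 * B i j + (B i i + B j j) := by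
      have : B j i = B i j := hs.apply i j
      simp [transvection, Matrix.add_mul, Matrix.mul_add, Matrix.transpose_add, this]
      ring
    rw [e]
    by_contra hc
    have hn : B i i + B j j ∈ nonunits S := IsLocalRing.nonunits_add (h i) (h j)
    have hn2 : -(B i i + B j j) ∈ nonunits S := by
      simpa only [mem_nonunits_iff, IsUnit.neg_iff] using hn
    have := IsLocalRing.nonunits_add hc hn2
    rw [add_neg_cancel_right] at this
    exact this (h2.mul hij)

theorem exists_diag {S : Type} [CommRing S] [IsLocalRing S] (h2 : IsUnit (2 : S)) (n : ℕ) :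
    ∀ {ι : Type} [Fintype ι] [DecidableEq ι] (_ : Fintype.card ι = n)
      (B : Matrix ι ι S) (_ : B.IsSymm) (_ : IsUnit B.det),
    ∃ V : Matrix ι ι S, IsUnit V.det ∧ (Vᵀ * B * V).IsDiag := by
  induction n with
  | zero =>
    intro ι _ _ hc B hs hd
    have : IsEmpty ι := Fintype.card_eq_zero_iff.mp hc
    exact ⟨1, by simp, fun i => isEmptyElim i⟩
  | succ n ih =>
    intro ι _ _ hc B hs hd
    have : Nonempty ι := Fintype.card_pos_iff.mp (by omega)
    obtain ⟨V, hV, i, hi⟩ := exists_pivot h2 B hs hd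
    set C := Vᵀ * B * V with hC
    have hCs : C.IsSymm := by
      rw [Matrix.IsSymm, hC, Matrix.transpose_mul, Matrix.transpose_mul, hs.eq,
        Matrix.transpose_transpose, Matrix.mul_assoc]
    have hCd : IsUnit C.det := by
      rw [hC, Matrix.det_mul, Matrix.det_mul, Matrix.det_transpose]
      exact (hV.mul hd).mul hV
    let e : {x // x = i} ⊕ {x // ¬ x = i} ≃ ι := Equiv.sumCompl (fun x => x = i)
    set D := C.submatrix e e with hD
    have hDs : D.IsSymm := by
      rw [hD, Matrix.IsSymm, Matrix.transpose_submatrix, hCs.eq]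
    have hDd : IsUnit D.det := by
      rwa [hD, Matrix.det_submatrix_equiv_self]
    have ha : IsUnit (D.toBlocks₁₁).det := by
      rw [Matrix.det_unique]
      exact hi
    have hb : D.toBlocks₂₁ = D.toBlocks₁₂ᵀ := by
      ext x y
      exact hDs.apply _ _
    have haa : D.toBlocks₁₁ᵀ = D.toBlocks₁₁ := by
      ext x y
      exact hDs.apply _ _
    have hdd : D.toBlocks₂₂ᵀ = D.toBlocks₂₂ := by
      ext x y
      exact hDs.apply _ _
    set a := D.toBlocks₁₁
    set b := D.toBlocks₁₂
    set d := D.toBlocks₂₂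
    have hDe : D = fromBlocks a b bᵀ d := by
      rw [← hb]; exact (fromBlocks_toBlocks D).symm
    set T : Matrix ({x // x = i} ⊕ {x // ¬ x = i}) ({x // x = i} ⊕ {x // ¬ x = i}) S :=
      fromBlocks 1 (-(a⁻¹ * b)) 0 1
    have hait : a⁻¹ᵀ = a⁻¹ := by rw [Matrix.transpose_nonsing_inv, haa]
    have hT : Tᵀ * D * T = fromBlocks a 0 0 (d - bᵀ * a⁻¹ * b) := by
      have e1 : a * (a⁻¹ * b) = b := by
        rw [← Matrix.mul_assoc, Matrix.mul_nonsing_inv _ ha, Matrix.one_mul]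
      have e2 : bᵀ * a⁻¹ * a = bᵀ := by
        rw [Matrix.mul_assoc, Matrix.nonsing_inv_mul _ ha, Matrix.mul_one]
      rw [hDe]
      simp only [T, fromBlocks_transpose, fromBlocks_multiply, Matrix.transpose_one,
        Matrix.transpose_zero, Matrix.transpose_neg, Matrix.transpose_mul, hait]
      simp only [Matrix.one_mul, Matrix.zero_mul, Matrix.mul_one, Matrix.mul_zero, add_zero,
        Matrix.neg_mul, Matrix.mul_neg, e1, e2]
      congr 1
      · simp
      · simp
      · simp [Matrix.mul_assoc]; abel
    have hTd : T.det = 1 := by simp [T]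
    have hEd : IsUnit (d - bᵀ * a⁻¹ * b).det := by
      have := congrArg Matrix.det hT
      rw [Matrix.det_mul, Matrix.det_mul, Matrix.det_transpose, hTd, det_fromBlocks_zero₂₁] at this
      simp only [one_mul, mul_one] at this
      rw [this] at hDd
      exact isUnit_of_mul_isUnit_right hDd
    have hEs : (d - bᵀ * a⁻¹ * b).IsSymm := by
      rw [Matrix.IsSymm]
      simp [Matrix.transpose_sub, Matrix.transpose_mul, hait, hdd, Matrix.mul_assoc]
    have hcard : Fintype.card {x // ¬ x = i} = n := by
      rw [Fintype.card_subtype_compl, Fintype.card_subtype_eq]; omega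
    obtain ⟨W, hW, hWd⟩ := ih hcard _ hEs hEd
    set X : Matrix ({x // x = i} ⊕ {x // ¬ x = i}) ({x // x = i} ⊕ {x // ¬ x = i}) S :=
      fromBlocks 1 0 0 W
    have hX : Xᵀ * (fromBlocks a 0 0 (d - bᵀ * a⁻¹ * b)) * X
        = fromBlocks a 0 0 (Wᵀ * (d - bᵀ * a⁻¹ * b) * W) := by
      simp [X, fromBlocks_transpose, fromBlocks_multiply]
    refine ⟨V * (T * X).submatrix e.symm e.symm, ?_, ?_⟩
    · rw [Matrix.det_mul, Matrix.det_submatrix_equiv_self, Matrix.det_mul, hTd]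
      simpa [X] using hV.mul hW
    · have : (V * (T * X).submatrix e.symm e.symm)ᵀ * B * (V * (T * X).submatrix e.symm e.symm)
          = (fromBlocks a 0 0 (Wᵀ * (d - bᵀ * a⁻¹ * b) * W)).submatrix e.symm e.symm := by
        have hC' : C = D.submatrix e.symm e.symm := by simp [hD]
        calc _ = ((T * X)ᵀ).submatrix e.symm e.symm * C * (T * X).submatrix e.symm e.symm := by
              rw [hC, Matrix.transpose_mul, Matrix.transpose_submatrix]
              simp only [Matrix.mul_assoc]
          _ = _ := by
              rw [hC', Matrix.submatrix_mul_equiv, Matrix.submatrix_mul_equiv, ← hX, ← hT,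
                Matrix.transpose_mul]
              simp only [Matrix.mul_assoc]
      rw [this]
      refine IsDiag.submatrix (IsDiag.fromBlocks ?_ hWd) e.symm.injective
      intro x y hxy
      exact absurd (Subsingleton.elim x y) hxy

theorem exists_split {S : Type} [CommRing S] [IsLocalRing S] {n : ℕ}
    (Q : Matrix (Fin n) (Fin n) S) (hQ : Q * Q = Q) :
    ∃ (m r : ℕ) (U : Matrix (Fin n) (Fin m ⊕ Fin r) S) (W : Matrix (Fin m ⊕ Fin r) (Fin n) S),
      m + r = n ∧ U * W = 1 ∧ W * U = 1 ∧ W * Q * U = fromBlocks 0 0 0 1 := by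
  have hf : IsIdempotentElem (toLin' Q) := by
    rw [IsIdempotentElem, Module.End.mul_eq_comp, ← Matrix.toLin'_mul, hQ]
  have hc := (LinearMap.IsIdempotentElem.isCompl hf).symm
  set K := LinearMap.ker (toLin' Q)
  set I := LinearMap.range (toLin' Q)
  have : Module.Projective S K := Module.Projective.of_split K.subtype (K.projectionOnto I hc)
    (Submodule.projectionOnto_comp_subtype hc)
  have : Module.Projective S I := Module.Projective.of_split I.subtype (I.projectionOnto K hc.symm)
    (Submodule.projectionOnto_comp_subtype hc.symm)
  have : Module.Finite S K := Module.Finite.of_surjective _ (Submodule.projectionOnto_surjective hc)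
  have : Module.Finite S I :=
    Module.Finite.of_surjective _ (Submodule.projectionOnto_surjective hc.symm)
  have : Module.Free S K := Module.free_of_flat_of_isLocalRing
  have : Module.Free S I := Module.free_of_flat_of_isLocalRing
  let bK := Module.finBasis S K
  let bI := Module.finBasis S I
  let b := (bK.prod bI).map (Submodule.prodEquivOfIsCompl K I hc)
  let c := Pi.basisFun S (Fin n)
  have hUW : c.toMatrix b * b.toMatrix c = 1 := Module.Basis.toMatrix_mul_toMatrix_flip _ _
  have hWU : b.toMatrix c * c.toMatrix b = 1 := Module.Basis.toMatrix_mul_toMatrix_flip _ _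
  refine ⟨_, _, c.toMatrix b, b.toMatrix c, ?_, hUW, hWU, ?_⟩
  · have := Fintype.card_congr (b.indexEquiv c)
    simpa using this
  · have : Q * c.toMatrix b = c.toMatrix b *
        (fromBlocks 0 0 0 1 : Matrix (Fin (Module.finrank S K) ⊕ Fin (Module.finrank S I))
          (Fin (Module.finrank S K) ⊕ Fin (Module.finrank S I)) S) := by
      ext i j
      have e1 : (Q * c.toMatrix b) i j = toLin' Q (b j) i := by
        simp [Matrix.mul_apply, Matrix.mulVec, dotProduct, c, Module.Basis.toMatrix_apply]
      rw [e1]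
      rcases j with j | j
      · have : toLin' Q (b (Sum.inl j)) = 0 := by
          have : b (Sum.inl j) = bK j := by simp [b]
          rw [this]
          exact (bK j).2
        rw [this]
        simp [Matrix.mul_apply]
      · have : toLin' Q (b (Sum.inr j)) = b (Sum.inr j) := by
          have h : b (Sum.inr j) = bI j := by simp [b]
          rw [h]
          obtain ⟨y, hy⟩ := (bI j).2
          rw [← hy]
          exact LinearMap.congr_fun hf y
        rw [this]
        simp [Matrix.mul_apply, Matrix.one_apply, c, Module.Basis.toMatrix_apply]
    rw [Matrix.mul_assoc, this, ← Matrix.mul_assoc, hWU, Matrix.one_mul]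

theorem isLocalRing_zmod (p k : ℕ) (hp : p.Prime) (hk : 1 ≤ k) : IsLocalRing (ZMod (p ^ k)) := by
  have : Fact p.Prime := ⟨hp⟩
  have : Nontrivial (ZMod (p ^ k)) := by
    have : Fact (1 < p ^ k) := ⟨Nat.one_lt_pow (by omega) hp.one_lt⟩
    infer_instance
  exact IsLocalRing.of_surjective' (PadicInt.toZModPow k : ℤ_[p] →+* ZMod (p ^ k))
    (ZMod.ringHom_surjective _)

theorem minExp_dvd (p q h : ℕ) (hp : p.Prime) (hq : q.Prime) (hpq : p ≠ q)
    (minE : ℕ) (hE : 0 < minE) (hEm : q ∣ p ^ minE - 1 ∨ q ∣ p ^ minE + 1)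
    (hmin : ∀ a, 0 < a → (q ∣ p ^ a - 1 ∨ q ∣ p ^ a + 1) → minE ≤ a)
    (hh : q ∣ p ^ (2 * h) - 1) : minE ∣ h := by
  have : Fact q.Prime := ⟨hq⟩
  have hp0 : (p : ZMod q) ≠ 0 := by
    rw [Ne, ZMod.natCast_eq_zero_iff]
    intro hd
    exact hpq ((Nat.prime_dvd_prime_iff_eq hq hp).mp hd).symm
  have key : ∀ a, (q ∣ p ^ a - 1 ∨ q ∣ p ^ a + 1) ↔ ((p : ZMod q) ^ a) ^ 2 = 1 := by
    intro a
    rw [sq_eq_one_iff, ← ZMod.natCast_eq_zero_iff, ← ZMod.natCast_eq_zero_iff,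
      Nat.cast_sub (Nat.one_le_pow _ _ hp.pos)]
    push_cast
    rw [sub_eq_zero, add_eq_zero_iff_eq_neg]
  have hh' : ((p : ZMod q) ^ h) ^ 2 = 1 := by
    rw [← pow_mul, mul_comm]
    have := (ZMod.natCast_eq_zero_iff _ _).mpr hh
    rw [Nat.cast_sub (Nat.one_le_pow _ _ hp.pos)] at this
    push_cast at this
    exact sub_eq_zero.mp this
  rw [key] at hEm
  have hr : ((p : ZMod q) ^ (h % minE)) ^ 2 = 1 := by
    rw [← Nat.div_add_mod h minE, pow_add, mul_pow, pow_mul, ← pow_mul, mul_comm _ 2, pow_mul, hEm,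
      one_pow, one_mul] at hh'
    exact hh'
  rw [← key] at hr
  by_contra hc
  have h1 : 0 < h % minE := Nat.pos_of_ne_zero (fun h0 => hc (Nat.dvd_of_mod_eq_zero h0))
  exact absurd (hmin _ h1 hr) (not_le.mpr (Nat.mod_lt _ hE))

theorem even_of_iso {F : Type} [Field F] (h2 : (2 : F) ≠ 0) {m : ℕ} (A B : Matrix (Fin m) (Fin m) F)
    (N : ℕ) (hN : Odd N) (hA : A ^ N = 1) (hs : B.IsSymm) (hd : B.det ≠ 0)
    (hiso : Aᵀ * B * A = B) (hfix : ∀ v, A *ᵥ v = v → v = 0) : Even m := by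
  by_contra hm
  rw [Nat.not_even_iff_odd] at hm
  have hsk : (B * A - Aᵀ * B)ᵀ = -(B * A - Aᵀ * B) := by
    simp [Matrix.transpose_mul, hs.eq]
  have hdet : (B * A - Aᵀ * B).det = 0 := by
    have := congrArg Matrix.det hsk
    rw [Matrix.det_transpose, Matrix.det_neg, Fintype.card_fin, hm.neg_one_pow] at this
    have h3 : 2 * (B * A - Aᵀ * B).det = 0 := by linear_combination this
    exact (mul_eq_zero.mp h3).resolve_left h2
  obtain ⟨v, hv0, hv⟩ := Matrix.exists_mulVec_eq_zero_iff.mpr hdet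
  obtain ⟨t, ht⟩ := hN
  have hAA : A ^ (N - 1) * A = 1 := by
    rw [← pow_succ]; convert hA using 2; omega
  -- Aᵀ B = B A^(N-1)
  have h4 : Aᵀ * B = B * A ^ (N - 1) := by
    calc Aᵀ * B = Aᵀ * B * (A * A ^ (N - 1)) := by
          rw [mul_eq_one_comm.mp hAA, Matrix.mul_one]
      _ = _ := by rw [← Matrix.mul_assoc, hiso]
  have h5 : A *ᵥ v = A ^ (N - 1) *ᵥ v := by
    rw [h4, ← Matrix.mul_sub, ← Matrix.mulVec_mulVec] at hv
    have := Matrix.eq_zero_of_mulVec_eq_zero hd hv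
    rw [Matrix.sub_mulVec] at this
    exact sub_eq_zero.mp this
  have h6 : A ^ 2 *ᵥ v = v := by
    rw [pow_two, ← Matrix.mulVec_mulVec, h5, Matrix.mulVec_mulVec, mul_eq_one_comm.mp hAA,
      Matrix.one_mulVec]
  have h7 : ∀ s, (A ^ 2) ^ s *ᵥ v = v := by
    intro s
    induction s with
    | zero => simp
    | succ s ih => rw [pow_succ, ← Matrix.mulVec_mulVec, h6, ih]
  have h8 : A *ᵥ v = v := by
    have e : A * (A ^ 2) ^ t = 1 := by rw [← pow_mul, ← pow_succ', ← ht, hA]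
    calc A *ᵥ v = A *ᵥ ((A ^ 2) ^ t *ᵥ v) := by rw [h7]
      _ = v := by rw [Matrix.mulVec_mulVec, e, Matrix.one_mulVec]
  exact hv0 (hfix v h8)

theorem card_modEq {p q m j : ℕ} (hp : p.Prime) (hq : q.Prime)
    (A : Matrix (Fin m) (Fin m) (ZMod p)) (hA : A ^ q ^ j = 1)
    (hfix : ∀ v, A *ᵥ v = v → v = 0) : q ∣ p ^ m - 1 := by
  have : Fact q.Prime := ⟨hq⟩
  have : Fact p.Prime := ⟨hp⟩
  let f : Function.End (Fin m → ZMod p) := fun v => A *ᵥ v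
  have hpow : ∀ (s : ℕ) (v : Fin m → ZMod p), (f ^ s : Function.End (Fin m → ZMod p)) v = A ^ s *ᵥ v := by
    intro s
    induction s with
    | zero => intro v; rw [pow_zero, pow_zero, Matrix.one_mulVec]; rfl
    | succ s ih =>
      intro v
      rw [pow_succ, pow_succ, ← Matrix.mulVec_mulVec, ← ih]
      rfl
  have hf : (f ^ q ^ j : Function.End (Fin m → ZMod p)) = 1 := by
    funext v
    rw [hpow, hA, Matrix.one_mulVec]; rfl
  have := Equiv.Perm.card_fixedPoints_modEq hf
  have hc : Fintype.card (Function.fixedPoints f) = 1 := by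
    rw [Fintype.card_eq_one_iff]
    refine ⟨⟨0, by simp [Function.fixedPoints, Function.IsFixedPt, f]⟩, ?_⟩
    rintro ⟨v, hv⟩
    exact Subtype.ext (hfix v hv)
  rw [hc] at this
  simp only [Fintype.card_pi, ZMod.card, Finset.prod_const, Finset.card_univ, Fintype.card_fin] at this
  exact (Nat.modEq_iff_dvd' (Nat.one_le_pow _ _ hp.pos)).mp this.symm

theorem block_sum_pow {S : Type} [CommRing S] {m r : ℕ} (A : Matrix (Fin m) (Fin m) S) (N : ℕ) :
    ∑ i ∈ Finset.range N, (fromBlocks A 0 0 (1 : Matrix (Fin r) (Fin r) S)) ^ i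
      = fromBlocks (∑ i ∈ Finset.range N, A ^ i) 0 0 (∑ i ∈ Finset.range N, 1) := by
  induction N with
  | zero => simp
  | succ N ih =>
    rw [Finset.sum_range_succ, Finset.sum_range_succ, Finset.sum_range_succ, ih,
      fromBlocks_diagonal_pow, fromBlocks_add]
    simp

theorem conj_pow' {S : Type} [CommRing S] {n : ℕ} {κ : Type} [Fintype κ] [DecidableEq κ]
    (A : Matrix (Fin n) (Fin n) S)
    (U : Matrix (Fin n) κ S) (W : Matrix κ (Fin n) S) (hUW : U * W = 1) (hWU : W * U = 1) (i : ℕ) :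
    (W * A * U) ^ i = W * A ^ i * U := by
  induction i with
  | zero => simp [hWU]
  | succ i ih =>
    rw [pow_succ, ih, pow_succ]
    calc W * A ^ i * U * (W * A * U) = W * A ^ i * (U * W) * A * U := by
          simp only [Matrix.mul_assoc]
      _ = _ := by rw [hUW]; simp only [Matrix.mul_assoc, Matrix.one_mul]

/-- splitting into the fixed part and its orthogonal complement -/
theorem split_fixed {S : Type} [CommRing S] [IsLocalRing S] {n : ℕ}
    (A B : Matrix (Fin n) (Fin n) S) (hs : B.IsSymm) (hd : IsUnit B.det) (hiso : Aᵀ * B * A = B)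
    (N : ℕ) (hN : 0 < N) (hA : A ^ N = 1) (hNu : IsUnit (N : S)) :
    ∃ (m r : ℕ) (U : Matrix (Fin n) (Fin m ⊕ Fin r) S) (W : Matrix (Fin m ⊕ Fin r) (Fin n) S)
      (A₁ B₁ : Matrix (Fin m) (Fin m) S) (B₂ : Matrix (Fin r) (Fin r) S),
      m + r = n ∧ U * W = 1 ∧ W * U = 1 ∧ W * A * U = fromBlocks A₁ 0 0 1 ∧
      Uᵀ * B * U = fromBlocks B₁ 0 0 B₂ ∧ B₁.IsSymm ∧ B₂.IsSymm ∧ IsUnit B₁.det ∧ IsUnit B₂.det ∧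
      A₁ᵀ * B₁ * A₁ = B₁ ∧ A₁ ^ N = 1 ∧ ∑ i ∈ Finset.range N, A₁ ^ i = 0 := by
  obtain ⟨c, hc⟩ := hNu.exists_right_inv
  set T := ∑ i ∈ Finset.range N, A ^ i with hT
  have hAS : A * T = T := by
    have h := mul_neg_geom_sum A N
    rw [hA, sub_self, ← hT, Matrix.sub_mul, Matrix.one_mul, sub_eq_zero] at h
    exact h.symm
  have hSA : T * A = T := by
    have h := geom_sum_mul_neg A N
    rw [hA, sub_self, ← hT, Matrix.mul_sub, Matrix.mul_one, sub_eq_zero] at h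
    exact h.symm
  have hAiS : ∀ i : ℕ, A ^ i * T = T := by
    intro i
    induction i with
    | zero => simp
    | succ i ih => rw [pow_succ, Matrix.mul_assoc, hAS, ih]
  have hSS : T * T = (N : S) • T := by
    conv_lhs => rw [hT, Finset.sum_mul]
    rw [← hT]
    simp [hAiS, Nat.cast_smul_eq_nsmul]
  have hAA : A * A ^ (N - 1) = 1 := by
    rw [← pow_succ', Nat.sub_add_cancel hN, hA]
  have hadj : ∀ i : ℕ, (Aᵀ) ^ i * B * A ^ i = B := by
    intro i
    induction i with
    | zero => simp
    | succ i ih =>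
      calc Aᵀ ^ (i + 1) * B * A ^ (i + 1) = Aᵀ ^ i * (Aᵀ * B * A) * A ^ i := by
            rw [pow_succ, pow_succ']; simp only [Matrix.mul_assoc]
        _ = B := by rw [hiso, ih]
  have hSt : Tᵀ = ∑ i ∈ Finset.range N, (Aᵀ) ^ i := by
    rw [hT, Matrix.transpose_sum]; simp [Matrix.transpose_pow]
  have hSB' : Tᵀ * B * T = (N : S) • (B * T) := by
    rw [hSt, Finset.sum_mul, Finset.sum_mul]
    have : ∀ i ∈ Finset.range N, Aᵀ ^ i * B * T = B * T := by
      intro i _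
      calc Aᵀ ^ i * B * T = Aᵀ ^ i * B * (A ^ i * T) := by rw [hAiS]
        _ = _ := by rw [← Matrix.mul_assoc, hadj]
    rw [Finset.sum_congr rfl this]
    simp [Nat.cast_smul_eq_nsmul]
  have hSB : Tᵀ * B = B * T := by
    have h1 : B * T = c • (Tᵀ * B * T) := by
      rw [hSB', smul_smul, mul_comm c, hc, one_smul]
    have h2 := congrArg Matrix.transpose h1
    rw [Matrix.transpose_smul, Matrix.transpose_mul, Matrix.transpose_mul, Matrix.transpose_mul,
      Matrix.transpose_transpose, hs.eq, ← Matrix.mul_assoc] at h2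
    rw [h2, h1]
  obtain ⟨m, r, U, W, hmr, hUW, hWU, hP⟩ := exists_split (c • T) (by
    rw [Matrix.smul_mul, Matrix.mul_smul, hSS, smul_smul c (N : S), mul_comm c, hc, one_smul])
  set A' := W * A * U with hA'
  set B' := Uᵀ * B * U with hB'
  set E : Matrix (Fin m ⊕ Fin r) (Fin m ⊕ Fin r) S := fromBlocks 0 0 0 1 with hE
  have hAE : A' * E = E := by
    rw [← hP]
    calc W * A * U * (W * (c • T) * U) = W * A * (U * W) * (c • T) * U := by
          simp only [Matrix.mul_assoc]
      _ = W * (c • (A * T)) * U := by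
          rw [hUW, Matrix.mul_one, Matrix.mul_assoc W A, Matrix.mul_smul]
      _ = _ := by rw [hAS]
  have hEA : E * A' = E := by
    rw [← hP]
    calc W * (c • T) * U * (W * A * U) = W * (c • T) * (U * W) * A * U := by
          simp only [Matrix.mul_assoc]
      _ = W * (c • (T * A)) * U := by
          rw [hUW, Matrix.mul_one, Matrix.mul_assoc W _ A, Matrix.smul_mul]
      _ = _ := by rw [hSA]
  have hEB : Eᵀ * B' = B' * E := by
    rw [← hP]
    calc (W * (c • T) * U)ᵀ * (Uᵀ * B * U) = Uᵀ * (c • Tᵀ) * (U * W)ᵀ * B * U := by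
          simp only [Matrix.mul_assoc, Matrix.transpose_mul, Matrix.transpose_smul]
      _ = Uᵀ * (c • (Tᵀ * B)) * U := by
          rw [hUW, Matrix.transpose_one, Matrix.mul_one, Matrix.mul_assoc Uᵀ _ B, Matrix.smul_mul]
      _ = Uᵀ * B * (U * W) * (c • T) * U := by
          rw [hSB, hUW, Matrix.mul_one, Matrix.mul_assoc Uᵀ B, Matrix.mul_smul B]
      _ = _ := by simp only [hB', Matrix.mul_assoc]
  have hA'e : A' = fromBlocks A'.toBlocks₁₁ 0 0 1 := by
    rw [← fromBlocks_toBlocks A', hE, fromBlocks_multiply, fromBlocks_inj] at hAE hEA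
    simp at hAE hEA
    conv_lhs => rw [← fromBlocks_toBlocks A']
    rw [hAE.1, hEA.1, hAE.2]
  have hB'e : B' = fromBlocks B'.toBlocks₁₁ 0 0 B'.toBlocks₂₂ := by
    rw [← fromBlocks_toBlocks B', hE, fromBlocks_transpose, fromBlocks_multiply,
      fromBlocks_multiply, fromBlocks_inj] at hEB
    simp at hEB
    conv_lhs => rw [← fromBlocks_toBlocks B']
    rw [← hEB.1, hEB.2]
  have hB's : B'.IsSymm := by
    rw [Matrix.IsSymm, hB', Matrix.transpose_mul, Matrix.transpose_mul, hs.eq,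
      Matrix.transpose_transpose, Matrix.mul_assoc]
  have hB'd : IsUnit B'.det := by
    refine Matrix.isUnit_det_of_right_inverse (B := W * B⁻¹ * Wᵀ) ?_
    calc Uᵀ * B * U * (W * B⁻¹ * Wᵀ) = Uᵀ * B * (U * W) * B⁻¹ * Wᵀ := by
          simp only [Matrix.mul_assoc]
      _ = Uᵀ * (B * B⁻¹) * Wᵀ := by rw [hUW, Matrix.mul_one]; simp only [Matrix.mul_assoc]
      _ = 1 := by rw [Matrix.mul_nonsing_inv _ hd, Matrix.mul_one, ← Matrix.transpose_mul, hWU,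
                    Matrix.transpose_one]
  have hiso' : A'ᵀ * B' * A' = B' := by
    calc (W * A * U)ᵀ * (Uᵀ * B * U) * (W * A * U)
        = Uᵀ * Aᵀ * (U * W)ᵀ * B * (U * W) * A * U := by
          simp only [Matrix.mul_assoc, Matrix.transpose_mul]
      _ = Uᵀ * (Aᵀ * B * A) * U := by
          rw [hUW, Matrix.transpose_one, Matrix.mul_one, Matrix.mul_one]
          simp only [Matrix.mul_assoc]
      _ = _ := by rw [hiso]
  have hpow : A' ^ N = 1 := by
    rw [hA', conj_pow' A U W hUW hWU, hA, Matrix.mul_one, hWU]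
  have hsum : c • ∑ i ∈ Finset.range N, A' ^ i = E := by
    rw [← hP, hT, Matrix.mul_smul, Matrix.smul_mul, Matrix.mul_sum, Matrix.sum_mul]
    congr 1
    exact Finset.sum_congr rfl (fun i _ => conj_pow' A U W hUW hWU i)
  refine ⟨m, r, U, W, A'.toBlocks₁₁, B'.toBlocks₁₁, B'.toBlocks₂₂, hmr, hUW, hWU, hA'e, hB'e,
    ?_, ?_, ?_, ?_, ?_, ?_, ?_⟩
  · ext i j; exact hB's.apply _ _
  · ext i j; exact hB's.apply _ _
  · rw [hB'e, det_fromBlocks_zero₂₁] at hB'd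
    exact isUnit_of_mul_isUnit_left hB'd
  · rw [hB'e, det_fromBlocks_zero₂₁] at hB'd
    exact isUnit_of_mul_isUnit_right hB'd
  · rw [hA'e, hB'e, fromBlocks_transpose, fromBlocks_multiply, fromBlocks_multiply,
      fromBlocks_inj] at hiso'
    simpa using hiso'.1
  · rw [hA'e, fromBlocks_diagonal_pow, ← fromBlocks_one, fromBlocks_inj] at hpow
    exact hpow.1
  · rw [hA'e, block_sum_pow, fromBlocks_smul, hE, fromBlocks_inj] at hsum
    have h1 := congrArg (fun X => (N : S) • X) hsum.1
    simpa only [smul_smul, hc, one_smul, smul_zero] using h1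

theorem stmt12 (p q : ℕ) (hp : p.Prime) (hq : q.Prime) (hp2 : p ≠ 2) (hq2 : q ≠ 2)
    (hpq : p ≠ q) (k : ℕ) (hk : 1 ≤ k) (d R n : ℕ) (hR : 0 < R) (hR' : R < 2 * minExp p q)
    (hn : n = 2 * minExp p q * d + R)
    (B : Matrix (Fin n) (Fin n) (ZMod (p ^ k))) (hsymm : B.IsSymm) (hdet : IsUnit B.det)
    (A : Matrix (Fin n) (Fin n) (ZMod (p ^ k))) (hiso : Aᵀ * B * A = B)
    (hord : ∃ j : ℕ, orderOf A = q ^ j) :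
    ∃ U : Matrix (Fin n) (Fin n) (ZMod (p ^ k)), IsUnit U.det ∧
      ∃ (B₁ : Matrix (Fin (2 * minExp p q * d)) (Fin (2 * minExp p q * d)) (ZMod (p ^ k)))
        (B₂ : Matrix (Fin R) (Fin R) (ZMod (p ^ k)))
        (A₁ : Matrix (Fin (2 * minExp p q * d)) (Fin (2 * minExp p q * d)) (ZMod (p ^ k))),
        Uᵀ * B * U = (Matrix.fromBlocks B₁ 0 0 B₂).submatrix
            (fun i => finSumFinEquiv.symm (Fin.cast hn i))
            (fun i => finSumFinEquiv.symm (Fin.cast hn i)) ∧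
        U⁻¹ * A * U = (Matrix.fromBlocks A₁ 0 0 (1 : Matrix (Fin R) (Fin R) (ZMod (p ^ k)))).submatrix
            (fun i => finSumFinEquiv.symm (Fin.cast hn i))
            (fun i => finSumFinEquiv.symm (Fin.cast hn i)) ∧
        ∃ f : (Fin R → ZMod (p ^ k)) →ₗ[ZMod (p ^ k)] (Fin n → ZMod (p ^ k)),
          Function.Injective f ∧ ∀ v : Fin R → ZMod (p ^ k), A.mulVec (f v) = f v := by
  obtain ⟨j, hj⟩ := hord
  have hA : A ^ q ^ j = 1 := by rw [← hj]; exact pow_orderOf_eq_one A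
  have hqo : Odd q := hq.odd_of_ne_two hq2
  have hpo : Odd p := hp.odd_of_ne_two hp2
  have hloc := isLocalRing_zmod p k hp hk
  have hqu : IsUnit ((q ^ j : ℕ) : ZMod (p ^ k)) := by
    rw [ZMod.isUnit_iff_coprime]
    exact Nat.Coprime.pow _ _ ((Nat.coprime_primes hq hp).mpr hpq.symm)
  have h2u : IsUnit (2 : ZMod (p ^ k)) := by
    have : IsUnit ((2 : ℕ) : ZMod (p ^ k)) := by
      rw [ZMod.isUnit_iff_coprime]
      exact Nat.Coprime.pow_right _ ((Nat.coprime_primes Nat.prime_two hp).mpr hp2.symm)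
    exact_mod_cast this
  obtain ⟨m, r, U, W, A₁, B₁, B₂, hmr, hUW, hWU, hA', hB', hB₁s, hB₂s, hB₁d, hB₂d, hiso₁, hA₁, hsum⟩ :=
    split_fixed A B hsymm hdet hiso (q ^ j) (Nat.pow_pos hq.pos) hA hqu
  -- divisibility of m
  have hdvd : 2 * minExp p q ∣ m := by
    have : Fact p.Prime := ⟨hp⟩
    let φ : ZMod (p ^ k) →+* ZMod p := ZMod.castHom (dvd_pow_self p (by omega)) (ZMod p)
    let a := φ.mapMatrix A₁
    let b := φ.mapMatrix B₁
    have ha : a ^ q ^ j = 1 := by rw [← map_pow, hA₁, map_one]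
    have hasum : ∑ i ∈ Finset.range (q ^ j), a ^ i = 0 := by
      have := congrArg φ.mapMatrix hsum
      rw [map_sum, map_zero] at this
      simpa only [map_pow] using this
    have hfix : ∀ v, a *ᵥ v = v → v = 0 := by
      intro v hv
      have h1 : ∀ i : ℕ, a ^ i *ᵥ v = v := by
        intro i
        induction i with
        | zero => simp
        | succ i ih => rw [pow_succ, ← Matrix.mulVec_mulVec, hv, ih]
      have h2 := congrArg (fun X => X *ᵥ v) hasum
      simp only [Matrix.sum_mulVec, h1, Matrix.zero_mulVec, Finset.sum_const,
        Finset.card_range] at h2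
      rw [← Nat.cast_smul_eq_nsmul (ZMod p)] at h2
      refine (smul_eq_zero.mp h2).resolve_left ?_
      intro h
      rw [ZMod.natCast_eq_zero_iff] at h
      exact hpq ((Nat.prime_dvd_prime_iff_eq hp hq).mp (hp.dvd_of_dvd_pow h))
    have h20 : (2 : ZMod p) ≠ 0 := by
      have := (h2u.map φ).ne_zero
      rwa [map_ofNat] at this
    have hev : Even m := by
      refine even_of_iso h20 a b (q ^ j) hqo.pow ha ?_ ?_ ?_ hfix
      · ext x y
        exact congrArg φ (hB₁s.apply x y)
      · rw [← RingHom.map_det]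
        exact (hB₁d.map φ).ne_zero
      · have := congrArg φ.mapMatrix hiso₁
        rw [map_mul, map_mul] at this
        exact this
    have hcard := card_modEq hp hq a ha hfix
    obtain ⟨h, hh⟩ := hev
    have hmm : m = 2 * h := by omega
    rw [hmm] at hcard ⊢
    refine Nat.mul_dvd_mul_left 2 ?_
    have hne : {a : ℕ | 0 < a ∧ (q ∣ p ^ a - 1 ∨ q ∣ p ^ a + 1)}.Nonempty := by
      by_contra hc
      rw [Set.not_nonempty_iff_eq_empty] at hc
      have : minExp p q = 0 := by rw [minExp, hc, Nat.sInf_empty]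
      omega
    have hmem := Nat.sInf_mem hne
    exact minExp_dvd p q h hp hq hpq (minExp p q) hmem.1 hmem.2
      (fun a h1 h2 => Nat.sInf_le ⟨h1, h2⟩) hcard
  have hle : m ≤ 2 * minExp p q * d := by
    obtain ⟨t, ht⟩ := hdvd
    rw [ht]
    refine Nat.mul_le_mul_left _ ?_
    by_contra hlt
    have : 2 * minExp p q * (d + 1) ≤ 2 * minExp p q * t := Nat.mul_le_mul_left _ (by omega)
    rw [mul_add] at this
    omega
  obtain ⟨s, hs⟩ := Nat.exists_eq_add_of_le hle
  have hr : r = s + R := by omega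
  obtain ⟨V, hV, hVd⟩ := exists_diag h2u r (Fintype.card_fin r) B₂ hB₂s hB₂d
  generalize 2 * minExp p q * d = D at *
  let g : Fin n ≃ Fin D ⊕ Fin R := (finCongr hn).trans finSumFinEquiv.symm
  let σ : Fin D ⊕ Fin R ≃ Fin m ⊕ Fin r :=
    ((((finCongr hs).trans finSumFinEquiv.symm).sumCongr (Equiv.refl (Fin R))).trans
      (Equiv.sumAssoc (Fin m) (Fin s) (Fin R))).trans
      ((Equiv.refl (Fin m)).sumCongr (finSumFinEquiv.trans (finCongr hr.symm)))
  have hσ : ∀ y : Fin R, ∃ z, σ (Sum.inr y) = Sum.inr z := fun y => ⟨_, rfl⟩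
  let G : Matrix (Fin m ⊕ Fin r) (Fin m ⊕ Fin r) (ZMod (p ^ k)) := fromBlocks 1 0 0 V
  let H : Matrix (Fin m ⊕ Fin r) (Fin m ⊕ Fin r) (ZMod (p ^ k)) := fromBlocks 1 0 0 V⁻¹
  have hG : G = fromBlocks 1 0 0 V := rfl
  have hH : H = fromBlocks 1 0 0 V⁻¹ := rfl
  let X := U * G
  let Y := H * W
  have hXY : X * Y = 1 := by
    calc X * Y = U * (G * H) * W := by
          simp only [X, Y, Matrix.mul_assoc]
      _ = 1 := by
          rw [hG, hH, fromBlocks_multiply]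
          simp [Matrix.mul_nonsing_inv _ hV, hUW]
  have hXA : Y * A * X = fromBlocks A₁ 0 0 1 := by
    calc Y * A * X = H * (W * A * U) * G := by
          simp only [X, Y, Matrix.mul_assoc]
      _ = _ := by
          rw [hG, hH, hA', fromBlocks_multiply, fromBlocks_multiply]
          simp [Matrix.nonsing_inv_mul _ hV]
  have hXB : Xᵀ * B * X = fromBlocks B₁ 0 0 (Vᵀ * B₂ * V) := by
    calc Xᵀ * B * X = (G)ᵀ * (Uᵀ * B * U) * G := by
          simp only [X, Matrix.mul_assoc, Matrix.transpose_mul]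
      _ = _ := by
          rw [hG, hB', fromBlocks_transpose, fromBlocks_multiply, fromBlocks_multiply]
          simp
  -- matrices that are diagonal on the last indices become block diagonal after reindexing
  have hblk : ∀ (M₁ : Matrix (Fin m) (Fin m) (ZMod (p ^ k))) (M₂ : Matrix (Fin r) (Fin r) (ZMod (p ^ k))),
      M₂.IsDiag → ((fromBlocks M₁ 0 0 M₂).submatrix σ σ).toBlocks₁₂ = 0 ∧
        ((fromBlocks M₁ 0 0 M₂).submatrix σ σ).toBlocks₂₁ = 0 ∧
        (M₂ = 1 → ((fromBlocks M₁ 0 0 M₂).submatrix σ σ).toBlocks₂₂ = 1) := by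
    intro M₁ M₂ hM
    refine ⟨?_, ?_, ?_⟩
    · ext x y
      obtain ⟨z, hz⟩ := hσ y
      change fromBlocks M₁ 0 0 M₂ (σ (Sum.inl x)) (σ (Sum.inr y)) = 0
      rcases hx : σ (Sum.inl x) with w | w
      · rw [hz]; rfl
      · rw [hz]
        refine hM (fun hwz => ?_)
        rw [← hwz, ← hx] at hz
        exact Sum.inr_ne_inl (σ.injective hz)
    · ext y x
      obtain ⟨z, hz⟩ := hσ y
      change fromBlocks M₁ 0 0 M₂ (σ (Sum.inr y)) (σ (Sum.inl x)) = 0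
      rcases hx : σ (Sum.inl x) with w | w
      · rw [hz]; rfl
      · rw [hz]
        refine hM (fun hwz => ?_)
        rw [hwz, ← hx] at hz
        exact Sum.inr_ne_inl (σ.injective hz)
    · rintro rfl
      ext y y'
      obtain ⟨z, hz⟩ := hσ y
      obtain ⟨z', hz'⟩ := hσ y'
      change fromBlocks M₁ 0 0 1 (σ (Sum.inr y)) (σ (Sum.inr y')) = _
      have : z = z' ↔ y = y' := by
        constructor
        · intro h
          rw [← h, ← hz] at hz'
          exact (Sum.inr_injective (σ.injective hz')).symm
        · rintro rfl
          rw [hz] at hz'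
          exact Sum.inr_injective hz'
      rw [hz, hz', fromBlocks_apply₂₂, Matrix.one_apply, Matrix.one_apply]
      simp only [this]
  have hbA := hblk A₁ 1 (Matrix.isDiag_one)
  have hbB := hblk B₁ _ hVd
  let τ : Fin n ≃ Fin m ⊕ Fin r := g.trans σ
  let Z := X.submatrix id τ
  let Z' := Y.submatrix τ id
  have hZZ : Z * Z' = 1 := by
    have := Matrix.submatrix_mul_equiv X Y id τ id
    rw [hXY, Matrix.submatrix_id_id] at this
    exact this
  have hinv : Z⁻¹ = Z' := Matrix.inv_eq_right_inv hZZ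
  have hZA : Z⁻¹ * A * Z = (fromBlocks A₁ 0 0 1).submatrix τ τ := by
    rw [hinv, ← hXA]
    rfl
  have hZB : Zᵀ * B * Z = (fromBlocks B₁ 0 0 (Vᵀ * B₂ * V)).submatrix τ τ := by
    rw [← hXB]
    rfl
  refine ⟨Z, Matrix.isUnit_det_of_right_inverse hZZ,
    ((fromBlocks B₁ 0 0 (Vᵀ * B₂ * V)).submatrix σ σ).toBlocks₁₁,
    ((fromBlocks B₁ 0 0 (Vᵀ * B₂ * V)).submatrix σ σ).toBlocks₂₂,
    ((fromBlocks A₁ 0 0 1).submatrix σ σ).toBlocks₁₁, ?_, ?_, ?_⟩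
  · rw [hZB]
    conv_rhs => rw [← hbB.1, ← hbB.2.1, fromBlocks_toBlocks]
    rfl
  · rw [hZA]
    conv_rhs =>
      rw [← hbA.1, ← hbA.2.2 rfl]
      rw [← hbA.2.1, fromBlocks_toBlocks]
    rfl
  · let ρ : Fin R → Fin m ⊕ Fin r := fun y => σ (Sum.inr y)
    have hYX : Y * X = 1 := by
      calc Y * X = H * (W * U) * G := by
            simp only [X, Y, Matrix.mul_assoc]
        _ = 1 := by
            rw [hWU, Matrix.mul_one, hG, hH, fromBlocks_multiply]
            simp [Matrix.nonsing_inv_mul _ hV]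
    let E : Matrix (Fin m ⊕ Fin r) (Fin m ⊕ Fin r) (ZMod (p ^ k)) := fromBlocks A₁ 0 0 1
    have hE : E = fromBlocks A₁ 0 0 1 := rfl
    have hAX : A * X = X * E := by
      rw [hE, ← hXA, Matrix.mul_assoc Y, ← Matrix.mul_assoc X, hXY, Matrix.one_mul]
    have hXρ : A * X.submatrix id ρ = X.submatrix id ρ := by
      have h1 : A * X.submatrix id ρ = (A * X).submatrix id ρ := rfl
      rw [h1, hAX]
      ext i y
      obtain ⟨z, hz⟩ := hσ y
      have : ρ y = Sum.inr z := hz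
      simp only [Matrix.submatrix_apply, this, Matrix.mul_apply, id]
      simp [hE, Matrix.one_apply]
    have hl : Y.submatrix ρ id * X.submatrix id ρ = 1 := by
      have h1 : Y.submatrix ρ id * X.submatrix id ρ = (Y * X).submatrix ρ ρ := rfl
      rw [h1, hYX]
      exact Matrix.submatrix_one _ (σ.injective.comp Sum.inr_injective)
    refine ⟨Matrix.mulVecLin (X.submatrix id ρ), ?_, ?_⟩
    · intro v w hvw
      have := congrArg (fun x => Y.submatrix ρ id *ᵥ x) hvw
      simpa only [Matrix.mulVecLin_apply, Matrix.mulVec_mulVec, hl, Matrix.one_mulVec] using this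
    · intro v
      rw [Matrix.mulVecLin_apply, Matrix.mulVec_mulVec, hXρ]
end

section
/- Let p ≠ q be odd primes, k ≥ 1, and let B be a p^k-form of rank n = 2[q|p]·d with d ≥ 1, and suppose ε(B) ≠ η(q)^d. Let A be an isometry of B whose order is a power of q. Then there exists an invertible n×n matrix U over ℤ/p^kℤ such that Uᵀ B U is block-diagonal diag(B₁, B₂) with blocks of sizes 2[q|p]·(d−1) and 2[q|p], and U⁻¹ A U is the block-diagonal matrix diag(A₁, I_{2[q|p]}); in particular A fixes pointwise a free ℤ/p^kℤ-submodule of rank at least 2[q|p]. -/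
open Matrix

lemma aux_q {R : Type*} [CommRing R] {α β : Type*} [Fintype α] [Fintype β]
    (B : Matrix α α R) (U : Matrix α β R) (x y : β → R) :
    (U *ᵥ x) ⬝ᵥ B *ᵥ (U *ᵥ y) = x ⬝ᵥ (Uᵀ * B * U) *ᵥ y := by
  rw [← mulVec_mulVec, ← mulVec_mulVec, dotProduct_mulVec x, vecMul_transpose]

lemma aux_mapsum {F K : Type*} [Field F] [Field K] (ψ : AddChar F K) {α : Type*} (s : Finset α)
    (f : α → F) : ψ (∑ i ∈ s, f i) = ∏ i ∈ s, ψ (f i) := by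
  classical
  induction s using Finset.induction_on with
  | empty => simp
  | insert a s ha ih => rw [Finset.sum_insert ha, Finset.prod_insert ha, AddChar.map_add_eq_mul, ih]

lemma aux_diag {F : Type*} [Field F] (h2 : (2:F) ≠ 0) {α : Type*} [Fintype α] [DecidableEq α]
    (B : Matrix α α F) (hB : B.IsSymm) :
    ∃ U : Matrix α α F, IsUnit U.det ∧ ∃ a : α → F, Uᵀ * B * U = diagonal a := by
  have : Invertible (2:F) := invertibleOfNonzero h2
  have hs : LinearMap.IsSymm (Matrix.toBilin' B) := by
    refine ⟨fun x y => ?_⟩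
    change Matrix.toBilin' B x y = Matrix.toBilin' B y x
    rw [Matrix.toBilin'_apply', Matrix.toBilin'_apply', Matrix.dotProduct_mulVec,
      ← Matrix.mulVec_transpose, hB.eq, dotProduct_comm]
  obtain ⟨v, hv⟩ := LinearMap.BilinForm.exists_orthogonal_basis hs
  let e : Fin (Module.finrank F (α → F)) ≃ α := (finCongr (by simp)).trans (Fintype.equivFin α).symm
  let w := v.reindex e
  let U : Matrix α α F := (Pi.basisFun F α).toMatrix w
  have hU : IsUnit U.det := by
    rw [← Matrix.isUnit_iff_isUnit_det]
    have := (Pi.basisFun F α).invertibleToMatrix w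
    exact isUnit_of_invertible _
  refine ⟨U, hU, fun i => (Uᵀ * B * U) i i, ?_⟩
  ext i j
  by_cases hij : i = j
  · subst hij; simp
  · rw [diagonal_apply_ne _ hij]
    have h := hv (i := e.symm i) (j := e.symm j) (fun h => hij (e.symm.injective h))
    have h' : Matrix.toBilin' B (w i) (w j) = 0 := by
      simpa [w] using h
    rw [Matrix.toBilin'_apply', dotProduct_mulVec] at h'
    exact h'

lemma aux_gauss1 {p : ℕ} [Fact p.Prime] (hp2 : p ≠ 2) {K : Type*} [Field K]
    (ψ : AddChar (ZMod p) K) (hψ : ψ.IsPrimitive) (a : ZMod p) (ha : a ≠ 0) :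
    ∑ x : ZMod p, ψ (a * x ^ 2) = (quadraticChar (ZMod p) a : K) *
      gaussSum ((quadraticChar (ZMod p)).ringHomComp (Int.castRingHom K)) ψ := by
  have hF : ringChar (ZMod p) ≠ 2 := by rwa [ZMod.ringChar_zmod_n]
  have h1 : ∑ x : ZMod p, ψ (a * x ^ 2) =
      ∑ y : ZMod p, ((quadraticChar (ZMod p) y : ℤ) + 1 : K) * ψ (a * y) := by
    rw [← Finset.sum_fiberwise (s := Finset.univ) (g := fun x : ZMod p => x ^ 2)]
    refine Finset.sum_congr rfl fun y _ => ?_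
    rw [Finset.sum_congr rfl (g := fun _ => ψ (a * y)) (by
      intro x hx
      rw [(Finset.mem_filter.1 hx).2])]
    rw [Finset.sum_const, nsmul_eq_mul]
    congr 1
    have := quadraticChar_card_sqrts hF y
    have h3 := congrArg (Int.cast : ℤ → K) this
    push_cast at h3
    rw [← h3]
    congr 2
    ext x; simp
  have h0 : ∑ y : ZMod p, ψ (a * y) = 0 := by
    exact AddChar.sum_eq_zero_of_ne_one (hψ ha)
  rw [h1]
  simp_rw [add_mul, one_mul]
  rw [Finset.sum_add_distrib, h0, add_zero]
  have h4 := gaussSum_mulShift ((quadraticChar (ZMod p)).ringHomComp (Int.castRingHom K)) ψ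
    (Units.mk0 a ha)
  rw [← h4]
  simp only [gaussSum, MulChar.ringHomComp_apply, Units.val_mk0, AddChar.mulShift_apply,
    eq_intCast]
  rw [← mul_assoc, ← Int.cast_mul, ← pow_two, quadraticChar_sq_one ha]
  simp

lemma aux_gauss {p : ℕ} [Fact p.Prime] (hp2 : p ≠ 2) {K : Type*} [Field K]
    (ψ : AddChar (ZMod p) K) (hψ : ψ.IsPrimitive) {α : Type*} [Fintype α] [DecidableEq α]
    (B : Matrix α α (ZMod p)) (hB : B.IsSymm) (hd : B.det ≠ 0) :
    ∑ v : α → ZMod p, ψ (v ⬝ᵥ B *ᵥ v) = (quadraticChar (ZMod p) B.det : K) *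
      gaussSum ((quadraticChar (ZMod p)).ringHomComp (Int.castRingHom K)) ψ ^ Fintype.card α := by
  have h2 : (2 : ZMod p) ≠ 0 := by
    have hF : ringChar (ZMod p) ≠ 2 := by rwa [ZMod.ringChar_zmod_n]
    exact Ring.two_ne_zero hF
  obtain ⟨U, hU, a, ha⟩ := aux_diag h2 B hB
  have hdet : U.det ^ 2 * B.det = ∏ i, a i := by
    rw [← det_diagonal, ← ha]; simp; ring
  have hai : ∀ i, a i ≠ 0 := by
    intro i hi
    have : ∏ i, a i = 0 := Finset.prod_eq_zero (Finset.mem_univ i) hi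
    rw [← hdet] at this
    simp [hU.ne_zero, hd] at this
  have hbij : Function.Bijective (fun x : α → ZMod p => U *ᵥ x) := by
    have hUu : IsUnit U := (Matrix.isUnit_iff_isUnit_det _).2 hU
    exact ⟨Matrix.mulVec_injective_iff_isUnit.2 hUu, Matrix.mulVec_surjective_iff_isUnit.2 hUu⟩
  rw [← hbij.sum_comp (fun v => ψ (v ⬝ᵥ B *ᵥ v))]
  have h5 : ∀ x : α → ZMod p, ψ ((U *ᵥ x) ⬝ᵥ B *ᵥ (U *ᵥ x)) = ∏ i, ψ (a i * x i ^ 2) := by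
    intro x
    have : (U *ᵥ x) ⬝ᵥ B *ᵥ (U *ᵥ x) = ∑ i, a i * x i ^ 2 := by
      rw [aux_q, ha, dotProduct]
      refine Finset.sum_congr rfl fun i _ => ?_
      rw [mulVec_diagonal]; ring
    rw [this, aux_mapsum]
  simp_rw [h5]
  rw [← Fintype.prod_sum (fun i y => ψ (a i * y ^ 2))]
  simp_rw [fun i => aux_gauss1 hp2 ψ hψ (a i) (hai i)]
  rw [Finset.prod_mul_distrib, Finset.prod_const, Finset.card_univ]
  congr 1
  rw [← Int.cast_prod, ← map_prod, ← hdet, map_mul, map_pow, quadraticChar_sq_one hU.ne_zero,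
    one_mul]

lemma aux_fix {q : ℕ} [Fact q.Prime] {K : Type*} [Field K] [CharP K q] {X T : Type*}
    [Fintype X] [DecidableEq X] [Fintype T] [DecidableEq T] (g : X → X) (j : ℕ)
    (hg : g^[q ^ j] = id) (x0 : X) (h0 : ∀ x, g x = x ↔ x = x0) (Q : X → T)
    (hQ : ∀ x, Q (g x) = Q x) (ψ : T → K) : ∑ x, ψ (Q x) = ψ (Q x0) := by
  have hc : ∀ t, ((Finset.univ.filter (fun x => Q x = t)).card : K) = if Q x0 = t then 1 else 0 := by
    intro t
    let f : Function.End {x // Q x = t} := fun x => ⟨g x.1, by rw [hQ, x.2]⟩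
    have hfi : ∀ n (x : {x // Q x = t}), ((f ^ n) x).1 = g^[n] x.1 := by
      intro n
      induction n with
      | zero => intro x; rfl
      | succ n ih => 
        intro x
        rw [pow_succ, Function.iterate_succ_apply]
        exact ih (f x)
    have hf : f ^ q ^ j = 1 := by
      funext x
      apply Subtype.ext
      rw [hfi, hg]; rfl
    have := Equiv.Perm.card_fixedPoints_modEq hf
    rw [Fintype.card_subtype] at this
    rw [(CharP.natCast_eq_natCast K q).2 this]
    split_ifs with h
    · have : Fintype.card f.fixedPoints = 1 := by
        rw [Fintype.card_eq_one_iff]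
        refine ⟨⟨⟨x0, h⟩, Subtype.ext ((h0 x0).2 rfl)⟩, ?_⟩
        rintro ⟨⟨y, hy⟩, hy'⟩
        apply Subtype.ext; apply Subtype.ext
        exact (h0 y).1 (congrArg Subtype.val hy')
      rw [this]; simp
    · have : Fintype.card f.fixedPoints = 0 := by
        rw [Fintype.card_eq_zero_iff]
        refine ⟨?_⟩
        rintro ⟨⟨y, hy⟩, hy'⟩
        have := (h0 y).1 (congrArg Subtype.val hy')
        subst this
        exact h hy
      rw [this]; simp
  rw [← Finset.sum_fiberwise (s := Finset.univ) (g := Q)]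
  rw [Finset.sum_congr rfl (g := fun t => (if Q x0 = t then 1 else 0) * ψ t)]
  · simp
  · intro t _
    rw [← hc, ← nsmul_eq_mul, ← Finset.sum_const]
    refine Finset.sum_congr rfl fun x hx => ?_
    rw [(Finset.mem_filter.1 hx).2]

lemma aux_core {p q : ℕ} [Fact p.Prime] [Fact q.Prime] (hp2 : p ≠ 2) {K : Type*} [Field K]
    [CharP K q] (ψ : AddChar (ZMod p) K) (hψ : ψ.IsPrimitive) {α : Type*} [Fintype α]
    [DecidableEq α] (B A : Matrix α α (ZMod p)) (hB : B.IsSymm) (hd : B.det ≠ 0)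
    (hA : Aᵀ * B * A = B) (j : ℕ) (hj : A ^ q ^ j = 1) (hfix : ∀ v, A *ᵥ v = v → v = 0) :
    (quadraticChar (ZMod p) B.det : K) *
      gaussSum ((quadraticChar (ZMod p)).ringHomComp (Int.castRingHom K)) ψ ^ Fintype.card α
      = 1 := by
  rw [← aux_gauss hp2 ψ hψ B hB hd]
  have hit : ∀ n (v : α → ZMod p), (fun v => A *ᵥ v)^[n] v = (A ^ n) *ᵥ v := by
    intro n
    induction n with
    | zero => intro v; simp
    | succ n ih => intro v; rw [Function.iterate_succ_apply, ih, mulVec_mulVec, pow_succ]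
  rw [aux_fix (q := q) (fun v => A *ᵥ v) j (by funext v; rw [hit, hj]; simp) 0
    (fun x => ⟨hfix x, fun h => by subst h; simp⟩) (fun v => v ⬝ᵥ B *ᵥ v) ?_ ψ]
  · simp
  · intro x
    rw [aux_q, hA]

lemma aux_final {p q : ℕ} [Fact p.Prime] [Fact q.Prime] (hp2 : p ≠ 2) (hq2 : q ≠ 2) (hpq : p ≠ q)
    {α : Type*} [Fintype α]
    [DecidableEq α] (B A : Matrix α α (ZMod p)) (hB : B.IsSymm) (hd : B.det ≠ 0)
    (hA : Aᵀ * B * A = B) (j : ℕ) (hj : A ^ q ^ j = 1) (hfix : ∀ v, A *ᵥ v = v → v = 0) :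
    ∃ N, Fintype.card α = 2 * N ∧ ((quadraticChar (ZMod p) B.det : ZMod q) *
      ((quadraticChar (ZMod p) (-1) : ZMod q) * p) ^ N = 1) := by
  have hF : ringChar (ZMod p) ≠ 2 := by rwa [ZMod.ringChar_zmod_n]
  let P := AddChar.FiniteField.primitiveChar (ZMod p) (ZMod q) (by
    rw [ZMod.ringChar_zmod_n, ZMod.ringChar_zmod_n]; exact hpq.symm)
  let K := CyclotomicField P.n (ZMod q)
  have : CharP K q := charP_of_injective_algebraMap (algebraMap (ZMod q) K).injective q
  let ψ : AddChar (ZMod p) K := P.char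
  have hψ : ψ.IsPrimitive := P.prim
  have h2K : (2 : K) ≠ 0 := Ring.two_ne_zero (by rwa [ringChar.eq K q])
  set G := gaussSum ((quadraticChar (ZMod p)).ringHomComp (Int.castRingHom K)) ψ with hG
  have h1 := aux_core hp2 ψ hψ B A hB hd hA j hj hfix
  rw [← hG] at h1
  have hev : Even (Fintype.card α) := by
    by_contra hodd
    rw [Nat.not_even_iff_odd] at hodd
    obtain ⟨t, ht⟩ := quadraticChar_exists_neg_one hF
    have ht0 : t ≠ 0 := by rintro rfl; simp at ht
    have h3 := aux_core hp2 ψ hψ (t • B) A (by rw [Matrix.IsSymm, transpose_smul, hB.eq])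
      (by rw [det_smul]; exact mul_ne_zero (pow_ne_zero _ ht0) hd) (by simp [hA]) j hj hfix
    rw [det_smul, map_mul, map_pow, ht, hodd.neg_one_pow, ← hG] at h3
    rw [Int.cast_mul, Int.cast_neg, Int.cast_one] at h3
    have : (2 : K) = 0 := by linear_combination -h1 - h3
    exact h2K this
  obtain ⟨N, hN⟩ := hev
  refine ⟨N, by omega, ?_⟩
  have hsq : G ^ 2 = _ := gaussSum_sq (χ := (quadraticChar (ZMod p)).ringHomComp (Int.castRingHom K))
    (by
      obtain ⟨t, ht⟩ := quadraticChar_exists_neg_one hF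
      have ht0 : t ≠ 0 := by rintro rfl; simp at ht
      intro h
      have := congrArg (fun c => c t) h
      simp only [MulChar.ringHomComp_apply, ht, MulChar.one_apply (Ne.isUnit ht0)] at this
      apply h2K
      push_cast [eq_intCast] at this
      linear_combination -this) ((quadraticChar_isQuadratic (ZMod p)).comp _) hψ
  rw [hN, ← two_mul, pow_mul, hsq] at h1
  apply (algebraMap (ZMod q) K).injective
  simpa [ZMod.card] using h1
lemma aux_unit {p k : ℕ} (hp : p.Prime) (hk : 1 ≤ k) (x : ZMod (p ^ k)) :
    IsUnit x ↔ ZMod.castHom (dvd_pow_self p (by omega : k ≠ 0)) (ZMod p) x ≠ 0 := by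
  have : Fact p.Prime := ⟨hp⟩
  have : NeZero (p ^ k) := ⟨pow_ne_zero _ hp.ne_zero⟩
  obtain ⟨n, rfl⟩ := ZMod.natCast_zmod_surjective x
  rw [map_natCast, Ne, ZMod.natCast_eq_zero_iff, ZMod.isUnit_iff_coprime,
    Nat.coprime_pow_right_iff (by omega), Nat.coprime_comm, hp.coprime_iff_not_dvd]

lemma aux_square {p k : ℕ} (hp : p.Prime) (hp2 : p ≠ 2) (hk : 1 ≤ k) (x : ZMod (p ^ k))
    (hx : IsUnit x) :
    IsSquare x ↔ IsSquare (ZMod.castHom (dvd_pow_self p (by omega : k ≠ 0)) (ZMod p) x) := by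
  have : Fact p.Prime := ⟨hp⟩
  set φ := ZMod.castHom (dvd_pow_self p (by omega : k ≠ 0)) (ZMod p) with hφ
  refine ⟨fun h => h.map φ, ?_⟩
  rintro ⟨y', hy⟩
  obtain ⟨y, rfl⟩ := ZMod.castHom_surjective (dvd_pow_self p (by omega : k ≠ 0)) y'
  rw [← hφ] at hy
  have hx0 := (aux_unit hp hk x).1 hx
  rw [← hφ] at hx0
  have hyu : IsUnit y := by
    rw [aux_unit hp hk, ← hφ]
    intro h0
    rw [h0] at hy
    simp [hy] at hx0
  obtain ⟨u, rfl⟩ := hyu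
  set z : ZMod (p ^ k) := x * ((u⁻¹ : (ZMod (p^k))ˣ) : ZMod (p^k)) ^ 2 with hz
  have hxz : x = u ^ 2 * z := by
    rw [hz, mul_left_comm, ← mul_pow]; simp
  have hφz : φ z = 1 := by
    have h1 : φ u ≠ 0 := (u.isUnit.map φ).ne_zero
    rw [hxz, map_mul, map_pow, ← pow_two] at hy
    exact (mul_eq_left₀ (pow_ne_zero 2 h1)).1 hy
  have hdvd : ((p : ℕ) : ZMod (p ^ k)) ∣ z - 1 := by
    have : NeZero (p ^ k) := ⟨pow_ne_zero _ hp.ne_zero⟩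
    have h0 : φ (z - 1) = 0 := by rw [map_sub, hφz, map_one, sub_self]
    obtain ⟨n, hn⟩ := ZMod.natCast_zmod_surjective (z - 1)
    rw [← hn] at h0 ⊢
    rw [map_natCast, ZMod.natCast_eq_zero_iff] at h0
    exact Nat.cast_dvd_cast h0
  have h2 := dvd_sub_pow_of_dvd_sub hdvd (k - 1)
  rw [Nat.sub_add_cancel hk, one_pow] at h2
  have h3 : ((p : ZMod (p ^ k)) ^ k) = 0 := by
    rw [← Nat.cast_pow]; exact ZMod.natCast_self _
  rw [h3, zero_dvd_iff, sub_eq_zero] at h2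
  have hodd : Odd (p ^ (k - 1)) := (hp.odd_of_ne_two hp2).pow
  obtain ⟨m, hm⟩ := hodd
  refine ⟨u * z ^ (m + 1), ?_⟩
  rw [hm] at h2
  calc x = u ^ 2 * (z * z ^ (2 * m + 1)) := by rw [h2, mul_one, hxz]
    _ = _ := by ring

lemma aux_fixed {R F : Type*} [CommRing R] [Field F] (φ : R →+* F) (hsurj : Function.Surjective φ)
    (hu : ∀ x, φ x ≠ 0 → IsUnit x) {α : Type*} [Fintype α] [DecidableEq α]
    (B A : Matrix α α R) (hB : B.IsSymm) (hd : φ B.det ≠ 0) (hA : Aᵀ * B * A = B) (a : ℕ)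
    (ha : A ^ a = 1) (haF : (a : F) ≠ 0) (h2F : (2 : F) ≠ 0)
    (hno : ¬ ∃ v, A *ᵥ v = v ∧ IsUnit (v ⬝ᵥ B *ᵥ v)) :
    ∀ w, (A.map φ) *ᵥ w = w → w = 0 := by
  intro w hw
  by_contra hw0
  have hmv : ∀ (M : Matrix α α R) (x : α → R), (fun i => φ ((M *ᵥ x) i)) =
      (M.map φ) *ᵥ (fun i => φ (x i)) := by
    intro M x
    ext i
    simp [mulVec, dotProduct]
  have hdp : ∀ (x y : α → R), φ (x ⬝ᵥ y) = (fun i => φ (x i)) ⬝ᵥ (fun i => φ (y i)) := by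
    intro x y
    simp [dotProduct]
  have hBu : IsUnit (B.map φ) := by
    rw [Matrix.isUnit_iff_isUnit_det]
    have : (B.map φ).det = φ B.det := (RingHom.map_det φ B).symm
    rw [this]
    exact Ne.isUnit hd
  have hBw : (B.map φ) *ᵥ w ≠ 0 := by
    intro h
    apply hw0
    apply Matrix.mulVec_injective_iff_isUnit.2 hBu
    simpa using h
  obtain ⟨i, hi⟩ := Function.ne_iff.1 hBw
  -- sum over the group
  let S : (α → R) → (α → R) := fun x => (∑ i ∈ Finset.range a, A ^ i) *ᵥ x
  have hAS : ∀ x, A *ᵥ S x = S x := by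
    intro x
    simp only [S, mulVec_mulVec]
    congr 1
    have h1 := Finset.sum_range_succ' (fun i => A ^ i) a
    rw [Finset.sum_range_succ, ha, pow_zero] at h1
    have h2 := add_right_cancel h1
    rw [Finset.mul_sum]
    simp_rw [← pow_succ']
    exact h2.symm
  obtain ⟨w', hw'⟩ : ∃ w' : α → R, (fun i => φ (w' i)) = w := by
    choose g hg using hsurj
    exact ⟨fun i => g (w i), funext fun i => hg _⟩
  have hpow : ∀ n, ((A ^ n).map φ) *ᵥ w = w := by
    intro n
    induction n with
    | zero => simp
    | succ n ih =>
      rw [pow_succ, Matrix.map_mul, ← mulVec_mulVec, hw, ih]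
  have hSw : (fun i => φ (S w' i)) = (a : F) • w := by
    simp only [S]
    rw [hmv, hw']
    have : (∑ i ∈ Finset.range a, A ^ i).map φ = ∑ i ∈ Finset.range a, (A ^ i).map φ :=
      map_sum (φ.mapMatrix) _ _
    rw [this, Matrix.sum_mulVec, Finset.sum_congr rfl (fun i _ => hpow i)]
    simp [Nat.cast_smul_eq_nsmul]
  have hinv : ∀ n (x y : α → R), ((A ^ n) *ᵥ x) ⬝ᵥ B *ᵥ ((A ^ n) *ᵥ y) = x ⬝ᵥ B *ᵥ y := by
    intro n
    induction n with
    | zero => simp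
    | succ n ih =>
      intro x y
      rw [pow_succ, ← mulVec_mulVec, ← mulVec_mulVec, ih, aux_q, hA]
  let z : α → R := Pi.single i 1
  have hAnS : ∀ n x, (A ^ n) *ᵥ S x = S x := by
    intro n x
    induction n with
    | zero => simp
    | succ n ih => rw [pow_succ, ← mulVec_mulVec, hAS, ih]
  have hkey : S z ⬝ᵥ B *ᵥ S w' = a * (z ⬝ᵥ B *ᵥ S w') := by
    have : S z = ∑ i ∈ Finset.range a, (A ^ i) *ᵥ z := Matrix.sum_mulVec _ _ _
    rw [this, sum_dotProduct]
    rw [Finset.sum_congr rfl (g := fun _ => z ⬝ᵥ B *ᵥ S w')]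
    · simp
    · intro n _
      rw [← hinv n z (S w'), hAnS]
  have hne : φ (S z ⬝ᵥ B *ᵥ S w') ≠ 0 := by
    rw [hkey, map_mul, map_natCast]
    refine mul_ne_zero haF ?_
    have : z ⬝ᵥ B *ᵥ S w' = (B *ᵥ S w') i := by simp [z]
    rw [this]
    have h5 := congrFun (hmv B (S w')) i
    rw [h5, hSw, mulVec_smul, Pi.smul_apply, smul_eq_mul]
    exact mul_ne_zero haF hi
  have hz0 : ∀ v, A *ᵥ v = v → φ (v ⬝ᵥ B *ᵥ v) = 0 := by
    intro v hv
    by_contra h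
    exact hno ⟨v, hv, hu _ h⟩
  have hsym : S w' ⬝ᵥ B *ᵥ S z = S z ⬝ᵥ B *ᵥ S w' := by
    rw [dotProduct_mulVec, ← mulVec_transpose, hB.eq, dotProduct_comm]
  have h6 := hz0 (S z + S w') (by rw [mulVec_add, hAS, hAS])
  rw [mulVec_add, add_dotProduct, dotProduct_add, dotProduct_add, hsym, map_add, map_add, map_add,
    hz0 _ (hAS z), hz0 _ (hAS w')] at h6
  have h7 : 2 * φ (S z ⬝ᵥ B *ᵥ S w') = 0 := by linear_combination h6
  exact (mul_ne_zero h2F hne) h7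

lemma aux_split1 {R : Type*} [CommRing R] {α : Type*} [Fintype α] [DecidableEq α]
    (B A : Matrix (α ⊕ Fin 1) (α ⊕ Fin 1) R) (hB : B.IsSymm) (hA : Aᵀ * B * A = B)
    (v : α ⊕ Fin 1 → R) (hv : A *ᵥ v = v) (hvu : IsUnit (v (Sum.inr 0)))
    (hc : IsUnit (v ⬝ᵥ B *ᵥ v)) :
    ∃ (U V : Matrix (α ⊕ Fin 1) (α ⊕ Fin 1) R) (B' A' : Matrix α α R) (D : Matrix (Fin 1) (Fin 1) R),
      U * V = 1 ∧ V * U = 1 ∧ Uᵀ * B * U = fromBlocks B' 0 0 D ∧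
      V * A * U = fromBlocks A' 0 0 1 := by
  obtain ⟨u, hu⟩ := hvu
  let v' : Matrix α (Fin 1) R := of fun i _ => v (Sum.inl i)
  let x : Matrix (Fin 1) (Fin 1) R := of fun _ _ => (u : R)
  let y : Matrix (Fin 1) (Fin 1) R := of fun _ _ => ((u⁻¹ : Rˣ) : R)
  have hxy : x * y = 1 := by
    ext i j; fin_cases i; fin_cases j; simp [x, y, mul_apply]
  have hyx : y * x = 1 := by
    ext i j; fin_cases i; fin_cases j; simp [x, y, mul_apply]
  let W := fromBlocks (1 : Matrix α α R) v' 0 x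
  let W' := fromBlocks (1 : Matrix α α R) (-(v' * y)) 0 y
  have hWW' : W * W' = 1 := by
    simp [W, W', fromBlocks_multiply, hxy]
  have hW'W : W' * W = 1 := by
    simp [W, W', fromBlocks_multiply, hyx, Matrix.mul_assoc]
  have hWlast : W *ᵥ Pi.single (Sum.inr 0) 1 = v := by
    ext i
    rcases i with i | i
    · simp [W, v']
    · fin_cases i; simp [W, x, hu]
  obtain ⟨P, b, b', D, hB1⟩ : ∃ P b b' D, Wᵀ * B * W = fromBlocks P b b' D :=
    ⟨_, _, _, _, (fromBlocks_toBlocks _).symm⟩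
  have hs1 : (Wᵀ * B * W).IsSymm := by
    simp [Matrix.IsSymm, transpose_mul, hB.eq, Matrix.mul_assoc]
  rw [hB1] at hs1
  have hs2 := isSymm_fromBlocks_iff.1 hs1
  obtain ⟨hPs, hbb, -, hDs⟩ := hs2
  have hD : D 0 0 = v ⬝ᵥ B *ᵥ v := by
    have h1 : D 0 0 = (Wᵀ * B * W) (Sum.inr 0) (Sum.inr 0) := by rw [hB1]; rfl
    have h2 : (Wᵀ * B * W) (Sum.inr 0) (Sum.inr 0) =
      (Pi.single (Sum.inr 0) 1 : α ⊕ Fin 1 → R) ⬝ᵥ (Wᵀ * B * W) *ᵥ Pi.single (Sum.inr 0) 1 := by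
      simp
    rw [h1, h2, ← aux_q, hWlast]
  obtain ⟨c, hcc⟩ := hc
  let E : Matrix (Fin 1) (Fin 1) R := of fun _ _ => ((c⁻¹ : Rˣ) : R)
  have hDE : D * E = 1 := by
    ext i j; fin_cases i; fin_cases j; simp [E, mul_apply, hD, ← hcc]
  have hED : E * D = 1 := by
    ext i j; fin_cases i; fin_cases j; simp [E, mul_apply, hD, ← hcc]
  have hEt : Eᵀ = E := by ext i j; rfl
  subst hbb
  let T := fromBlocks (1 : Matrix α α R) 0 (-(E * bᵀ)) (1 : Matrix (Fin 1) (Fin 1) R)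
  let T' := fromBlocks (1 : Matrix α α R) 0 (E * bᵀ) (1 : Matrix (Fin 1) (Fin 1) R)
  have hTT' : T * T' = 1 := by simp [T, T', fromBlocks_multiply]
  have hT'T : T' * T = 1 := by simp [T, T', fromBlocks_multiply]
  have hBU : (W * T)ᵀ * B * (W * T) = fromBlocks (P - b * E * bᵀ) 0 0 D := by
    have : (W * T)ᵀ * B * (W * T) = Tᵀ * (Wᵀ * B * W) * T := by
      simp [transpose_mul, Matrix.mul_assoc]
    rw [this, hB1]
    have h3 : D * (E * bᵀ) = bᵀ := by rw [← Matrix.mul_assoc, hDE, Matrix.one_mul]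
    have h4 : b * E * D = b := by rw [Matrix.mul_assoc, hED, Matrix.mul_one]
    simp [T, fromBlocks_transpose, fromBlocks_multiply, hEt, h3, h4, sub_eq_add_neg, Matrix.mul_assoc]
  have hUV : (W * T) * (T' * W') = 1 := by
    rw [Matrix.mul_assoc, ← Matrix.mul_assoc T, hTT', Matrix.one_mul, hWW']
  have hVU : (T' * W') * (W * T) = 1 := by
    rw [Matrix.mul_assoc, ← Matrix.mul_assoc W', hW'W, Matrix.one_mul, hT'T]
  have hUl : (W * T) *ᵥ Pi.single (Sum.inr 0) 1 = v := by
    rw [← mulVec_mulVec]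
    have : T *ᵥ (Pi.single (Sum.inr 0) 1) = Pi.single (Sum.inr 0) 1 := by
      ext i
      rcases i with i | i
      · simp [T]
      · fin_cases i; simp [T]
    rw [this, hWlast]
  generalize W * T = U at *
  generalize T' * W' = V at *
  have hMl : (V * A * U) *ᵥ Pi.single (Sum.inr 0) 1 = Pi.single (Sum.inr 0) 1 := by
    rw [← mulVec_mulVec, hUl, ← mulVec_mulVec, hv, ← hUl, mulVec_mulVec, hVU, one_mulVec]
  have hMi : (V * A * U)ᵀ * (Uᵀ * B * U) * (V * A * U) = Uᵀ * B * U := by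
    calc _ = Uᵀ * Aᵀ * (U * V)ᵀ * B * (U * V) * A * U := by
            simp only [transpose_mul, Matrix.mul_assoc]
      _ = Uᵀ * (Aᵀ * B * A) * U := by
            rw [hUV]; simp [Matrix.mul_assoc]
      _ = _ := by rw [hA]
  obtain ⟨A', a2, C, a4, hM⟩ : ∃ P b b' D, V * A * U = fromBlocks P b b' D :=
    ⟨_, _, _, _, (fromBlocks_toBlocks _).symm⟩
  have ha2 : a2 = 0 := by
    ext i j
    fin_cases j
    have := congrFun hMl (Sum.inl i)
    rw [hM] at this
    simpa using this
  have ha4 : a4 = 1 := by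
    ext i j
    fin_cases j
    fin_cases i
    have := congrFun hMl (Sum.inr 0)
    rw [hM] at this
    simpa using this
  subst ha2 ha4
  rw [hM, hBU] at hMi
  simp only [fromBlocks_transpose, fromBlocks_multiply, fromBlocks_inj] at hMi
  have h12 : Cᵀ * D = 0 := by simpa using hMi.2.1
  have hC : C = 0 := by
    have : Cᵀ = 0 := by
      calc Cᵀ = Cᵀ * D * E := by rw [Matrix.mul_assoc, hDE, Matrix.mul_one]
        _ = 0 := by rw [h12, Matrix.zero_mul]
    simpa using this
  subst hC
  exact ⟨U, V, _, A', D, hUV, hVU, hBU, hM⟩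

lemma aux_split {R : Type*} [CommRing R] {α : Type*} [Fintype α] [DecidableEq α] (N : ℕ)
    (hN : Fintype.card α = N + 1)
    (B A : Matrix α α R) (hB : B.IsSymm) (hA : Aᵀ * B * A = B)
    (v : α → R) (hv : A *ᵥ v = v) (i : α) (hvu : IsUnit (v i))
    (hc : IsUnit (v ⬝ᵥ B *ᵥ v)) :
    ∃ (U : Matrix α (Fin N ⊕ Fin 1) R) (V : Matrix (Fin N ⊕ Fin 1) α R)
      (B' A' : Matrix (Fin N) (Fin N) R) (D : Matrix (Fin 1) (Fin 1) R),
      U * V = 1 ∧ V * U = 1 ∧ Uᵀ * B * U = fromBlocks B' 0 0 D ∧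
      V * A * U = fromBlocks A' 0 0 1 := by
  obtain ⟨e, he⟩ : ∃ e : Fin N ⊕ Fin 1 ≃ α, e (Sum.inr 0) = i := by
    let e0 : Fin N ⊕ Fin 1 ≃ α := Fintype.equivOfCardEq (by simp [hN])
    exact ⟨e0.trans (Equiv.swap (e0 (Sum.inr 0)) i), by simp⟩
  obtain ⟨U, V, B', A', D, h1, h2, h3, h4⟩ := aux_split1 (B.submatrix e e) (A.submatrix e e)
    (hB.submatrix e) (by rw [transpose_submatrix, submatrix_mul_equiv, submatrix_mul_equiv, hA])
    (v ∘ e) (by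
      rw [submatrix_mulVec_equiv]
      simp [Function.comp_assoc, hv]) (by simpa [he] using hvu)
    (by
      rw [submatrix_mulVec_equiv]
      simpa [Function.comp_assoc] using hc)
  refine ⟨U.submatrix e.symm id, V.submatrix id e.symm, B', A', D, ?_, ?_, ?_, ?_⟩
  · have := submatrix_mul_equiv U V e.symm (Equiv.refl _) e.symm
    rw [h1] at this
    simpa using this
  · rw [submatrix_mul_equiv, h2]; simp
  · rw [← h3]
    have hBe : B = (B.submatrix e e).submatrix e.symm e.symm := by simp
    conv_lhs => rw [hBe]
    rw [transpose_submatrix, submatrix_mul_equiv, submatrix_mul_equiv]; simp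
  · rw [← h4]
    have hBe : A = (A.submatrix e e).submatrix e.symm e.symm := by simp
    conv_lhs => rw [hBe]
    rw [submatrix_mul_equiv, submatrix_mul_equiv]; simp

lemma aux_ind {R : Type*} [CommRing R] (hloc : ∀ (β : Type) [Fintype β] (x y : β → R),
      IsUnit (x ⬝ᵥ y) → ∃ i, IsUnit (x i)) (a N : ℕ) :
    ∀ (s : ℕ) (_ : ∀ t, N < t → t < N + s → ∀ B A : Matrix (Fin t) (Fin t) R,
      B.IsSymm → IsUnit B.det → Aᵀ * B * A = B → A ^ a = 1 →
        ∃ v, A *ᵥ v = v ∧ IsUnit (v ⬝ᵥ B *ᵥ v))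
      (α : Type) [Fintype α] [DecidableEq α] (_ : Fintype.card α = N + s)
      (B A : Matrix α α R) (_ : B.IsSymm) (_ : IsUnit B.det) (_ : Aᵀ * B * A = B) (_ : A ^ a = 1)
      (_ : 0 < s → ∃ v, A *ᵥ v = v ∧ IsUnit (v ⬝ᵥ B *ᵥ v)),
      ∃ (U : Matrix α (Fin N ⊕ Fin s) R) (V : Matrix (Fin N ⊕ Fin s) α R)
        (B' A' : Matrix (Fin N) (Fin N) R) (D : Matrix (Fin s) (Fin s) R),
        U * V = 1 ∧ V * U = 1 ∧ Uᵀ * B * U = fromBlocks B' 0 0 D ∧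
        V * A * U = fromBlocks A' 0 0 1 := by
  intro s
  induction s with
  | zero =>
    intro _ α _ _ hcard B A hB hdet hA ha _
    let e : Fin N ⊕ Fin 0 ≃ α := Fintype.equivOfCardEq (by simp [hcard])
    refine ⟨(1 : Matrix α α R).submatrix id e, (1 : Matrix α α R).submatrix e id,
      (B.submatrix e e).toBlocks₁₁, (A.submatrix e e).toBlocks₁₁, 0, ?_, ?_, ?_, ?_⟩
    · have := submatrix_mul_equiv (1 : Matrix α α R) (1 : Matrix α α R) id e id
      rw [this]; simp
    · rw [← submatrix_mul _ _ _ _ _ Function.bijective_id]; simp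
    · ext i j
      rcases i with i | i
      · rcases j with j | j
        · simp [toBlocks₁₁, mul_apply, Matrix.one_apply]
        · exact j.elim0
      · exact i.elim0
    · ext i j
      rcases i with i | i
      · rcases j with j | j
        · simp [toBlocks₁₁, mul_apply, Matrix.one_apply]
        · exact j.elim0
      · exact i.elim0
  | succ s ih =>
    intro hex α _ _ hcard B A hB hdet hA ha hv
    obtain ⟨v, hv, hvu⟩ := hv (Nat.succ_pos s)
    obtain ⟨i, hi⟩ := hloc α v _ hvu
    obtain ⟨U, V, B', A', D, hUV, hVU, hBU, hM⟩ := aux_split (N + s) hcard B A hB hA v hv i hi hvu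
    have hMi : (V * A * U)ᵀ * (Uᵀ * B * U) * (V * A * U) = Uᵀ * B * U := by
      calc _ = Uᵀ * Aᵀ * (U * V)ᵀ * B * (U * V) * A * U := by
              simp only [transpose_mul, Matrix.mul_assoc]
        _ = Uᵀ * (Aᵀ * B * A) * U := by
              rw [hUV]; simp [Matrix.mul_assoc]
        _ = _ := by rw [hA]
    have hA' : A'ᵀ * B' * A' = B' := by
      rw [hM, hBU] at hMi
      simp only [fromBlocks_transpose, fromBlocks_multiply, fromBlocks_inj] at hMi
      simpa using hMi.1
    have hB' : B'.IsSymm := by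
      have hs1 : (Uᵀ * B * U).IsSymm := by
        simp [Matrix.IsSymm, transpose_mul, hB.eq, Matrix.mul_assoc]
      rw [hBU] at hs1
      exact (isSymm_fromBlocks_iff.1 hs1).1
    have hdet' : IsUnit B'.det := by
      have h1 : (Uᵀ * B * U) * (V * B⁻¹ * Vᵀ) = 1 := by
        calc _ = Uᵀ * (B * ((U * V) * B⁻¹)) * Vᵀ := by simp only [Matrix.mul_assoc]
          _ = (V * U)ᵀ := by
            rw [hUV, Matrix.one_mul, mul_nonsing_inv _ hdet, Matrix.mul_one, transpose_mul]
          _ = 1 := by rw [hVU, transpose_one]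
      have h2 := isUnit_det_of_right_inverse h1
      rw [hBU, det_fromBlocks_zero₁₂] at h2
      exact isUnit_of_mul_isUnit_left h2
    have ha' : A' ^ a = 1 := by
      have h1 : ∀ m, (V * A * U) ^ m = V * A ^ m * U := by
        intro m
        induction m with
        | zero => simp [hVU]
        | succ m ihm =>
          rw [pow_succ, ihm, pow_succ]
          calc _ = V * A ^ m * (U * V) * A * U := by simp only [Matrix.mul_assoc]
            _ = _ := by rw [hUV, Matrix.mul_one]; simp only [Matrix.mul_assoc]
      have h2 : ∀ m, (fromBlocks A' 0 0 (1 : Matrix (Fin 1) (Fin 1) R)) ^ m =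
          fromBlocks (A' ^ m) 0 0 1 := by
        intro m
        induction m with
        | zero => simp [fromBlocks_one]
        | succ m ihm =>
          rw [pow_succ, ihm, pow_succ, fromBlocks_multiply]; simp
      have h3 := h1 a
      rw [hM, h2, ha, Matrix.mul_one, hVU, ← fromBlocks_one, fromBlocks_inj] at h3
      exact h3.1
    obtain ⟨U1, V1, B1, A1, D1, hUV1, hVU1, hBU1, hM1⟩ := ih
      (fun t ht ht' => hex t ht (by omega)) (Fin (N + s)) (by simp) B' A' hB' hdet' hA' ha'
      (fun hs => hex (N + s) (by omega) (by omega) B' A' hB' hdet' hA' ha')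
    let e : Fin N ⊕ Fin (s + 1) ≃ (Fin N ⊕ Fin s) ⊕ Fin 1 :=
      (Equiv.sumCongr (Equiv.refl _) finSumFinEquiv.symm).trans (Equiv.sumAssoc _ _ _).symm
    let X := fromBlocks U1 0 0 (1 : Matrix (Fin 1) (Fin 1) R)
    let Y := fromBlocks V1 0 0 (1 : Matrix (Fin 1) (Fin 1) R)
    have hXY : X * Y = 1 := by simp [X, Y, fromBlocks_multiply, hUV1]
    have hYX : Y * X = 1 := by simp [X, Y, fromBlocks_multiply, hVU1]
    have hblk : ∀ (P : Matrix (Fin N) (Fin N) R) (Q : Matrix (Fin s) (Fin s) R)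
        (T : Matrix (Fin 1) (Fin 1) R), (fromBlocks (fromBlocks P 0 0 Q) 0 0 T).submatrix e e =
          fromBlocks P 0 0 ((fromBlocks Q 0 0 T).submatrix finSumFinEquiv.symm
            finSumFinEquiv.symm) := by
      intro P Q T
      ext i j
      rcases i with i | i
      · rcases j with j | j
        · simp [e]
        · obtain ⟨j, rfl⟩ := finSumFinEquiv.surjective j
          rcases j with j | j <;> simp [e, -finSumFinEquiv_apply_left, -finSumFinEquiv_apply_right]
      · obtain ⟨i, rfl⟩ := finSumFinEquiv.surjective i
        rcases j with j | j
        · rcases i with i | i <;> simp [e, -finSumFinEquiv_apply_left, -finSumFinEquiv_apply_right]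
        · obtain ⟨j, rfl⟩ := finSumFinEquiv.surjective j
          rcases i with i | i <;> rcases j with j | j <;>
            simp [e, -finSumFinEquiv_apply_left, -finSumFinEquiv_apply_right]
    refine ⟨(U * X).submatrix id e, (Y * V).submatrix e id, B1, A1,
      (fromBlocks D1 0 0 D).submatrix finSumFinEquiv.symm finSumFinEquiv.symm, ?_, ?_, ?_, ?_⟩
    · have := submatrix_mul_equiv (U * X) (Y * V) id e id
      rw [this, Matrix.mul_assoc, ← Matrix.mul_assoc X, hXY, Matrix.one_mul, hUV]; simp
    · rw [← submatrix_mul _ _ _ _ _ Function.bijective_id, Matrix.mul_assoc,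
        ← Matrix.mul_assoc V, hVU, Matrix.one_mul, hYX]; simp
    · rw [← hblk, ← hBU1]
      have h1 : (U * X)ᵀ * B * (U * X) = fromBlocks (U1ᵀ * B' * U1) 0 0 D := by
        have : (U * X)ᵀ * B * (U * X) = Xᵀ * (Uᵀ * B * U) * X := by
          simp only [transpose_mul, Matrix.mul_assoc]
        rw [this, hBU]
        simp [X, fromBlocks_multiply, fromBlocks_transpose]
      rw [← h1]; rfl
    · have h0 : (1 : Matrix (Fin (s+1)) (Fin (s+1)) R) = (fromBlocks (1 : Matrix (Fin s) (Fin s) R)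
          0 0 (1 : Matrix (Fin 1) (Fin 1) R)).submatrix finSumFinEquiv.symm finSumFinEquiv.symm := by
        rw [fromBlocks_one]; simp
      rw [h0, ← hblk, ← hM1]
      have h1 : (Y * V) * A * (U * X) = fromBlocks (V1 * A' * U1) 0 0 1 := by
        have : (Y * V) * A * (U * X) = Y * (V * A * U) * X := by
          simp only [Matrix.mul_assoc]
        rw [this, hM]
        simp [X, Y, fromBlocks_multiply]
      rw [← h1]; rfl

lemma aux_minExp {p q : ℕ} [Fact p.Prime] [hq : Fact q.Prime] (hpq : p ≠ q) :
    0 < minExp p q ∧ (p : ZMod q) ^ minExp p q = ((eta p q : ℤ) : ZMod q) ∧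
      (eta p q = 1 ∨ eta p q = -1) ∧
      ∀ M, ((p : ZMod q) ^ M) ^ 2 = 1 → minExp p q ∣ M := by
  have hp : p.Prime := Fact.out
  have h1 : ∀ a, q ∣ p ^ a - 1 ↔ (p : ZMod q) ^ a = 1 := by
    intro a
    rw [← ZMod.natCast_eq_zero_iff, Nat.cast_sub (Nat.one_le_pow _ _ hp.pos)]
    simp [sub_eq_zero]
  have h2 : ∀ a, q ∣ p ^ a + 1 ↔ (p : ZMod q) ^ a = -1 := by
    intro a
    rw [← ZMod.natCast_eq_zero_iff]
    push_cast
    exact add_eq_zero_iff_eq_neg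
  have hp0 : (p : ZMod q) ≠ 0 := by
    rw [Ne, ZMod.natCast_eq_zero_iff, Nat.prime_dvd_prime_iff_eq hq.out hp]
    exact hpq.symm
  have hmem : minExp p q ∈ {a : ℕ | 0 < a ∧ (q ∣ p ^ a - 1 ∨ q ∣ p ^ a + 1)} := by
    apply Nat.sInf_mem
    refine ⟨q - 1, ?_, Or.inl ?_⟩
    · have := hq.out.two_le; omega
    · rw [h1]; exact ZMod.pow_card_sub_one_eq_one hp0
  obtain ⟨hm0, hm⟩ := hmem
  have hpm : (p : ZMod q) ^ minExp p q = ((eta p q : ℤ) : ZMod q) := by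
    unfold eta
    split_ifs with h
    · rw [(h1 _).1 h]; simp
    · rw [(h2 _).1 (hm.resolve_left h)]; simp
  have heta : eta p q = 1 ∨ eta p q = -1 := by
    unfold eta; split_ifs <;> simp
  refine ⟨hm0, hpm, heta, ?_⟩
  intro M hM
  have h3 : ((p : ZMod q) ^ (M % minExp p q)) ^ 2 = 1 := by
    have h4 := Nat.div_add_mod M (minExp p q)
    have h5 : ((p : ZMod q) ^ (minExp p q * (M / minExp p q))) ^ 2 = 1 := by
      rw [pow_mul, ← pow_mul, mul_comm, pow_mul, hpm]
      rcases heta with h | h <;> rw [h] <;> simp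
    rw [← h4, pow_add, mul_pow, h5, one_mul] at hM
    exact hM
  by_contra hnd
  have h6 : 0 < M % minExp p q := Nat.pos_of_ne_zero fun h => hnd (Nat.dvd_of_mod_eq_zero h)
  have h7 : minExp p q ≤ M % minExp p q := by
    apply Nat.sInf_le
    refine ⟨h6, ?_⟩
    rcases sq_eq_sq_iff_eq_or_eq_neg.1 (h3.trans (one_pow 2).symm) with h | h
    · exact Or.inl ((h1 _).2 h)
    · exact Or.inr ((h2 _).2 h)
  exact absurd (Nat.mod_lt M hm0) (by omega)

lemma aux_pm {q : ℕ} [hq : Fact q.Prime] (hq2 : q ≠ 2) {a : ℤ} (ha : a = 1 ∨ a = -1)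
    (h : (a : ZMod q) = 1) : a = 1 := by
  rcases ha with ha | ha
  · exact ha
  · exfalso
    rw [ha] at h
    have h2 : (2 : ZMod q) ≠ 0 := Ring.two_ne_zero (by rwa [ZMod.ringChar_zmod_n])
    apply h2
    push_cast at h
    linear_combination -h

lemma aux_chi_neg {p : ℕ} [hp : Fact p.Prime] (hp2 : p ≠ 2) (N : ℕ) :
    (quadraticChar (ZMod p) (-1)) ^ N = if p % 4 = 3 ∧ (2 * N) % 4 = 2 then -1 else 1 := by
  have hodd : p % 2 = 1 := Nat.odd_iff.1 (hp.out.odd_of_ne_two hp2)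
  rw [quadraticChar_neg_one (by rwa [ZMod.ringChar_zmod_n]), ZMod.card]
  rcases (by omega : p % 4 = 1 ∨ p % 4 = 3) with h | h
  · rw [ZMod.χ₄_nat_one_mod_four h, one_pow, if_neg (by omega)]
  · rw [ZMod.χ₄_nat_three_mod_four h]
    rcases Nat.even_or_odd N with hN | hN
    · rw [hN.neg_one_pow, if_neg (by rintro ⟨-, h⟩; obtain ⟨r, hr⟩ := hN; omega)]
    · rw [hN.neg_one_pow, if_pos ⟨h, by obtain ⟨r, hr⟩ := hN; omega⟩]

lemma aux_exists {p q : ℕ} [hp : Fact p.Prime] [hq : Fact q.Prime] (hp2 : p ≠ 2) (hq2 : q ≠ 2)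
    (hpq : p ≠ q) (k : ℕ) (hk : 1 ≤ k) (j : ℕ) {α : Type} [Fintype α] [DecidableEq α]
    (B A : Matrix α α (ZMod (p ^ k))) (hB : B.IsSymm) (hdet : IsUnit B.det)
    (hA : Aᵀ * B * A = B) (ha : A ^ q ^ j = 1)
    (hno : ¬ ∃ v, A *ᵥ v = v ∧ IsUnit (v ⬝ᵥ B *ᵥ v)) :
    ∃ d, Fintype.card α = 2 * minExp p q * d ∧ epsilon p B = eta p q ^ d := by
  set φ := ZMod.castHom (dvd_pow_self p (by omega : k ≠ 0)) (ZMod p) with hφ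
  have hF : ringChar (ZMod p) ≠ 2 := by rwa [ZMod.ringChar_zmod_n]
  have hd0 : φ B.det ≠ 0 := (aux_unit hp.out hk _).1 hdet
  have hfix := aux_fixed φ (ZMod.castHom_surjective _) (fun x hx => (aux_unit hp.out hk x).2 hx)
    B A hB hd0 hA (q ^ j) ha (by
      rw [Nat.cast_pow]
      apply pow_ne_zero
      rw [Ne, ZMod.natCast_eq_zero_iff, Nat.prime_dvd_prime_iff_eq hp.out hq.out]
      exact hpq) (Ring.two_ne_zero hF) hno
  have hdm : (B.map φ).det = φ B.det := (RingHom.map_det φ B).symm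
  obtain ⟨N, hN, hNe⟩ := aux_final hp2 hq2 hpq (B.map φ) (A.map φ)
    (by rw [Matrix.IsSymm, ← transpose_map, hB.eq]) (by rw [hdm]; exact hd0)
    (by rw [← transpose_map, ← Matrix.map_mul, ← Matrix.map_mul, hA]) j
    (by
      have := map_pow φ.mapMatrix A (q ^ j)
      rw [ha, map_one] at this
      exact this.symm) hfix
  rw [hdm] at hNe
  obtain ⟨hm0, hpm, heta, hdvd⟩ := aux_minExp (p := p) (q := q) hpq
  have hχ : quadraticChar (ZMod p) (φ B.det) = 1 ∨ quadraticChar (ZMod p) (φ B.det) = -1 :=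
    quadraticChar_dichotomy hd0
  have hχ1 : quadraticChar (ZMod p) (-1) = 1 ∨ quadraticChar (ZMod p) (-1) = -1 :=
    quadraticChar_dichotomy (by simp)
  have hMd : minExp p q ∣ N := by
    apply hdvd
    have h1 := congrArg (· ^ 2) hNe
    simp only [mul_pow, one_pow] at h1
    rcases hχ with h | h <;> rcases hχ1 with h' | h' <;> rw [h, h'] at h1 <;>
      simpa [← pow_mul, mul_comm] using h1
  obtain ⟨d, rfl⟩ := hMd
  refine ⟨d, by rw [hN, mul_assoc], ?_⟩
  have heps : epsilon p B = quadraticChar (ZMod p) (φ B.det) *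
      quadraticChar (ZMod p) (-1) ^ (minExp p q * d) := by
    unfold epsilon
    rw [aux_chi_neg hp2, hN]
    congr 1
    have := aux_square hp.out hp2 hk _ hdet
    rw [← hφ] at this
    split_ifs with h
    · exact ((quadraticChar_one_iff_isSquare hd0).2 (this.1 h)).symm
    · exact (quadraticChar_neg_one_iff_not_isSquare.2 (fun h' => h (this.2 h'))).symm
  have he : (((epsilon p B * eta p q ^ d : ℤ)) : ZMod q) = 1 := by
    rw [heps, ← hNe, mul_pow, pow_mul (p : ZMod q), hpm]
    push_cast
    ring
  have hpe : ∀ (x : ℤ) (n : ℕ), (x = 1 ∨ x = -1) → x ^ n = 1 ∨ x ^ n = -1 := by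
    rintro x n (rfl | rfl)
    · simp
    · exact neg_one_pow_eq_or ℤ n
  have h1 := hpe _ (minExp p q * d) hχ1
  have h2 := hpe _ d heta
  have hε : epsilon p B = 1 ∨ epsilon p B = -1 := by
    rw [heps]
    rcases hχ with h | h <;> rcases h1 with h' | h' <;> rw [h, h'] <;> simp
  have h3 := aux_pm hq2 (a := epsilon p B * eta p q ^ d) (by
    rcases hε with h | h <;> rcases h2 with h' | h' <;> rw [h, h'] <;> simp) he
  rcases hε with h | h <;> rcases h2 with h' | h' <;> rw [h, h'] at h3 ⊢ <;> simp at h3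

theorem stmt13 (p q : ℕ) (hp : p.Prime) (hq : q.Prime) (hp2 : p ≠ 2) (hq2 : q ≠ 2)
    (hpq : p ≠ q) (k : ℕ) (hk : 1 ≤ k) (d : ℕ) (hd : 1 ≤ d) (n : ℕ)
    (hn : n = 2 * minExp p q * d)
    (B : Matrix (Fin n) (Fin n) (ZMod (p ^ k))) (hsymm : B.IsSymm) (hdet : IsUnit B.det)
    (heps : epsilon p B ≠ eta p q ^ d)
    (A : Matrix (Fin n) (Fin n) (ZMod (p ^ k))) (hiso : Aᵀ * B * A = B)
    (hord : ∃ j : ℕ, orderOf A = q ^ j) :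
    ∃ U : Matrix (Fin n) (Fin n) (ZMod (p ^ k)), IsUnit U.det ∧
      ∃ (h2 : n = 2 * minExp p q * (d - 1) + 2 * minExp p q)
        (B₁ : Matrix (Fin (2 * minExp p q * (d - 1))) (Fin (2 * minExp p q * (d - 1)))
          (ZMod (p ^ k)))
        (B₂ : Matrix (Fin (2 * minExp p q)) (Fin (2 * minExp p q)) (ZMod (p ^ k)))
        (A₁ : Matrix (Fin (2 * minExp p q * (d - 1))) (Fin (2 * minExp p q * (d - 1)))
          (ZMod (p ^ k))),
        Uᵀ * B * U = (Matrix.fromBlocks B₁ 0 0 B₂).submatrix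
            (fun i => finSumFinEquiv.symm (Fin.cast h2 i))
            (fun i => finSumFinEquiv.symm (Fin.cast h2 i)) ∧
        U⁻¹ * A * U = (Matrix.fromBlocks A₁ 0 0
            (1 : Matrix (Fin (2 * minExp p q)) (Fin (2 * minExp p q)) (ZMod (p ^ k)))).submatrix
            (fun i => finSumFinEquiv.symm (Fin.cast h2 i))
            (fun i => finSumFinEquiv.symm (Fin.cast h2 i)) ∧
        ∃ f : (Fin (2 * minExp p q) → ZMod (p ^ k)) →ₗ[ZMod (p ^ k)] (Fin n → ZMod (p ^ k)),
          Function.Injective f ∧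
            ∀ v : Fin (2 * minExp p q) → ZMod (p ^ k), A.mulVec (f v) = f v := by
  have : Fact p.Prime := ⟨hp⟩
  have : Fact q.Prime := ⟨hq⟩
  obtain ⟨j, hj⟩ := hord
  have ha : A ^ q ^ j = 1 := by rw [← hj]; exact pow_orderOf_eq_one A
  have hm0 : 0 < minExp p q := (aux_minExp (p := p) (q := q) hpq).1
  have h2 : n = 2 * minExp p q * (d - 1) + 2 * minExp p q := by
    rw [hn]
    obtain ⟨d, rfl⟩ : ∃ d', d = d' + 1 := ⟨d - 1, by omega⟩
    simp; ring
  have hloc : ∀ (β : Type) [Fintype β] (x y : β → ZMod (p ^ k)),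
      IsUnit (x ⬝ᵥ y) → ∃ i, IsUnit (x i) := by
    intro β _ x y hxy
    by_contra! hx
    rw [aux_unit hp hk] at hxy
    apply hxy
    rw [dotProduct, map_sum]
    refine Finset.sum_eq_zero fun i _ => ?_
    rw [map_mul]
    have := hx i
    rw [aux_unit hp hk, not_not] at this
    rw [this, zero_mul]
  obtain ⟨U, V, B₁, A₁, B₂, hUV, hVU, hBU, hM⟩ := aux_ind hloc (q ^ j)
    (2 * minExp p q * (d - 1)) (2 * minExp p q) (by
      intro t ht ht' B A hB hdet hA ha
      by_contra hno
      obtain ⟨d', hd', -⟩ := aux_exists hp2 hq2 hpq k hk j B A hB hdet hA ha hno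
      rw [Fintype.card_fin] at hd'
      rw [hd'] at ht ht'
      have h3 : d - 1 < d' := lt_of_mul_lt_mul_left ht (Nat.zero_le _)
      have h4 : d' < d - 1 + 1 := by
        refine lt_of_mul_lt_mul_left (a := 2 * minExp p q) ?_ (Nat.zero_le _)
        rw [mul_add, mul_one]; exact ht'
      omega) (Fin n) (by rw [Fintype.card_fin]; exact h2) B A hsymm hdet hiso ha (by
      intro _
      by_contra hno
      obtain ⟨d', hd', he⟩ := aux_exists hp2 hq2 hpq k hk j B A hsymm hdet hiso ha hno
      rw [Fintype.card_fin, hn] at hd'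
      have : d = d' := Nat.eq_of_mul_eq_mul_left (by omega) hd'
      subst this
      exact heps he)
  let e : Fin n ≃ Fin (2 * minExp p q * (d - 1)) ⊕ Fin (2 * minExp p q) :=
    (finCongr h2).trans finSumFinEquiv.symm
  have he : (fun i => finSumFinEquiv.symm (Fin.cast h2 i)) = e := rfl
  have hUV' : U.submatrix id e * V.submatrix e id = 1 := by
    have := submatrix_mul_equiv U V id e id
    rw [this, hUV]; simp
  have hinv : (U.submatrix id e)⁻¹ = V.submatrix e id := inv_eq_right_inv hUV'
  refine ⟨U.submatrix id e, isUnit_det_of_right_inverse hUV', h2, B₁, B₂, A₁, ?_, ?_, ?_⟩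
  · rw [he, ← hBU]; rfl
  · rw [he, hinv, ← hM]; rfl
  · let g : (Fin (2 * minExp p q) → ZMod (p ^ k)) →ₗ[ZMod (p ^ k)]
        (Fin (2 * minExp p q * (d - 1)) ⊕ Fin (2 * minExp p q) → ZMod (p ^ k)) :=
      { toFun := fun v => Sum.elim (fun _ => 0) v
        map_add' := by intro x y; ext i; rcases i with i | i <;> simp
        map_smul' := by intro c x; ext i; rcases i with i | i <;> simp }
    have hg : ∀ v, g v = Sum.elim (fun _ => 0) v := fun v => rfl
    refine ⟨U.mulVecLin.comp g, ?_, ?_⟩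
    · intro x y hxy
      simp only [LinearMap.comp_apply, mulVecLin_apply] at hxy
      have h3 := congrArg (V *ᵥ ·) hxy
      simp only [mulVec_mulVec, hVU, one_mulVec, hg] at h3
      funext i
      exact congrFun h3 (Sum.inr i)
    · intro v
      simp only [LinearMap.comp_apply, mulVecLin_apply]
      have h3 : A * U = U * (V * A * U) := by
        rw [← Matrix.mul_assoc, ← Matrix.mul_assoc, hUV, Matrix.one_mul]
      rw [mulVec_mulVec, h3, ← mulVec_mulVec, hM, hg, fromBlocks_mulVec]
      congr 1
      ext i; rcases i with i | i <;> simp [mulVec, dotProduct, Matrix.one_apply]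
end

section
/- Let p ≠ q be odd primes, k ≥ 1, and let B be a p^k-form of rank n = 2[q|p]·d with d ≥ 1 and ε(B) = η(q)^d. Let r ≥ 1 and suppose that O(B) contains an element of order exactly q^r. Then O(B) contains an element ψ of order exactly q^r which has no non-zero fixed points. -/
open Matrix

section modulePart

variable {R : Type} [CommRing R] {M : Type} [AddCommGroup M] [Module R M]

/-- isometry predicate -/
def IsIso (b : M →ₗ[R] M →ₗ[R] R) (g : Module.End R M) : Prop := ∀ x y, b (g x) (g y) = b x y

/-- fixed submodule -/
def fixS (g : Module.End R M) : Submodule R M := LinearMap.ker (g - 1)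

theorem mem_fixS (g : Module.End R M) (x : M) : x ∈ fixS g ↔ g x = x := by
  simp [fixS, sub_eq_zero]

theorem pow_fix (g : Module.End R M) (x : M) (h : g x = x) (m : ℕ) : (g ^ m) x = x := by
  induction m with
  | zero => simp
  | succ m ih => rw [pow_succ, Module.End.mul_apply, h, ih]

theorem IsIso.pow {b : M →ₗ[R] M →ₗ[R] R} {g : Module.End R M} (h : IsIso b g) (m : ℕ) :
    IsIso b (g ^ m) := by
  induction m with
  | zero => intro x y; simp
  | succ m ih => intro x y; rw [pow_succ, Module.End.mul_apply, Module.End.mul_apply, ih, h]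

theorem exists_avg (b : M →ₗ[R] M →ₗ[R] R) (g : Module.End R M) (hg : IsIso b g) (N : ℕ)
    (hN : IsUnit (N : R)) (hgN : g ^ N = 1) :
    ∃ π : Module.End R M, (∀ x, g (π x) = π x) ∧ (∀ x, g x = x → π x = x) ∧
      (∀ x y, g x = x → b x (π y) = b x y) ∧ (∀ x, π (g x) = π x) := by
  obtain ⟨u, hu⟩ := hN
  have hc : (↑u⁻¹ : R) * (N : R) = 1 := by rw [← hu]; simp
  have key : g * (∑ i ∈ Finset.range N, g ^ i) = ∑ i ∈ Finset.range N, g ^ i := by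
    have := mul_geom_sum g N
    rw [hgN, sub_self, sub_mul, one_mul, sub_eq_zero] at this
    exact this
  have key2 : (∑ i ∈ Finset.range N, g ^ i) * g = ∑ i ∈ Finset.range N, g ^ i := by
    have := geom_sum_mul g N
    rw [hgN, sub_self, mul_sub, mul_one, sub_eq_zero] at this
    exact this
  refine ⟨(↑u⁻¹ : R) • ∑ i ∈ Finset.range N, g ^ i, ?_, ?_, ?_, ?_⟩
  · intro x
    rw [LinearMap.smul_apply, map_smul, ← Module.End.mul_apply, key]
  · intro x hx
    rw [LinearMap.smul_apply, LinearMap.sum_apply, Finset.sum_congr rfl (fun i _ => pow_fix g x hx i)]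
    rw [Finset.sum_const, Finset.card_range, ← Nat.cast_smul_eq_nsmul R, smul_smul, hc, one_smul]
  · intro x y hx
    have : ∀ i ∈ Finset.range N, b x ((g ^ i) y) = b x y := by
      intro i _
      have := hg.pow i x y
      rwa [pow_fix g x hx] at this
    rw [LinearMap.smul_apply, LinearMap.sum_apply, map_smul, map_sum, Finset.sum_congr rfl this]
    rw [Finset.sum_const, Finset.card_range, nsmul_eq_mul, smul_eq_mul, ← mul_assoc, hc, one_mul]
  · intro x
    rw [LinearMap.smul_apply, LinearMap.smul_apply, ← Module.End.mul_apply, key2]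

/-- restriction of the form -/
def resB (b : M →ₗ[R] M →ₗ[R] R) (F : Submodule R M) : F →ₗ[R] F →ₗ[R] R :=
  b.compl₁₂ F.subtype F.subtype

theorem resB_apply (b : M →ₗ[R] M →ₗ[R] R) (F : Submodule R M) (x y : F) :
    resB b F x y = b x y := rfl

theorem glue (b : M →ₗ[R] M →ₗ[R] R) (hs : ∀ x y, b x y = b y x)
    (g : Module.End R M) (hg : IsIso b g) (N : ℕ)
    (hN : IsUnit (N : R)) (hgN : g ^ N = 1)
    (h : Module.End R (fixS g)) (hh : IsIso (resB b (fixS g)) h) (hhN : h ^ N = 1)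
    (hfix : ∀ x, h x = x → x = 0) :
    ∃ G : Module.End R M, IsIso b G ∧ G ^ N = 1 ∧ (∀ m, G ^ m = 1 → g ^ m = 1) ∧
      ∀ x, G x = x → x = 0 := by
  obtain ⟨π, h1, h2, h3, h4⟩ := exists_avg b g hg N hN hgN
  let P : M →ₗ[R] fixS g := π.codRestrict (fixS g) (fun x => (mem_fixS g _).2 (h1 x))
  have hP : ∀ x, ((P x : fixS g) : M) = π x := fun x => rfl
  let G : Module.End R M := (fixS g).subtype ∘ₗ h ∘ₗ P + g - π
  have hG : ∀ x, G x = (h (P x) : M) + g x - π x := fun x => rfl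
  have hhf : ∀ y : fixS g, g (y : M) = y := fun y => (mem_fixS g _).1 y.2
  have hPf : ∀ y : fixS g, P (y : M) = y := fun y => Subtype.ext (h2 _ (hhf y))
  have hππ : ∀ x, π (π x) = π x := fun x => h2 _ (h1 x)
  have hPG : ∀ x, P (G x) = h (P x) := by
    intro x
    apply Subtype.ext
    rw [hP, hG, map_sub, map_add, h4, hππ, add_sub_cancel_right, h2 _ (hhf _)]
  have hPGm : ∀ m x, P ((G ^ m) x) = (h ^ m) (P x) := by
    intro m
    induction m with
    | zero => intro x; simp
    | succ m ih => intro x; rw [pow_succ, pow_succ, Module.End.mul_apply, ih, hPG]; rfl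
  have hGm : ∀ m x, (G ^ m) x = ((h ^ m) (P x) : M) + (g ^ m) x - π x := by
    intro m
    induction m with
    | zero => intro x; simp [hP]
    | succ m ih =>
      intro x
      rw [pow_succ, Module.End.mul_apply, ih, hPG, ← hP, hPG, pow_succ, pow_succ,
        Module.End.mul_apply, Module.End.mul_apply, hG, map_sub, map_add, pow_fix g _ (hhf _),
        pow_fix g _ (h1 _)]
      abel
  have hGsub : ∀ x, π (x - π x) = 0 := by intro x; rw [map_sub, hππ, sub_self]
  have hPsub : ∀ x, P (x - π x) = 0 := fun x => Subtype.ext (hGsub x)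
  refine ⟨G, ?_, ?_, ?_, ?_⟩
  · intro x y
    have e1 : ∀ f z, g f = f → b f (g z) = b f z := by
      intro f z hf
      have := hg f z
      rwa [hf] at this
    have e2 : b (h (P x) : M) (h (P y) : M) = b (π x) y := by
      have := hh (P x) (P y)
      rw [resB_apply, resB_apply] at this
      rw [this, hP, hP, h3 _ _ (h1 x)]
    have a1 := e1 (h (P x)) y (hhf _)
    have a2 := e1 (h (P y)) x (hhf _)
    have a3 := h3 (h (P x)) y (hhf _)
    have a4 := h3 (h (P y)) x (hhf _)
    have a5 := e1 (π x) y (h1 _)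
    have a6 := e1 (π y) x (h1 _)
    have a7 := h3 (π x) y (h1 _)
    have a8 := h3 (π y) x (h1 _)
    rw [hs _ x] at a8 a6 a4 a2
    rw [hs _ (g x)] at a6 a2
    rw [hs _ (π x)] at a8 a4
    rw [hG, hG]
    simp only [map_sub, map_add, LinearMap.sub_apply, LinearMap.add_apply]
    rw [e2, hg, a1, a2, a3, a4, a5, a6, a7]
    rw [a7] at a8
    rw [← a8]
    ring
  · ext x
    rw [hGm, hhN, hgN, Module.End.one_apply, Module.End.one_apply, hP]
    simp
  · intro m hm
    ext x
    have := hGm m (x - π x)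
    rw [hm, hPsub, hGsub, map_zero, map_sub (g ^ m), pow_fix g _ (h1 _)] at this
    simp only [Module.End.one_apply, ZeroMemClass.coe_zero, zero_add, sub_zero] at this
    rw [Module.End.one_apply]
    exact (sub_left_injective this).symm
  · intro x hx
    have := hPG x
    rw [hx] at this
    have h0 := hfix _ this.symm
    have h0' : π x = 0 := by rw [← hP, h0]; rfl
    have := hG x
    rw [hx, h0, h0', map_zero] at this
    simp only [ZeroMemClass.coe_zero, zero_add, sub_zero] at this
    rw [← h2 x this.symm, h0']

/-- the inductive property of the form -/
structure Good (ϖ : R) (q : ℕ) (b : M →ₗ[R] M →ₗ[R] R) : Prop where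
  symm : ∀ x y, b x y = b y x
  prim : ∀ x, (∀ y, ¬ IsUnit (b x y)) → ∃ z, x = ϖ • z
  count : ∀ c : R, IsUnit c → q ∣ Nat.card {x : M // b x x = c}

theorem Good.descend [Finite M] {ϖ : R} {q : ℕ} (hq : q.Prime) (hqu : IsUnit (q : R))
    {b : M →ₗ[R] M →ₗ[R] R} (hb : Good ϖ q b) (g : Module.End R M) (hg : IsIso b g) (r : ℕ)
    (hgr : g ^ q ^ r = 1) : Good ϖ q (resB b (fixS g)) := by
  have hN : IsUnit ((q ^ r : ℕ) : R) := by push_cast; exact hqu.pow r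
  obtain ⟨π, h1, h2, h3, h4⟩ := exists_avg b g hg _ hN hgr
  refine ⟨fun x y => hb.symm _ _, ?_, ?_⟩
  · intro x hx
    have hxf : g (x : M) = x := (mem_fixS g _).1 x.2
    obtain ⟨z, hz⟩ := hb.prim (x : M) (fun y => by
      rw [← h3 _ y hxf]
      exact hx ⟨π y, (mem_fixS g _).2 (h1 y)⟩)
    refine ⟨⟨π z, (mem_fixS g _).2 (h1 z)⟩, Subtype.ext ?_⟩
    rw [← h2 _ hxf, hz, map_smul]; rfl
  · intro c hc
    classical
    have := Fact.mk hq
    have : Fintype {x : M // b x x = c} := Fintype.ofFinite _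
    have := hb.count c hc
    let f : Function.End {x : M // b x x = c} := fun x => ⟨g x.1, by rw [hg]; exact x.2⟩
    have hfm : ∀ m x, ((f ^ m) x).1 = (g ^ m) x.1 := by
      intro m
      induction m with
      | zero => intro x; rfl
      | succ m ih =>
        intro x
        rw [pow_succ, pow_succ]
        exact ih (f x)
    have hf : f ^ q ^ r = 1 := by
      funext x
      apply Subtype.ext
      rw [hfm, hgr]; rfl
    have h5 := Equiv.Perm.card_fixedPoints_modEq hf
    rw [← Nat.card_eq_fintype_card, ← Nat.card_eq_fintype_card] at h5
    have h6 : Nat.card (Function.fixedPoints f) = Nat.card {x : fixS g // resB b (fixS g) x x = c} := by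
      refine Nat.card_congr ⟨fun x => ⟨⟨x.1.1, (mem_fixS g _).2 (congrArg Subtype.val x.2)⟩, x.1.2⟩,
        fun x => ⟨⟨x.1.1, x.2⟩, Subtype.ext ((mem_fixS g _).1 x.1.2)⟩, fun x => rfl, fun x => rfl⟩
    rw [← h6]
    exact (h5.dvd_iff dvd_rfl).1 this

theorem exists_refl (b : M →ₗ[R] M →ₗ[R] R) (hs : ∀ x y, b x y = b y x) (y : M)
    (hy : IsUnit (b y y)) : ∃ s : M ≃ₗ[R] M, (∀ x z, b (s x) (s z) = b x z) ∧
      ∀ x, b y y • s x = b y y • x - (2 * b y x) • y := by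
  obtain ⟨u, hu⟩ := hy
  have hc : (↑u⁻¹ : R) * b y y = 1 := by rw [← hu]; simp
  have hf : ((2 * (↑u⁻¹ : R)) • b y) y = 2 := by
    rw [LinearMap.smul_apply, smul_eq_mul, mul_assoc, hc, mul_one]
  refine ⟨Module.reflection hf, ?_, ?_⟩
  · intro x z
    simp only [Module.reflection_apply, map_sub, map_smul, LinearMap.sub_apply,
      LinearMap.smul_apply, smul_eq_mul]
    rw [hs x y]
    linear_combination (4 * (↑u⁻¹ : R) * b y x * b y z) * hc
  · intro x
    simp only [Module.reflection_apply, smul_sub, LinearMap.smul_apply, smul_eq_mul, smul_smul]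
    congr 2
    linear_combination (2 * b y x) * hc

theorem transitive [IsLocalRing R] (h2 : IsUnit (2 : R)) (b : M →ₗ[R] M →ₗ[R] R)
    (hs : ∀ x y, b x y = b y x) (x y : M) (hx : IsUnit (b x x)) (hxy : b x x = b y y) :
    ∃ s : M ≃ₗ[R] M, (∀ x z, b (s x) (s z) = b x z) ∧ s x = y := by
  have hsum : b (x - y) (x - y) + b (x + y) (x + y) = 2 * 2 * b x x := by
    simp only [map_sub, map_add, LinearMap.sub_apply, LinearMap.add_apply]
    linear_combination (-2) * hxy
  have hU : IsUnit (b (x - y) (x - y) + b (x + y) (x + y)) := by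
    rw [hsum]; exact (h2.mul h2).mul hx
  rcases IsLocalRing.isUnit_or_isUnit_of_isUnit_add hU with h | h
  · obtain ⟨s, h1, h3⟩ := exists_refl b hs _ h
    refine ⟨s, h1, ?_⟩
    apply (h.smul_left_cancel).1
    rw [h3, sub_eq_iff_eq_add, ← sub_eq_iff_eq_add', ← smul_sub]
    congr 1
    simp only [map_sub, LinearMap.sub_apply]
    rw [hs y x]
    linear_combination (-1) * hxy
  · obtain ⟨s, h1, h3⟩ := exists_refl b hs _ h
    refine ⟨s.trans (LinearEquiv.neg R), ?_, ?_⟩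
    · intro x z
      simp [h1]
    · have : s x = - y := by
        apply (h.smul_left_cancel).1
        rw [h3, sub_eq_iff_eq_add, ← sub_eq_iff_eq_add', ← smul_sub, sub_neg_eq_add]
        congr 1
        simp only [map_add, LinearMap.add_apply]
        rw [hs y x]
        linear_combination (-1) * hxy
      simp [this]

/-- the orthogonal group -/
def OG (b : M →ₗ[R] M →ₗ[R] R) : Subgroup (M ≃ₗ[R] M) where
  carrier := {s | ∀ x z, b (s x) (s z) = b x z}
  mul_mem' := by
    intro s t hs ht x z
    rw [LinearEquiv.mul_apply, LinearEquiv.mul_apply, hs, ht]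
  one_mem' := fun x z => rfl
  inv_mem' := by
    intro s hs x z
    have := hs (s⁻¹ x) (s⁻¹ z)
    rw [← this, ← LinearEquiv.mul_apply, ← LinearEquiv.mul_apply, mul_inv_cancel]
    rfl

theorem exists_order_q [IsLocalRing R] [Finite M] [Nontrivial M] {ϖ : R} (hϖ : IsNilpotent ϖ)
    (h2 : IsUnit (2 : R)) {q : ℕ} (hq : q.Prime) {b : M →ₗ[R] M →ₗ[R] R} (hb : Good ϖ q b) :
    ∃ g : Module.End R M, IsIso b g ∧ g ^ q = 1 ∧ g ≠ 1 := by
  have hx0 : ∃ x, IsUnit (b x x) := by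
    by_contra! hno
    have hall : ∀ x y, ¬ IsUnit (b x y) := by
      intro x y hxy
      have hU : IsUnit (b (x + y) (x + y) + (- b x x + - b y y)) := by
        have : b (x + y) (x + y) + (- b x x + - b y y) = 2 * b x y := by
          simp only [map_add, LinearMap.add_apply]
          rw [hb.symm y x]; ring
        rw [this]; exact h2.mul hxy
      rcases IsLocalRing.isUnit_or_isUnit_of_isUnit_add hU with h | h
      · exact hno _ h
      · rcases IsLocalRing.isUnit_or_isUnit_of_isUnit_add h with h | h
        · exact hno x (by simpa using h)
        · exact hno y (by simpa using h)
    have hdiv : ∀ m, ∀ x : M, ∃ z, x = ϖ ^ m • z := by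
      intro m
      induction m with
      | zero => intro x; exact ⟨x, by simp⟩
      | succ m ih =>
        intro x
        obtain ⟨z, hz⟩ := ih x
        obtain ⟨w, hw⟩ := hb.prim z (hall z)
        exact ⟨w, by rw [hz, hw, smul_smul, pow_succ]⟩
    obtain ⟨m, hm⟩ := hϖ
    obtain ⟨x, hx⟩ := exists_ne (0 : M)
    obtain ⟨z, hz⟩ := hdiv m x
    rw [hm, zero_smul] at hz
    exact hx hz
  obtain ⟨x0, hx0⟩ := hx0
  have : Finite (M ≃ₗ[R] M) := Finite.of_injective (fun s : M ≃ₗ[R] M => (s : M → M)) DFunLike.coe_injective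
  classical
  have : Fintype (OG b) := Fintype.ofFinite _
  have : Fintype (MulAction.orbit (OG b) x0) := Fintype.ofFinite _
  have : Fintype (MulAction.stabilizer (OG b) x0) := Fintype.ofFinite _
  have hcard := MulAction.card_orbit_mul_card_stabilizer_eq_card_group (OG b) x0
  have horb : MulAction.orbit (OG b) x0 = {x : M | b x x = b x0 x0} := by
    ext x
    constructor
    · rintro ⟨s, rfl⟩
      exact s.2 x0 x0
    · intro hx
      obtain ⟨s, hs1, hs2⟩ := transitive h2 b hb.symm x0 x hx0 hx.symm
      exact ⟨⟨s, hs1⟩, hs2⟩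
  have hdvd : q ∣ Nat.card (OG b) := by
    have := hb.count _ hx0
    rw [Nat.card_eq_fintype_card, ← hcard, ← Nat.card_eq_fintype_card, horb]
    exact Dvd.dvd.mul_right this _
  have := Fact.mk hq
  obtain ⟨s, hs⟩ := exists_prime_orderOf_dvd_card' q hdvd
  have hsq : (s : M ≃ₗ[R] M) ^ q = 1 := by
    have := pow_orderOf_eq_one s
    rw [hs] at this
    simpa using congrArg Subtype.val this
  have hpow : ∀ m x, (((s : M ≃ₗ[R] M) : Module.End R M) ^ m) x = ((s : M ≃ₗ[R] M) ^ m) x := by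
    intro m
    induction m with
    | zero => intro x; rfl
    | succ m ih => intro x; rw [pow_succ, pow_succ]; exact ih _
  refine ⟨((s : M ≃ₗ[R] M) : Module.End R M), s.2, ?_, ?_⟩
  · ext x
    rw [hpow, hsq]; rfl
  · intro h
    have : s = 1 := by
      apply Subtype.ext
      ext x
      exact LinearMap.congr_fun h x
    rw [this, orderOf_one] at hs
    exact hq.one_lt.ne hs

end modulePart

theorem main_ind {R : Type} [CommRing R] [IsLocalRing R] {ϖ : R} (hϖ : IsNilpotent ϖ)
    (h2 : IsUnit (2 : R)) {q : ℕ} (hq : q.Prime) (hqu : IsUnit (q : R)) (N : ℕ) :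
    ∀ (M : Type) [AddCommGroup M] [Module R M] [Finite M] (b : M →ₗ[R] M →ₗ[R] R),
      Nat.card M = N → Good ϖ q b →
      ∃ g : Module.End R M, IsIso b g ∧ g ^ q = 1 ∧ ∀ x, g x = x → x = 0 := by
  induction N using Nat.strong_induction_on with
  | _ N ih =>
    intro M _ _ _ b hcard hb
    rcases subsingleton_or_nontrivial M with hM | hM
    · exact ⟨1, fun x y => rfl, one_pow _, fun x _ => Subsingleton.elim _ _⟩
    · obtain ⟨g, hg, hgq, hg1⟩ := exists_order_q hϖ h2 hq hb
      have hlt : Nat.card (fixS g) < N := by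
        rw [← hcard]
        obtain ⟨x, hx⟩ : ∃ x, g x ≠ x := by
          by_contra! hno
          exact hg1 (LinearMap.ext hno)
        exact Finite.card_subtype_lt (x := x) (fun h => hx ((mem_fixS g x).1 h))
      obtain ⟨h, hh, hhq, hhf⟩ := ih _ hlt (fixS g) (resB b (fixS g)) rfl
        (hb.descend hq hqu g hg 1 (by rwa [pow_one]))
      obtain ⟨G, hG1, hG2, _, hG4⟩ := glue b hb.symm g hg q hqu hgq h hh hhq hhf
      exact ⟨G, hG1, hG2, hG4⟩

theorem main_mod {R : Type} [CommRing R] [IsLocalRing R] {ϖ : R} (hϖ : IsNilpotent ϖ)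
    (h2 : IsUnit (2 : R)) {q : ℕ} (hq : q.Prime) (hqu : IsUnit (q : R))
    (M : Type) [AddCommGroup M] [Module R M] [Finite M] (b : M →ₗ[R] M →ₗ[R] R)
    (hb : Good ϖ q b) (r : ℕ) (hr : 1 ≤ r) (g : Module.End R M) (hg : IsIso b g)
    (hgo : orderOf g = q ^ r) :
    ∃ G : Module.End R M, IsIso b G ∧ orderOf G = q ^ r ∧ ∀ x, G x = x → x = 0 := by
  have hgr : g ^ q ^ r = 1 := by rw [← hgo]; exact pow_orderOf_eq_one g
  obtain ⟨h, hh, hhq, hhf⟩ := main_ind hϖ h2 hq hqu _ (fixS g) (resB b (fixS g)) rfl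
        (hb.descend hq hqu g hg r hgr)
  have hhr : h ^ q ^ r = 1 := by
    obtain ⟨m, hm⟩ := dvd_pow_self q (show r ≠ 0 by omega)
    rw [hm, pow_mul, hhq, one_pow]
  obtain ⟨G, hG1, hG2, hG3, hG4⟩ := glue b hb.symm g hg (q ^ r)
    (by push_cast; exact hqu.pow r) hgr h hh hhr hhf
  refine ⟨G, hG1, Nat.dvd_antisymm (orderOf_dvd_of_pow_eq_one hG2) ?_, hG4⟩
  rw [← hgo]
  exact orderOf_dvd_of_pow_eq_one (hG3 _ (pow_orderOf_eq_one G))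

theorem addChar_sum {A : Type} [AddCommGroup A] (ψ : AddChar A ℂ) {ι : Type} (s : Finset ι)
    (f : ι → A) : ψ (∑ i ∈ s, f i) = ∏ i ∈ s, ψ (f i) := by
  classical
  induction s using Finset.induction_on with
  | empty => simp
  | insert i s hi ih => rw [Finset.sum_insert hi, Finset.prod_insert hi, AddChar.map_add_eq_mul, ih]

theorem gauss_one {p : ℕ} [Fact p.Prime] (hp2 : p ≠ 2) (ψ : AddChar (ZMod p) ℂ)
    (hψ : ψ.IsPrimitive) (a : ZMod p) (ha : a ≠ 0) :
    ∑ x : ZMod p, ψ (a * x ^ 2) = ((quadraticChar (ZMod p) a : ℤ) : ℂ) *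
      gaussSum ((quadraticChar (ZMod p)).ringHomComp (Int.castRingHom ℂ)) ψ := by
  have hF : ringChar (ZMod p) ≠ 2 := by rwa [ZMod.ringChar_zmod_n]
  have h1 : ∑ x : ZMod p, ψ (a * x ^ 2) =
      ∑ y : ZMod p, (((quadraticChar (ZMod p) y : ℤ) : ℂ) + 1) * ψ (a * y) := by
    rw [← Finset.sum_fiberwise (s := Finset.univ) (g := fun x : ZMod p => x ^ 2)]
    refine Finset.sum_congr rfl fun y _ => ?_
    have h2 := quadraticChar_card_sqrts hF y
    rw [Finset.sum_congr rfl (g := fun _ => ψ (a * y))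
      (by intro x hx; rw [(Finset.mem_filter.1 hx).2])]
    rw [Finset.sum_const, nsmul_eq_mul]
    congr 1
    have h3 : ({x : ZMod p | x ^ 2 = y} : Set (ZMod p)).toFinset =
      Finset.univ.filter (fun x => x ^ 2 = y) := by ext; simp
    rw [h3] at h2
    exact_mod_cast h2
  rw [h1]
  simp only [add_mul, one_mul, Finset.sum_add_distrib]
  have h4 : ∑ y : ZMod p, ψ (a * y) = 0 := by
    have := AddChar.sum_mulShift a hψ
    simp only [mul_comm _ a] at this
    rw [this]; simp [ha]
  rw [h4, add_zero]
  have h5 := gaussSum_mulShift_eq ((quadraticChar (ZMod p)).ringHomComp (Int.castRingHom ℂ)) ψ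
    (Units.mk0 a ha)
  have hquad : ((quadraticChar (ZMod p)).ringHomComp (Int.castRingHom ℂ)).IsQuadratic :=
    (quadraticChar_isQuadratic (ZMod p)).comp _
  rw [hquad.inv] at h5
  simpa [gaussSum, AddChar.mulShift_apply] using h5

theorem count_diag {p : ℕ} [Fact p.Prime] (hp2 : p ≠ 2) {n h : ℕ} (hn : n = 2 * h)
    (a : Fin n → ZMod p) (ha : ∀ i, a i ≠ 0) (c : ZMod p) (hc : c ≠ 0) :
    (p : ℤ) * (Finset.univ.filter (fun x : Fin n → ZMod p => ∑ i, a i * x i ^ 2 = c)).card =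
      p ^ n - quadraticChar (ZMod p) (∏ i, a i) * quadraticChar (ZMod p) (-1) ^ h * p ^ h := by
  have hF : ringChar (ZMod p) ≠ 2 := by rwa [ZMod.ringChar_zmod_n]
  set ψ : AddChar (ZMod p) ℂ := ZMod.stdAddChar
  have hψ : ψ.IsPrimitive := ZMod.isPrimitive_stdAddChar p
  set χ := quadraticChar (ZMod p) with hχ
  set g := gaussSum (χ.ringHomComp (Int.castRingHom ℂ)) ψ with hg
  have hg2 : g ^ 2 = ((χ (-1) : ℤ) : ℂ) * p := by
    have := gaussSum_sq (χ := χ.ringHomComp (Int.castRingHom ℂ)) (by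
      intro h1
      obtain ⟨a, ha⟩ := quadraticChar_exists_neg_one' hF
      have := congrArg (fun f : MulChar (ZMod p) ℂ => f a) h1
      simp only [MulChar.ringHomComp_apply, hχ, ha, MulChar.one_apply_coe] at this
      norm_num at this) ((quadraticChar_isQuadratic (ZMod p)).comp _) hψ
    simpa using this
  have hgn : g ^ n = ((χ (-1) : ℤ) : ℂ) ^ h * p ^ h := by
    rw [hn, pow_mul, hg2, mul_pow]
  have hinner : ∀ t : ZMod p, t ≠ 0 → ∑ x : Fin n → ZMod p, ψ (t * (∑ i, a i * x i ^ 2 - c)) =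
      ψ (t * (-c)) * (((χ (∏ i, a i) : ℤ) : ℂ) * (((χ (-1) : ℤ) : ℂ) ^ h * p ^ h)) := by
    intro t ht
    have htn : quadraticChar (ZMod p) (t ^ n) = 1 := by
      rw [hn, pow_mul, map_pow, quadraticChar_sq_one' ht, one_pow]
    have e1 : ∀ x : Fin n → ZMod p, ψ (t * (∑ i, a i * x i ^ 2 - c)) =
        ψ (t * (-c)) * ∏ i, ψ ((t * a i) * x i ^ 2) := by
      intro x
      rw [← addChar_sum, ← AddChar.map_add_eq_mul]
      congr 1
      rw [mul_sub, Finset.mul_sum, mul_neg, neg_add_eq_sub]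
      simp only [mul_assoc]
    rw [Finset.sum_congr rfl (fun x _ => e1 x), ← Finset.mul_sum]
    congr 1
    have e2 := Finset.prod_univ_sum (fun _ : Fin n => (Finset.univ : Finset (ZMod p)))
      (fun i x => ψ ((t * a i) * x ^ 2))
    rw [Fintype.piFinset_univ] at e2
    rw [← e2, Finset.prod_congr rfl (fun i _ => gauss_one hp2 ψ hψ _ (mul_ne_zero ht (ha i)))]
    rw [Finset.prod_mul_distrib, Finset.prod_const, Finset.card_univ, Fintype.card_fin, hgn]
    congr 1
    rw [← Int.cast_prod, ← map_prod, Finset.prod_mul_distrib, Finset.prod_const, Finset.card_univ,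
      Fintype.card_fin, map_mul, htn, one_mul]
  have hsum : ∑ t : ZMod p, ∑ x : Fin n → ZMod p, ψ (t * (∑ i, a i * x i ^ 2 - c)) =
      (p : ℂ) * (Finset.univ.filter (fun x : Fin n → ZMod p => ∑ i, a i * x i ^ 2 = c)).card := by
    rw [Finset.sum_comm, Finset.sum_congr rfl (fun x _ => AddChar.sum_mulShift _ hψ)]
    simp only [sub_eq_zero, ZMod.card, Nat.cast_ite, Nat.cast_zero]
    rw [← Finset.sum_filter, Finset.sum_const, nsmul_eq_mul, mul_comm]
  have hsum2 : ∑ t : ZMod p, ∑ x : Fin n → ZMod p, ψ (t * (∑ i, a i * x i ^ 2 - c)) =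
      (p : ℂ) ^ n - (((χ (∏ i, a i) : ℤ) : ℂ) * (((χ (-1) : ℤ) : ℂ) ^ h * p ^ h)) := by
    rw [← Finset.add_sum_erase _ _ (Finset.mem_univ (0 : ZMod p))]
    rw [Finset.sum_congr rfl (fun t ht => hinner t (Finset.ne_of_mem_erase ht)), ← Finset.sum_mul]
    have e3 := AddChar.sum_mulShift (-c) hψ
    rw [← Finset.add_sum_erase _ _ (Finset.mem_univ (0 : ZMod p))] at e3
    simp only [zero_mul, AddChar.map_zero_eq_one, neg_eq_zero, hc, if_false, Nat.cast_zero] at e3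
    rw [eq_neg_of_add_eq_zero_right e3]
    simp [sub_eq_add_neg, ZMod.card]
  rw [hsum] at hsum2
  have : ((p : ℤ) * ((Finset.univ.filter (fun x : Fin n → ZMod p => ∑ i, a i * x i ^ 2 = c)).card : ℤ) : ℂ) =
      ((p ^ n - χ (∏ i, a i) * χ (-1) ^ h * p ^ h : ℤ) : ℂ) := by
    push_cast
    rw [hsum2, mul_assoc]
  exact_mod_cast this

theorem exists_diag_s14 {p : ℕ} [Fact p.Prime] (hp2 : p ≠ 2) {n : ℕ}
    (B : Matrix (Fin n) (Fin n) (ZMod p)) (hB : B.IsSymm) :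
    ∃ (P : Matrix (Fin n) (Fin n) (ZMod p)) (a : Fin n → ZMod p), IsUnit P.det ∧
      Pᵀ * B * P = Matrix.diagonal a := by
  have : Invertible (2 : ZMod p) := invertibleOfNonzero (by
    intro h
    have : (p : ℕ) ∣ 2 := (ZMod.natCast_eq_zero_iff 2 p).1 (by exact_mod_cast h)
    exact hp2 ((Nat.prime_dvd_prime_iff_eq Fact.out Nat.prime_two).1 this))
  have hsym : LinearMap.IsSymm (Matrix.toBilin' B) := by
    constructor
    intro x y
    simp only [Matrix.toBilin'_apply', RingHom.id_apply]
    rw [Matrix.dotProduct_mulVec, dotProduct_comm, ← Matrix.mulVec_transpose, hB.eq]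
  obtain ⟨v, hv⟩ := LinearMap.BilinForm.exists_orthogonal_basis hsym
  have hfr : Module.finrank (ZMod p) (Fin n → ZMod p) = n := by simp
  let w := v.reindex (finCongr hfr)
  let P := (Pi.basisFun (ZMod p) (Fin n)).toMatrix w
  have hPe : ∀ i j, P i j = w j i := fun i j => by simp [P, Module.Basis.toMatrix_apply]
  refine ⟨P, fun i => (Pᵀ * B * P) i i, ?_, ?_⟩
  · have := (Pi.basisFun (ZMod p) (Fin n)).invertibleToMatrix w
    exact (Matrix.isUnit_iff_isUnit_det _).1 (isUnit_of_invertible P)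
  · ext i j
    by_cases hij : i = j
    · subst hij; simp
    · rw [Matrix.diagonal_apply_ne _ hij]
      have h1 : (Pᵀ * B * P) i j = Matrix.toBilin' B (w i) (w j) := by
        rw [Matrix.toBilin'_apply', Matrix.mul_assoc, Matrix.mul_apply]
        simp only [dotProduct, Matrix.transpose_apply, hPe, Matrix.mul_apply, Matrix.mulVec]
      rw [h1]
      have := hv (i := (finCongr hfr).symm i) (j := (finCongr hfr).symm j) (by simpa using hij)
      simpa [w] using this

theorem count_form {p : ℕ} [Fact p.Prime] (hp2 : p ≠ 2) {n h : ℕ} (hn : n = 2 * h)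
    (B : Matrix (Fin n) (Fin n) (ZMod p)) (hB : B.IsSymm) (hd : B.det ≠ 0)
    (c : ZMod p) (hc : c ≠ 0) :
    (p : ℤ) * (Finset.univ.filter (fun x : Fin n → ZMod p => x ⬝ᵥ B *ᵥ x = c)).card =
      p ^ n - quadraticChar (ZMod p) B.det * quadraticChar (ZMod p) (-1) ^ h * p ^ h := by
  obtain ⟨P, a, hP, hPB⟩ := exists_diag_s14 hp2 B hB
  have hdet : ∏ i, a i = P.det ^ 2 * B.det := by
    rw [← Matrix.det_diagonal, ← hPB, Matrix.det_mul, Matrix.det_mul, Matrix.det_transpose]; ring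
  have ha : ∀ i, a i ≠ 0 := by
    have : ∏ i, a i ≠ 0 := by rw [hdet]; exact mul_ne_zero (pow_ne_zero _ hP.ne_zero) hd
    intro i
    exact Finset.prod_ne_zero_iff.1 this i (Finset.mem_univ i)
  have h1 := count_diag hp2 hn a ha c hc
  rw [hdet, map_mul, quadraticChar_sq_one' hP.ne_zero, one_mul] at h1
  rw [← h1]
  congr 2
  symm
  have hPu : IsUnit P := (Matrix.isUnit_iff_isUnit_det _).2 hP
  have hbij : Function.Bijective P.mulVec := 
    Finite.injective_iff_bijective.1 (Matrix.mulVec_injective_of_isUnit hPu)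
  refine Finset.card_bijective P.mulVec hbij ?_
  intro x
  have : ∑ i, a i * x i ^ 2 = (P *ᵥ x) ⬝ᵥ B *ᵥ (P *ᵥ x) := by
    have e : (P *ᵥ x) ⬝ᵥ B *ᵥ (P *ᵥ x) = x ⬝ᵥ (Pᵀ * B * P) *ᵥ x := by
      rw [← Matrix.mulVec_mulVec, ← Matrix.mulVec_mulVec, Matrix.dotProduct_mulVec x Pᵀ,
        Matrix.vecMul_transpose]
    rw [e, hPB]
    simp only [dotProduct, Matrix.mulVec_diagonal]
    exact Finset.sum_congr rfl fun i _ => by ring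
  simp [this]

section ringPart

variable {p k : ℕ}

/-- reduction mod p -/
def red (p k : ℕ) (hk : 1 ≤ k) : ZMod (p ^ k) →+* ZMod p :=
  ZMod.castHom (dvd_pow_self p (Nat.one_le_iff_ne_zero.1 hk)) (ZMod p)

theorem red_nat (hk : 1 ≤ k) (m : ℕ) : red p k hk m = m := map_natCast _ m

theorem red_surj (hk : 1 ≤ k) : Function.Surjective (red p k hk) :=
  ZMod.ringHom_surjective _

theorem isUnit_red (hp : p.Prime) (hk : 1 ≤ k) (a : ZMod (p ^ k)) :
    IsUnit a ↔ red p k hk a ≠ 0 := by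
  have : NeZero (p ^ k) := ⟨(pow_pos hp.pos k).ne'⟩
  rw [← ZMod.natCast_zmod_val a, ZMod.isUnit_iff_coprime, red_nat, Ne, ZMod.natCast_eq_zero_iff,
    Nat.coprime_pow_right_iff hk, Nat.coprime_comm, hp.coprime_iff_not_dvd]

theorem dvd_of_red (hp : p.Prime) (hk : 1 ≤ k) (a : ZMod (p ^ k)) (ha : red p k hk a = 0) :
    (p : ZMod (p ^ k)) ∣ a := by
  have : NeZero (p ^ k) := ⟨(pow_pos hp.pos k).ne'⟩
  rw [← ZMod.natCast_zmod_val a, red_nat, ZMod.natCast_eq_zero_iff] at ha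
  rw [← ZMod.natCast_zmod_val a]
  exact Nat.cast_dvd_cast ha

theorem local_R (hp : p.Prime) (hk : 1 ≤ k) : IsLocalRing (ZMod (p ^ k)) := by
  have : Fact (1 < p ^ k) := ⟨Nat.one_lt_pow (by omega) hp.one_lt⟩
  refine IsLocalRing.of_nonunits_add ?_
  intro a b ha hb
  rw [mem_nonunits_iff, isUnit_red hp hk, not_not] at *
  rw [map_add, ha, hb, add_zero]

theorem sq_of_one (hp : p.Prime) (hp2 : p ≠ 2) (hk : 1 ≤ k) (u : ZMod (p ^ k))
    (hu : red p k hk u = 1) : ∃ w, u = w ^ 2 ∧ red p k hk w = 1 := by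
  have h1 : (p : ZMod (p ^ k)) ∣ u - 1 := dvd_of_red hp hk _ (by rw [map_sub, hu, map_one, sub_self])
  have h2 := dvd_sub_pow_of_dvd_sub h1 (k - 1)
  have h3 : (p : ZMod (p ^ k)) ^ (k - 1 + 1) = 0 := by
    rw [Nat.sub_add_cancel hk, ← Nat.cast_pow]; exact ZMod.natCast_self _
  rw [h3, zero_dvd_iff, one_pow, sub_eq_zero] at h2
  have hodd : Odd (p ^ (k - 1)) := (hp.odd_of_ne_two hp2).pow
  obtain ⟨m, hm⟩ := hodd
  refine ⟨u ^ (m + 1), ?_, by rw [map_pow, hu, one_pow]⟩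
  rw [← pow_mul, show (m + 1) * 2 = p ^ (k - 1) + 1 by rw [hm]; ring, pow_succ, h2, one_mul]

theorem sq_lift (hp : p.Prime) (hp2 : p ≠ 2) (hk : 1 ≤ k) (a b : ZMod (p ^ k))
    (ha : IsUnit a) (hab : red p k hk a = red p k hk b) : ∃ w, IsUnit w ∧ b = a * w ^ 2 := by
  have : Fact p.Prime := ⟨hp⟩
  obtain ⟨u, rfl⟩ := ha
  have hne := (isUnit_red hp hk _).1 u.isUnit
  have hm : red p k hk (↑u⁻¹ * b) = 1 := by
    rw [map_mul, ← hab, ← map_mul, Units.inv_mul, map_one]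
  obtain ⟨w, hw1, hw2⟩ := sq_of_one hp hp2 hk _ hm
  refine ⟨w, (isUnit_red hp hk _).2 (by rw [hw2]; exact one_ne_zero), ?_⟩
  rw [← hw1, Units.mul_inv_cancel_left]

theorem isSquare_red (hp : p.Prime) (hp2 : p ≠ 2) (hk : 1 ≤ k) (a : ZMod (p ^ k))
    (ha : IsUnit a) : IsSquare a ↔ IsSquare (red p k hk a) := by
  constructor
  · exact fun h => h.map _
  · rintro ⟨y, hy⟩
    obtain ⟨w, rfl⟩ := red_surj hk y
    rw [← map_mul] at hy
    have hww : IsUnit (w * w) := by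
      rw [isUnit_red hp hk, ← hy]; exact (isUnit_red hp hk _).1 ha
    obtain ⟨v, hv, rfl⟩ := sq_lift hp hp2 hk _ _ hww hy.symm
    exact ⟨w * v, by ring⟩

theorem count_R (hp : p.Prime) (hp2 : p ≠ 2) (hk : 1 ≤ k) {n q : ℕ} (hq : q.Prime) (hpq : p ≠ q)
    (B : Matrix (Fin n) (Fin n) (ZMod (p ^ k))) (c : ZMod (p ^ k)) (hc : IsUnit c)
    (hcount : q ∣ Nat.card {z : Fin n → ZMod p // z ⬝ᵥ (B.map (red p k hk)) *ᵥ z = red p k hk c}) :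
    q ∣ Nat.card {x : Fin n → ZMod (p ^ k) // x ⬝ᵥ B *ᵥ x = c} := by
  classical
  have : NeZero (p ^ k) := ⟨(pow_pos hp.pos k).ne'⟩
  have : NeZero p := ⟨hp.ne_zero⟩
  set φ := red p k hk with hφ
  have hQ : ∀ x : Fin n → ZMod (p ^ k), φ (x ⬝ᵥ B *ᵥ x) = (φ ∘ x) ⬝ᵥ (B.map φ) *ᵥ (φ ∘ x) := by
    intro x
    rw [RingHom.map_dotProduct]
    congr 1
    funext i
    simp [RingHom.map_mulVec]
  let S : Finset (Fin n → ZMod (p ^ k)) := Finset.univ.filter (fun x => φ (x ⬝ᵥ B *ᵥ x) = φ c)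
  let T : Finset (Fin n → ZMod p) :=
    Finset.univ.filter (fun z => z ⬝ᵥ (B.map φ) *ᵥ z = φ c)
  let X : ZMod (p ^ k) → Finset (Fin n → ZMod (p ^ k)) := fun c' =>
    Finset.univ.filter (fun x => x ⬝ᵥ B *ᵥ x = c')
  have hT : q ∣ T.card := by
    rwa [Nat.card_eq_fintype_card, Fintype.card_subtype] at hcount
  let Φ : (Fin n → ZMod (p ^ k)) →+ (Fin n → ZMod p) := AddMonoidHom.compLeft φ.toAddMonoidHom (Fin n)
  have hΦ : ∀ x, Φ x = φ ∘ x := fun x => rfl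
  have hΦs : Function.Surjective Φ := by
    intro z
    choose f hf using red_surj (p := p) hk
    exact ⟨fun i => f (z i), funext fun i => hf _⟩
  have hS1 : S.card = T.card * (Finset.univ.filter (fun x => Φ x = 0)).card := by
    rw [Finset.card_eq_sum_card_fiberwise (f := Φ) (t := T)]
    · rw [Finset.sum_const_nat]
      intro z hz
      rw [← AddMonoidHom.card_fiber_eq_of_mem_range Φ (hΦs z) (hΦs 0)]
      congr 1
      ext x
      simp only [S, Finset.mem_filter, Finset.mem_univ, true_and]
      constructor
      · exact fun h => h.2
      · intro h
        refine ⟨?_, h⟩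
        rw [hQ, ← hΦ, h]
        simpa [T] using hz
    · intro x hx
      simp only [S, T, Finset.coe_filter, Finset.mem_univ, true_and, Set.mem_ofPred_eq] at hx ⊢
      rw [hΦ, ← hQ, hx]
  have hX : ∀ c', φ c' = φ c → (X c').card = (X c).card := by
    intro c' hc'
    obtain ⟨w, hw, rfl⟩ := sq_lift hp hp2 hk c c' hc hc'.symm
    symm
    refine Finset.card_bijective (fun x => w • x) ?_ ?_
    · obtain ⟨u, rfl⟩ := hw
      exact MulAction.bijective u
    · intro x
      simp only [X, Finset.mem_filter, Finset.mem_univ, true_and, Matrix.mulVec_smul,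
        smul_dotProduct, dotProduct_smul, smul_eq_mul]
      rw [← mul_assoc, ← sq, mul_comm c, (hw.pow 2).mul_right_inj]
  have hS2 : S.card = (Finset.univ.filter (fun c' => φ c' = φ c)).card * (X c).card := by
    rw [Finset.card_eq_sum_card_fiberwise (f := fun x => x ⬝ᵥ B *ᵥ x)
      (t := Finset.univ.filter (fun c' => φ c' = φ c))]
    · rw [Finset.sum_const_nat]
      intro c' hc'
      have hc'2 := (Finset.mem_filter.1 hc').2
      rw [← hX c' hc'2]
      congr 1
      ext x
      simp only [S, X, Finset.mem_filter, Finset.mem_univ, true_and]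
      constructor
      · exact fun h => h.2
      · intro h
        exact ⟨by rw [h, hc'2], h⟩
    · intro x hx
      simpa [S] using hx
  have hfib : p ^ k = p * (Finset.univ.filter (fun c' => φ c' = φ c)).card := by
    have h1 : (Finset.univ : Finset (ZMod (p ^ k))).card = p ^ k := by
      rw [Finset.card_univ, ZMod.card]
    have h2 : (Finset.univ : Finset (ZMod p)).card = p := by
      rw [Finset.card_univ, ZMod.card]
    refine h1.symm.trans ?_
    rw [Finset.card_eq_sum_card_fiberwise (f := φ) (t := Finset.univ)]
    · rw [Finset.sum_const_nat (m := (Finset.univ.filter (fun c' => φ c' = φ c)).card), h2]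
      intro z _
      exact AddMonoidHom.card_fiber_eq_of_mem_range φ (red_surj hk z) ⟨c, rfl⟩
    · intro x _; simp
  have hqfib : ¬ q ∣ (Finset.univ.filter (fun c' => φ c' = φ c)).card := by
    intro h
    have : q ∣ p ^ k := by rw [hfib]; exact h.mul_left p
    exact hpq ((Nat.prime_dvd_prime_iff_eq hq hp).1 (hq.dvd_of_dvd_pow this)).symm
  have hfin : q ∣ (Finset.univ.filter (fun c' => φ c' = φ c)).card * (X c).card := by
    rw [← hS2, hS1]; exact hT.mul_right _
  rw [Nat.card_eq_fintype_card, Fintype.card_subtype]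
  exact (hq.dvd_mul.1 hfin).resolve_left hqfib

end ringPart

theorem eta_spec {p q : ℕ} (hp : p.Prime) (hq : q.Prime) (hpq : p ≠ q) :
    ((p : ZMod q)) ^ minExp p q = (eta p q : ZMod q) := by
  have : Fact q.Prime := ⟨hq⟩
  have hne : {a : ℕ | 0 < a ∧ (q ∣ p ^ a - 1 ∨ q ∣ p ^ a + 1)}.Nonempty := by
    refine ⟨q - 1, Nat.sub_pos_of_lt hq.one_lt, Or.inl ?_⟩
    have h0 : (p : ZMod q) ≠ 0 := by
      rw [Ne, ZMod.natCast_eq_zero_iff]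
      exact fun h => hpq ((Nat.prime_dvd_prime_iff_eq hq hp).1 h).symm
    have h1 := ZMod.pow_card_sub_one_eq_one h0
    rw [← ZMod.natCast_eq_zero_iff, Nat.cast_sub (Nat.one_le_pow _ _ hp.pos)]
    push_cast
    rw [h1, sub_self]
  have hmem := Nat.sInf_mem hne
  change 0 < minExp p q ∧ (q ∣ p ^ minExp p q - 1 ∨ q ∣ p ^ minExp p q + 1) at hmem
  unfold eta
  split_ifs with h
  · rw [← ZMod.natCast_eq_zero_iff, Nat.cast_sub (Nat.one_le_pow _ _ hp.pos)] at h
    push_cast at h ⊢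
    exact sub_eq_zero.1 h
  · have h := hmem.2.resolve_left h
    rw [← ZMod.natCast_eq_zero_iff] at h
    push_cast at h ⊢
    exact eq_neg_of_add_eq_zero_left h

theorem eta_sq (p q : ℕ) : eta p q ^ 2 = 1 := by
  unfold eta; split_ifs <;> norm_num

theorem eps_spec {p k n h : ℕ} [Fact p.Prime] (hp : p.Prime) (hp2 : p ≠ 2) (hk : 1 ≤ k)
    (hn : n = 2 * h)
    (B : Matrix (Fin n) (Fin n) (ZMod (p ^ k))) (hdet : IsUnit B.det) :
    epsilon p B = quadraticChar (ZMod p) (B.map (red p k hk)).det *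
      quadraticChar (ZMod p) (-1) ^ h := by
  have hF : ringChar (ZMod p) ≠ 2 := by rwa [ZMod.ringChar_zmod_n]
  have hd : (B.map (red p k hk)).det = red p k hk B.det := by
    rw [RingHom.map_det]; rfl
  have hne := (isUnit_red hp hk _).1 hdet
  unfold epsilon
  congr 1
  · rw [hd]
    split_ifs with hs
    · exact ((quadraticChar_one_iff_isSquare hne).2 ((isSquare_red hp hp2 hk _ hdet).1 hs)).symm
    · exact (quadraticChar_neg_one_iff_not_isSquare.2
        (fun h => hs ((isSquare_red hp hp2 hk _ hdet).2 h))).symm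
  · rw [quadraticChar_neg_one hF, ZMod.card, ZMod.χ₄_nat_eq_if_mod_four, Fintype.card_fin]
    have hodd : p % 2 = 1 := Nat.odd_iff.1 (hp.odd_of_ne_two hp2)
    have h1 : p % 4 = 1 ∨ p % 4 = 3 := by omega
    rcases h1 with h1 | h1
    · simp [h1, hodd]
    · simp only [h1, hodd, true_and]
      norm_num
      split_ifs with h2
      · exact (Odd.neg_one_pow (Nat.odd_iff.2 (by omega))).symm
      · exact (Even.neg_one_pow (Nat.even_iff.2 (by omega))).symm

theorem good_B (p q : ℕ) (hp : p.Prime) (hq : q.Prime) (hp2 : p ≠ 2)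
    (hpq : p ≠ q) (k : ℕ) (hk : 1 ≤ k) (d : ℕ) (n : ℕ)
    (hn : n = 2 * minExp p q * d)
    (B : Matrix (Fin n) (Fin n) (ZMod (p ^ k))) (hsymm : B.IsSymm) (hdet : IsUnit B.det)
    (heps : epsilon p B = eta p q ^ d) :
    Good (M := Fin n → ZMod (p ^ k)) (p : ZMod (p ^ k)) q (Matrix.toBilin' B) := by
  have : Fact p.Prime := ⟨hp⟩
  have : Fact q.Prime := ⟨hq⟩
  refine ⟨?_, ?_, ?_⟩
  · intro x y
    simp only [Matrix.toBilin'_apply']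
    rw [Matrix.dotProduct_mulVec, dotProduct_comm, ← Matrix.mulVec_transpose, hsymm.eq]
  · intro x hx
    have h1 : ∀ i, ∃ z, (B *ᵥ x) i = p * z := by
      intro i
      have h2 := hx (Pi.single i 1)
      rw [Matrix.toBilin'_apply', Matrix.dotProduct_mulVec, ← Matrix.mulVec_transpose, hsymm.eq,
        dotProduct_single, mul_one, isUnit_red hp hk, not_not] at h2
      exact dvd_of_red hp hk _ h2
    choose z hz using h1
    refine ⟨B⁻¹ *ᵥ z, ?_⟩
    rw [← Matrix.mulVec_smul]
    have h3 : B *ᵥ x = (p : ZMod (p ^ k)) • z := funext hz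
    rw [← h3, Matrix.mulVec_mulVec, Matrix.nonsing_inv_mul _ hdet, Matrix.one_mulVec]
  · intro c hc
    simp only [Matrix.toBilin'_apply']
    apply count_R hp hp2 hk hq hpq B c hc
    have hn' : n = 2 * (minExp p q * d) := by rw [hn, mul_assoc]
    have hd : (B.map (red p k hk)).det = red p k hk B.det := by
      rw [RingHom.map_det]; rfl
    have h1 := count_form hp2 hn' (B.map (red p k hk)) (hsymm.map _)
      (by rw [hd]; exact (isUnit_red hp hk _).1 hdet) (red p k hk c) ((isUnit_red hp hk _).1 hc)
    rw [← eps_spec hp hp2 hk hn' B hdet, heps] at h1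
    rw [Nat.card_eq_fintype_card, Fintype.card_subtype]
    have h2 := congrArg (Int.cast : ℤ → ZMod q) h1
    push_cast at h2
    have h3 : (p : ZMod q) ^ n = 1 := by
      rw [hn, mul_assoc, mul_comm, pow_mul, pow_mul, eta_spec hp hq hpq, ← pow_mul, mul_comm, pow_mul]
      rw [← Int.cast_pow, eta_sq]; simp
    have h4 : (eta p q : ZMod q) ^ d * (p : ZMod q) ^ (minExp p q * d) = 1 := by
      rw [pow_mul, eta_spec hp hq hpq, ← mul_pow, ← sq, ← Int.cast_pow, eta_sq]; simp
    rw [h3, h4, sub_self] at h2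
    have h0 : (p : ZMod q) ≠ 0 := by
      rw [Ne, ZMod.natCast_eq_zero_iff]
      exact fun h => hpq ((Nat.prime_dvd_prime_iff_eq hq hp).1 h).symm
    exact (ZMod.natCast_eq_zero_iff _ _).1 ((mul_eq_zero.1 h2).resolve_left h0)

theorem isIso_iff {R : Type} [CommRing R] {n : ℕ} (B A : Matrix (Fin n) (Fin n) R) :
    IsIso (M := Fin n → R) (Matrix.toBilin' B) (Matrix.toLinAlgEquiv' A) ↔ Aᵀ * B * A = B := by
  have h : ∀ x y, Matrix.toBilin' B (A *ᵥ x) (A *ᵥ y) = Matrix.toBilin' (Aᵀ * B * A) x y := by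
    intro x y
    rw [Matrix.toBilin'_apply', Matrix.toBilin'_apply', ← Matrix.mulVec_mulVec,
      ← Matrix.mulVec_mulVec, Matrix.dotProduct_mulVec x Aᵀ, Matrix.vecMul_transpose]
  constructor
  · intro hA
    apply Matrix.toBilin'.injective
    refine LinearMap.ext fun x => LinearMap.ext fun y => ?_
    rw [← h]
    exact hA x y
  · intro hA x y
    have := h x y
    rw [hA] at this
    exact this

theorem mat_main {R : Type} [CommRing R] [Finite R] [IsLocalRing R] {ϖ : R} (hϖ : IsNilpotent ϖ)
    (h2 : IsUnit (2 : R)) {q : ℕ} (hq : q.Prime) (hqu : IsUnit (q : R)) {n : ℕ}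
    (B : Matrix (Fin n) (Fin n) R)
    (hb : Good (M := Fin n → R) ϖ q (Matrix.toBilin' B)) (r : ℕ) (hr : 1 ≤ r)
    (A : Matrix (Fin n) (Fin n) R) (hA : Aᵀ * B * A = B) (hAo : orderOf A = q ^ r) :
    ∃ C : Matrix (Fin n) (Fin n) R, Cᵀ * B * C = B ∧ orderOf C = q ^ r ∧
      ∀ x : Fin n → R, C.mulVec x = x → x = 0 := by
  have hord : ∀ C : Matrix (Fin n) (Fin n) R,
      orderOf (Matrix.toLinAlgEquiv' C : Module.End R (Fin n → R)) = orderOf C := fun C =>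
    orderOf_injective (Matrix.toLinAlgEquiv' (R := R) (n := Fin n)).toMulEquiv.toMonoidHom
      Matrix.toLinAlgEquiv'.injective C
  obtain ⟨G, hG1, hG2, hG3⟩ := main_mod hϖ h2 hq hqu (Fin n → R) (Matrix.toBilin' B) hb r hr
    (Matrix.toLinAlgEquiv' A) ((isIso_iff B A).2 hA) (by rw [hord, hAo])
  obtain ⟨C, rfl⟩ := Matrix.toLinAlgEquiv'.surjective G
  exact ⟨C, (isIso_iff B C).1 hG1, by rw [← hord, hG2], fun x hx => hG3 x hx⟩

theorem stmt14 (p q : ℕ) (hp : p.Prime) (hq : q.Prime) (hp2 : p ≠ 2) (hq2 : q ≠ 2)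
    (hpq : p ≠ q) (k : ℕ) (hk : 1 ≤ k) (d : ℕ) (hd : 1 ≤ d) (n : ℕ)
    (hn : n = 2 * minExp p q * d)
    (B : Matrix (Fin n) (Fin n) (ZMod (p ^ k))) (hsymm : B.IsSymm) (hdet : IsUnit B.det)
    (heps : epsilon p B = eta p q ^ d)
    (r : ℕ) (hr : 1 ≤ r)
    (hex : ∃ A : Matrix (Fin n) (Fin n) (ZMod (p ^ k)), Aᵀ * B * A = B ∧ orderOf A = q ^ r) :
    ∃ ψ : Matrix (Fin n) (Fin n) (ZMod (p ^ k)), ψᵀ * B * ψ = B ∧ orderOf ψ = q ^ r ∧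
      ∀ x : Fin n → ZMod (p ^ k), ψ.mulVec x = x → x = 0 := by
  obtain ⟨A, hA, hAo⟩ := hex
  have : NeZero (p ^ k) := ⟨(pow_pos hp.pos k).ne'⟩
  have : IsLocalRing (ZMod (p ^ k)) := local_R hp hk
  have hunit : ∀ l : ℕ, l.Prime → p ≠ l → IsUnit (l : ZMod (p ^ k)) := by
    intro l hl hpl
    rw [ZMod.isUnit_iff_coprime]
    exact Nat.Coprime.pow_right k ((Nat.coprime_primes hl hp).2 hpl.symm)
  have hnil : IsNilpotent (p : ZMod (p ^ k)) :=
    ⟨k, by rw [← Nat.cast_pow]; exact ZMod.natCast_self _⟩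
  have h2 : IsUnit (2 : ZMod (p ^ k)) := by
    have := hunit 2 Nat.prime_two hp2
    rwa [Nat.cast_ofNat] at this
  have hfin : Finite (ZMod (p ^ k)) := inferInstance
  exact mat_main hnil h2 hq (hunit q hq hpq) B
    (good_B p q hp hq hp2 hpq k hk d n hn B hsymm hdet heps) r hr A hA hAo
end
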